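/- arXiv:2204.08631 — 2 statements merged into one kernel-verified Lean document; each statement's English description precedes it below -/
import Mathlib

section
/- Let G be a (2K_2, K_3+K_1, C_5+K_1)-free graph with clique number at most 5 (i.e., G is K_6-free). Then G is 7-colorable. -/
open SimpleGraph

/-- `2K_2`: disjoint union of two edges. -/
def twoK2 : SimpleGraph (Fin 4) :=
  SimpleGraph.fromEdgeSet {s(0, 1), s(2, 3)}

/-- `K_3 + K_1`: a triangle plus an isolated vertex. -/
def K3K1 : SimpleGraph (Fin 4) :=
  SimpleGraph.fromEdgeSet {s(0, 1), s(0, 2), s(1, 2)}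

/-- `C_5 + K_1`: a 5-cycle plus an isolated vertex. -/
def C5K1 : SimpleGraph (Fin 6) :=
  SimpleGraph.fromEdgeSet {s(0, 1), s(1, 2), s(2, 3), s(3, 4), s(4, 0)}

/-- The complement of `G` contains neither `C_4`, nor a claw, nor the wheel `W_5`. -/
structure Admissible {V : Type*} (G : SimpleGraph V) : Prop where
  diamondless : ∀ a b c d, G.Adj a c → G.Adj b d → ¬G.Adj a b → ¬G.Adj b c → ¬G.Adj c d →
    ¬G.Adj d a → False
  clawless : ∀ v a b c, G.Adj a b → G.Adj a c → G.Adj b c → ¬G.Adj v a → ¬G.Adj v b →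
    ¬G.Adj v c → False
  wheelless : ∀ v a b c d e, G.Adj a b → G.Adj b c → G.Adj c d → G.Adj d e → G.Adj e a →
    ¬G.Adj a c → ¬G.Adj b d → ¬G.Adj c e → ¬G.Adj d a → ¬G.Adj e b →
    ¬G.Adj v a → ¬G.Adj v b → ¬G.Adj v c → ¬G.Adj v d → ¬G.Adj v e → False

/-- The conditions satisfied by an admissible graph that is a minimal counterexample. -/
structure Reduced {V : Type*} (G : SimpleGraph V) : Prop where
  robust : ∀ t u, G.Adj t u → ∃ a b, G.Adj a b ∧ ¬G.Adj u a ∧ ¬G.Adj u b ∧ G.Adj t a ∧ G.Adj t b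
  undominated : ∀ u v, u ≠ v → ∃ x, G.Adj v x ∧ ¬G.Adj u x

universe u

variable {V : Type u} {G : SimpleGraph V}

theorem Admissible.exists_bipartition (hG : Admissible G) (v : V) :
    ∃ f : V → Bool, ∀ x y, ¬G.Adj v x → ¬G.Adj v y → G.Adj x y → f x ≠ f y := by
  classical
  by_cases h : ∃ a b, ¬G.Adj v a ∧ ¬G.Adj v b ∧ G.Adj a b
  · obtain ⟨a, b, ha, hb, hab⟩ := h
    refine ⟨fun x => decide (G.Adj b x ∨ (¬G.Adj a x ∧ ∃ c, ¬G.Adj v c ∧ G.Adj a c ∧ G.Adj x c)),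
      fun x y hx hy hxy => ?_⟩
    have hs : ∀ x y, G.Adj x y → G.Adj y x := fun _ _ h => h.symm
    have key : ∀ x c d, ¬G.Adj v x → ¬G.Adj v c → ¬G.Adj v d → ¬G.Adj a x → ¬G.Adj b x →
        G.Adj a c → G.Adj b d → G.Adj x c → G.Adj x d → False := by
      intro x c d hx hc hd hax hbx hac hbd hxc hxd
      have h1 := hG.clawless v x c d
      have h2 := hG.wheelless v x c a b d
      have h3 := hG.clawless v a b c
      have h4 := hG.clawless v a b d
      grind
    have h1 := hG.clawless v x y a
    have h2 := hG.clawless v x y b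
    have h3 := hG.diamondless a x b y
    have h4 := hG.clawless v a b x
    have h5 := hG.clawless v a b y
    simp only [ne_eq, decide_eq_decide]
    have k1 := fun c => key x c y
    have k2 := fun c => key y c x
    by_cases bx : G.Adj b x <;> by_cases b_y : G.Adj b y <;> by_cases ax : G.Adj a x <;>
      by_cases ay : G.Adj a y <;> grind
  · exact ⟨fun _ => true, fun x y hx hy hxy => (h ⟨x, y, hx, hy, hxy⟩).elim⟩

theorem exists_mem_not_mem_of_card_le {α : Type*} {P Q : Finset α} (h : P.card ≤ Q.card) {y : α}
    (hy : y ∈ P) (hy' : y ∉ Q) : ∃ z ∈ Q, z ∉ P := by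
  by_contra! hc
  have : Q ⊂ P := ⟨hc, fun h => hy' (h hy)⟩
  exact absurd (Finset.card_lt_card this) (by omega)

/-- `s false` and `s true` represent the two cliques (of the complement) covering the
neighbours of `v`. -/
structure IsSides (G : SimpleGraph V) (v : V) (s : Bool → V) : Prop where
  adj : ∀ i, G.Adj (s i) (s !i)
  not_adj : ∀ i, ¬G.Adj v (s i)
  split : ∀ x, x ≠ v → ¬G.Adj v x → ∀ i, (G.Adj (s i) x ↔ ¬G.Adj (s !i) x)

theorem exists_side [Finite V] (hG : Admissible G) (hR : Reduced G) {v : V} {f : V → Bool}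
    (hf : ∀ x y, ¬G.Adj v x → ¬G.Adj v y → G.Adj x y → f x ≠ f y) {i : Bool}
    (hi : ∃ x, x ≠ v ∧ ¬G.Adj v x ∧ f x = i) :
    ∃ a, a ≠ v ∧ ¬G.Adj v a ∧ f a = i ∧ ∀ y, y ≠ v → ¬G.Adj v y → f y = (!i) → G.Adj a y := by
  classical
  have := Fintype.ofFinite V
  let N : V → Finset V := fun x => {y | y ≠ v ∧ ¬G.Adj v y ∧ f y = (!i) ∧ ¬G.Adj x y}
  obtain ⟨a, ha, hmin⟩ := Finset.exists_min_image
    ({x | x ≠ v ∧ ¬G.Adj v x ∧ f x = i} : Finset V) (fun x => (N x).card)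
    (by obtain ⟨x, hx⟩ := hi; exact ⟨x, by simpa using hx⟩)
  simp only [Finset.mem_filter, Finset.mem_univ, true_and] at ha hmin
  refine ⟨a, ha.1, ha.2.1, ha.2.2, fun y hyv hy hfy => ?_⟩
  by_contra hay
  have hne : ∀ a b : Bool, a ≠ !b → a = b := by decide
  obtain ⟨x, hyx, hvx⟩ := hR.undominated v y hyv.symm
  have hs : ∀ x y, G.Adj x y → G.Adj y x := fun _ _ h => h.symm
  have hxv : x ≠ v := by rintro rfl; exact hy hyx.symm
  have hfx : f x = i := by
    have h1 := hf x y hvx hy hyx.symm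
    rw [hfy] at h1
    exact hne _ _ h1
  obtain ⟨z, hz, hz'⟩ := exists_mem_not_mem_of_card_le (hmin x ⟨hxv, hvx, hfx⟩)
    (y := y) (by simp [N, *]) (by simp [N, hyx.symm])
  simp only [N, Finset.mem_filter, Finset.mem_univ, true_and, not_and, not_not] at hz hz'
  have h1 := hf a x ha.2.1 hvx
  have h2 := hf y z hy hz.2.1
  have h3 := hG.diamondless a y z x
  clear hmin
  grind

theorem exists_isSides [Finite V] [Nontrivial V] (hG : Admissible G) (hR : Reduced G) (v : V) :
    ∃ s, IsSides G v s := by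
  obtain ⟨f, hf⟩ := hG.exists_bipartition v
  obtain ⟨w, hw⟩ := exists_ne v
  obtain ⟨t, ht, -⟩ := hR.undominated w v hw
  obtain ⟨a, b, hab, ha, hb, -, -⟩ := hR.robust t v ht.symm
  have hs : ∀ x y, G.Adj x y → G.Adj y x := fun _ _ h => h.symm
  have hfab := hf a b ha hb hab
  have hne : ∀ a b i : Bool, a ≠ b → a ≠ i → b = i := by decide
  have key : ∀ i, ∃ x, x ≠ v ∧ ¬G.Adj v x ∧ f x = i := by
    intro i
    by_cases h : f a = i
    · exact ⟨a, by rintro rfl; exact hb hab, ha, h⟩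
    · exact ⟨b, by rintro rfl; exact ha hab.symm, hb, hne _ _ _ hfab h⟩
  choose s hsv hs1 hs2 hs3 using fun i => exists_side hG hR hf (key i)
  have hne' : ∀ a b : Bool, a ≠ b → a = !b := by decide
  refine ⟨s, fun i => hs3 i _ (hsv _) (hs1 _) (hs2 _), hs1, fun x hxv hx i => ?_⟩
  rcases eq_or_ne (f x) i with h | h
  · have h1 := hf (s i) x (hs1 i) hx
    have h2 := hs3 (!i) x hxv hx
    grind
  · have h1 := hf (s !i) x (hs1 _) hx
    have h2 := hs3 i x hxv hx
    have h3 : f x = !i := hne' _ _ h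
    grind

theorem IsSides.clique (hG : Admissible G) {v : V} {s : Bool → V} (h : IsSides G v s) {i : Bool}
    {x y : V} (hx : ¬G.Adj v x) (hy : ¬G.Adj v y) (hx' : ¬G.Adj (s i) x) (hy' : ¬G.Adj (s i) y) :
    ¬G.Adj x y := by
  intro hxy
  have h1 := h.split x (by rintro rfl; exact hy hxy) hx i
  have h2 := h.split y (by rintro rfl; exact hx hxy.symm) hy i
  have h3 := hG.clawless v x y (s !i)
  have h4 := h.not_adj (!i)
  have hs : ∀ x y, G.Adj x y → G.Adj y x := fun _ _ h => h.symm
  grind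

/-- An edge (of the complement) between the two sides of the neighbourhood of `v` is extended
by a triangle avoiding `v`. -/
theorem IsSides.exists_triangle [Finite V] (hG : Admissible G) (hR : Reduced G) {v : V}
    {s : Bool → V} (h : IsSides G v s) {i : Bool} {b : V} (hb : ¬G.Adj v b) (hbv : b ≠ v)
    (hbi : ¬G.Adj (s i) b) :
    ∃ x, G.Adj v x ∧ ¬G.Adj b x ∧
      (∀ y c, G.Adj v y → ¬G.Adj b y → ¬G.Adj v c → ¬G.Adj (s i) c → ¬G.Adj y c → ¬G.Adj x c) ∧
      ∀ a, a ≠ v → ¬G.Adj v a → ¬G.Adj (s !i) a → ¬G.Adj a b → ¬G.Adj a x := by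
  classical
  have := Fintype.ofFinite V
  have hs : ∀ x y, G.Adj x y → G.Adj y x := fun _ _ h => h.symm
  have cl := fun x y => h.clique hG (i := i) (x := x) (y := y)
  have cl' := fun x y => h.clique hG (i := !i) (x := x) (y := y)
  let N : V → Finset V := fun x => {c | ¬G.Adj v c ∧ ¬G.Adj (s i) c ∧ ¬G.Adj x c}
  obtain ⟨t, ht, hmax⟩ := Finset.exists_max_image
    ({x | G.Adj v x ∧ ¬G.Adj b x} : Finset V) (fun x => (N x).card)
    (by obtain ⟨x, hx⟩ := hR.undominated b v hbv; exact ⟨x, by simpa using hx⟩)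
  simp only [Finset.mem_filter, Finset.mem_univ, true_and] at ht hmax
  have hmax' : ∀ y c, G.Adj v y → ¬G.Adj b y → ¬G.Adj v c → ¬G.Adj (s i) c → ¬G.Adj y c →
      G.Adj t c → ∃ d, ¬G.Adj v d ∧ ¬G.Adj (s i) d ∧ ¬G.Adj t d ∧ G.Adj y d := by
    intro y c hvy hby hvc hic hyc htc
    obtain ⟨d, hd, hd'⟩ := exists_mem_not_mem_of_card_le (hmax y ⟨hvy, hby⟩)
      (y := c) (by simp [N, *]) (by simp [N, htc])
    simp only [N, Finset.mem_filter, Finset.mem_univ, true_and, not_and, not_not] at hd hd'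
    exact ⟨d, hd.1, hd.2.1, hd.2.2, hd' hd.1 hd.2.1⟩
  refine ⟨t, ht.1, ht.2, fun y c hvy hby hvc hic hyc htc => ?_, fun a hav hva hia hab hat => ?_⟩
  · obtain ⟨d, hd1, hd2, hd3, hd4⟩ := hmax' y c hvy hby hvc hic hyc htc
    have h1 := hG.clawless b v t y
    have h2 := hG.diamondless t y c d
    grind
  · clear hmax
    obtain ⟨c, hvc, hic, htc, hcv⟩ : ∃ c, ¬G.Adj v c ∧ ¬G.Adj (s i) c ∧ G.Adj t c ∧ c ≠ v := by
      obtain ⟨p, q, hpq, hp, hq, htp, htq⟩ := hR.robust t v (hs _ _ ht.1)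
      have hpv : p ≠ v := by rintro rfl; exact hq hpq
      have hqv : q ≠ v := by rintro rfl; exact hp (hs _ _ hpq)
      have h1 := cl' p q hp hq
      have h2 := h.split p hpv hp i
      have h3 := h.split q hqv hq i
      by_cases h4 : G.Adj (s i) p
      · exact ⟨q, hq, by grind, htq, hqv⟩
      · exact ⟨p, hp, h4, htp, hpv⟩
    have hca : ¬G.Adj c a := by
      have h1 := hG.clawless b t c a
      have h2 := cl b c
      grind
    obtain ⟨e, hve, hce⟩ := hR.undominated c v hcv
    obtain ⟨d, hvd, hid, htd, hed⟩ : ∃ d, ¬G.Adj v d ∧ ¬G.Adj (s i) d ∧ ¬G.Adj t d ∧ G.Adj e d := by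
      by_cases hbe : G.Adj b e
      · exact ⟨b, hb, hbi, fun h => ht.2 h.symm, hbe.symm⟩
      · exact hmax' e c hve hbe hvc hic (fun h => hce h.symm) htc
    have hte : G.Adj t e := by
      have h1 := hG.diamondless t e c d
      have h2 := cl c d
      grind
    have hbe : G.Adj b e := by
      have h1 := hG.clawless b t e v
      grind
    have hab0 : G.Adj (s i) a := (h.split a hav hva i).2 hia
    have htb0 : ¬G.Adj t (s i) := by
      have h1 := hG.clawless b t (s i) a
      grind
    have hcb : ¬G.Adj c b := cl c b hvc hb hic hbi
    have hvs := h.not_adj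
    have hsi := h.adj i
    by_cases hea : G.Adj e a
    · have h1 := hG.clawless c e (s i) a
      have h2 := hG.clawless (s i) v t e
      grind
    · have h1 := h.split b hbv hb i
      have h2 := h.split c hcv hvc i
      have h3 := hG.clawless a (s !i) b e
      have h4 := hG.diamondless (s !i) v c e
      grind

theorem IsSides.unique_cross_aux (hG : Admissible G) (hR : Reduced G) {v : V}
    {s : Bool → V} (h : IsSides G v s) {i : Bool} {a b b' x x' : V} (hne : b ≠ b')
    (ha : ¬G.Adj v a) (hai : ¬G.Adj (s !i) a) (hb : ¬G.Adj v b) (hbi : ¬G.Adj (s i) b)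
    (hb' : ¬G.Adj v b') (hbi' : ¬G.Adj (s i) b') (hav : a ≠ v) (hbv : b ≠ v) (hbv' : b' ≠ v)
    (hab : ¬G.Adj a b) (hab' : ¬G.Adj a b') (hvx : G.Adj v x) (hvx' : G.Adj v x') (hbx : ¬G.Adj b x)
    (hx : ∀ y c, G.Adj v y → ¬G.Adj b y → ¬G.Adj v c → ¬G.Adj (s i) c → ¬G.Adj y c → ¬G.Adj x c)
    (hx' : ∀ y c, G.Adj v y → ¬G.Adj b' y → ¬G.Adj v c → ¬G.Adj (s i) c → ¬G.Adj y c →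
      ¬G.Adj x' c)
    (hxa : ∀ a, a ≠ v → ¬G.Adj v a → ¬G.Adj (s !i) a → ¬G.Adj a b → ¬G.Adj a x)
    (hxa' : ∀ a, a ≠ v → ¬G.Adj v a → ¬G.Adj (s !i) a → ¬G.Adj a b' → ¬G.Adj a x')
    (hxb : ¬G.Adj x b') : False := by
  have hs : ∀ x y, G.Adj x y → G.Adj y x := fun _ _ h => h.symm
  have hs' : ∀ x y, ¬G.Adj x y → ¬G.Adj y x := fun _ _ h h' => h h'.symm
  have hbb := h.clique hG hb hb' hbi hbi'
  obtain ⟨u, hu', hu⟩ := hR.undominated b b' hne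
  obtain ⟨w, hw', hw⟩ := hR.undominated b' b hne.symm
  have huv : u ≠ v := by rintro rfl; exact hb' (hs _ _ hu')
  have hwv : w ≠ v := by rintro rfl; exact hb (hs _ _ hw')
  have huw : G.Adj u w := by
    have h1 := hG.diamondless b u w b'
    grind
  have hvu : G.Adj v u := by
    by_contra hvu
    have h1 := h.clique hG (i := i) hvu hb'
    have h2 := h.split u huv hvu i
    have h3 := hxa u huv hvu
    have h4 := hG.diamondless v u x b'
    clear hx hx' hxa hxa'
    grind
  have hvw : G.Adj v w := by
    by_contra hvw
    have h1 := h.clique hG (i := i) hvw hb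
    have h2 := h.split w hwv hvw i
    have h3 := hxa' w hwv hvw
    have h4 := hx' x b hvx (hs' _ _ hxb) hb hbi (hs' _ _ hbx)
    have h5 := hG.diamondless v w x' b
    clear hx hx' hxa hxa'
    grind
  have hxu : ¬G.Adj x u := fun hxu =>
    hG.clawless b v x u hvx hvu hxu (hs' _ _ hb) hbx hu
  have hxw : ¬G.Adj x w := fun hxw =>
    hG.clawless b' v x w hvx hvw hxw (hs' _ _ hb') (hs' _ _ hxb) hw
  have hax : ¬G.Adj a x := hxa a hav ha hai hab
  have hv0 := h.not_adj (!i)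
  have h0 := h.split b hbv hb i
  have h0' := h.split b' hbv' hb' i
  by_cases hau : G.Adj a u
  · have haw : ¬G.Adj a w := fun haw =>
      hG.clawless x a u w hau haw huw (hs' _ _ hax) hxu hxw
    have h1 := hG.clawless a w b (s !i)
    have h2 := hG.diamondless v (s !i) w b'
    grind
  · have h1 := hG.clawless a u b' (s !i)
    have h2 := hG.diamondless v (s !i) u b
    grind

/-- Every vertex has at most one neighbour (in the complement) on the opposite side. -/
theorem IsSides.unique_cross [Finite V] (hG : Admissible G) (hR : Reduced G) {v : V}
    {s : Bool → V} (h : IsSides G v s) {i : Bool} {a b b' : V}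
    (ha : ¬G.Adj v a) (hai : ¬G.Adj (s !i) a) (hb : ¬G.Adj v b) (hbi : ¬G.Adj (s i) b)
    (hb' : ¬G.Adj v b') (hbi' : ¬G.Adj (s i) b') (hav : a ≠ v) (hbv : b ≠ v) (hbv' : b' ≠ v)
    (hab : ¬G.Adj a b) (hab' : ¬G.Adj a b') : b = b' := by
  by_contra hne
  have hs' : ∀ x y, ¬G.Adj x y → ¬G.Adj y x := fun _ _ h h' => h h'.symm
  obtain ⟨x, hvx, hbx, hx, hxa⟩ := h.exists_triangle hG hR hb hbv hbi
  obtain ⟨x', hvx', hbx', hx', hxa'⟩ := h.exists_triangle hG hR hb' hbv' hbi'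
  by_cases h1 : G.Adj x b'
  · by_cases h2 : G.Adj x' b
    · have h3 : ¬G.Adj x x' := fun h3 => hG.clawless a v x x' hvx hvx' h3 (hs' _ _ ha)
        (hxa a hav ha hai hab) (hxa' a hav ha hai hab')
      exact hG.diamondless x x' b' b h1 h2 h3 (hs' _ _ hbx')
        (hs' _ _ (h.clique hG hb hb' hbi hbi')) hbx
    · exact h.unique_cross_aux hG hR (Ne.symm hne) ha hai hb' hbi' hb hbi hav hbv' hbv hab' hab
        hvx' hvx hbx' hx' hx hxa' hxa h2
  · exact h.unique_cross_aux hG hR hne ha hai hb hbi hb' hbi' hav hbv hbv' hab hab'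
        hvx hvx' hbx hx hx' hxa hxa' h1

/-- The clique (of the complement) formed by `v` and its `i`-th side. -/
def sideSet (G : SimpleGraph V) (v a : V) : Set V := {x | ¬G.Adj v x ∧ ¬G.Adj a x}

theorem IsSides.sideSet_subset [Finite V] (hG : Admissible G) (hR : Reduced G) {v u : V}
    {s r : Bool → V} (hv : IsSides G v s) (hu : IsSides G u r) {i j : Bool} (hne : u ≠ v)
    (huv : u ∈ sideSet G v (s i)) (hvu : v ∈ sideSet G u (r j)) :
    sideSet G v (s i) ⊆ sideSet G u (r j) := by
  rintro x ⟨hvx, hix⟩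
  have hs : ∀ x y, G.Adj x y → G.Adj y x := fun _ _ h => h.symm
  have hs' : ∀ x y, ¬G.Adj x y → ¬G.Adj y x := fun _ _ h h' => h h'.symm
  have hux := hv.clique hG huv.1 hvx huv.2 hix
  refine ⟨hux, fun hjx => ?_⟩
  have hjv : ¬G.Adj (r j) v := hvu.2
  have hxv : x ≠ v := by rintro rfl; exact hjv hjx
  have hxu : x ≠ u := by rintro rfl; exact hu.not_adj j (hs _ _ hjx)
  have hjx' : ¬G.Adj (r !j) x := (hu.split x hxu hux j).1 hjx
  have hii : ¬G.Adj u (s i) := hs' _ _ huv.2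
  have hvi := hv.not_adj i
  have hsv : s i ≠ v := by
    intro e
    have := hv.adj i
    rw [e] at this
    exact hv.not_adj _ this
  by_cases hau : s i = u
  · have h1 : G.Adj (r j) x := hjx
    have h2 := hu.split v (Ne.symm hne) hvu.1 j
    have h3 : r j ≠ v := by
      intro e
      rw [e] at hjx
      exact hvx hjx
    have h4 := hv.split (r j) h3 (hs' _ _ hjv) i
    have h5 : ¬G.Adj (r j) x := hv.clique hG (i := i) (hs' _ _ hjv) hvx
      (by rw [hau]; exact hu.not_adj j) hix
    exact h5 hjx
  · by_cases hax : s i = x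
    · obtain ⟨y, huy, hxy, -, hy⟩ := hu.exists_triangle hG hR (i := !j) (b := x) hux hxu hjx'
      have hvy := hy v (Ne.symm hne) hvu.1 (by simpa using hjv) hvx
      have hyv : y ≠ v := by rintro rfl; exact hvu.1 huy
      exact hv.clique hG huv.1 hvy huv.2 (by rw [hax]; exact hxy) huy
    · by_cases hja : G.Adj (r j) (s i)
      · have h1 := (hu.split _ hau hii j).1 hja
        exact hax (hu.unique_cross hG hR (i := !j) (a := v) (b := s i) (b' := x) hvu.1
          (by simpa using hjv) hii h1 hux hjx' (Ne.symm hne) hau hxu hvi hvx)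
      · exact hsv (hu.unique_cross hG hR (i := j) (a := x) (b := s i) (b' := v) hux
          hjx' hii hja hvu.1 hjv hxu hau (Ne.symm hne) (hs' _ _ hix) (hs' _ _ hvx))

/-- Two distinct vertices have at most one common neighbour. -/
def SquareFree {W : Type*} (F : SimpleGraph W) : Prop :=
  ∀ a b c d, a ≠ c → b ≠ d → F.Adj a b → F.Adj b c → F.Adj c d → ¬F.Adj d a

section
variable {W : Type*} {F : SimpleGraph W} [DecidableRel F.Adj]

theorem SquareFree.sum_degree_le [DecidableEq W] (hF : SquareFree F) (Y : Finset W) :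
    ∑ y ∈ Y, ({z ∈ Y | F.Adj y z}.card * {z ∈ Y | F.Adj y z}.card - {z ∈ Y | F.Adj y z}.card) ≤
      Y.card * Y.card - Y.card := by
  simp only [← Finset.offDiag_card]
  rw [← Finset.card_biUnion]
  · refine Finset.card_le_card (Finset.biUnion_subset.2 fun y _ => ?_)
    exact Finset.offDiag_mono (Finset.filter_subset _ _)
  · intro a _ c _ hac
    rw [Function.onFun, Finset.disjoint_left]
    rintro ⟨b, d⟩ h1 h2
    simp only [Finset.mem_offDiag, Finset.mem_filter] at h1 h2
    exact hF a b c d hac h1.2.2 h1.1.2 h2.1.2.symm h2.2.1.2 h1.2.1.2.symm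

theorem even_sum_degree (F : SimpleGraph W) [DecidableRel F.Adj] (Y : Finset W) :
    Even (∑ y ∈ Y, {z ∈ Y | F.Adj y z}.card) := by
  have h := (F.induce (Y : Set W)).sum_degrees_eq_twice_card_edges
  rw [← Finset.sum_coe_sort]
  refine ⟨(F.induce (Y : Set W)).edgeFinset.card, ?_⟩
  rw [← two_mul, ← h]
  refine Finset.sum_congr rfl fun y _ => ?_
  rw [← SimpleGraph.card_neighborFinset_eq_degree]
  symm
  refine Finset.card_bij (fun z _ => z.1) ?_ ?_ ?_
  · intro z hz
    simpa using hz
  · intro a _ b _ h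
    exact Subtype.ext h
  · intro z hz
    simp only [Finset.mem_filter] at hz
    exact ⟨⟨z, hz.1⟩, by simpa using hz.2, rfl⟩

theorem IsIndepSet.insert_of_subset [DecidableEq W] {T Y : Finset W} {y : W} (hT : F.IsIndepSet (T : Set W))
    (hTY : T ⊆ {z ∈ Y.erase y | ¬F.Adj y z}) :
    F.IsIndepSet ((insert y T : Finset W) : Set W) ∧ (insert y T).card = T.card + 1 := by
  refine ⟨?_, Finset.card_insert_of_notMem fun h => by simpa using hTY h⟩
  rw [Finset.coe_insert]
  refine hT.insert fun b hb _ => ?_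
  have := hTY hb
  simp only [Finset.mem_filter] at this
  exact ⟨this.2, fun h => this.2 h.symm⟩

theorem card_nonadj [DecidableEq W] (F : SimpleGraph W) [DecidableRel F.Adj] {Y : Finset W} {y : W} (hy : y ∈ Y) :
    {z ∈ Y.erase y | ¬F.Adj y z}.card + {z ∈ Y | F.Adj y z}.card + 1 = Y.card := by
  have h1 := Finset.card_filter_add_card_filter_not (s := Y.erase y) (fun z => F.Adj y z)
  have h2 : {z ∈ Y.erase y | F.Adj y z} = {z ∈ Y | F.Adj y z} := by
    ext z
    simp only [Finset.mem_filter, Finset.mem_erase]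
    exact ⟨fun h => ⟨h.1.2, h.2⟩, fun h => ⟨⟨h.2.ne', h.1⟩, h.2⟩⟩
  have h3 := Finset.card_erase_add_one hy
  rw [h2] at h1
  omega

theorem SquareFree.exists_indep_two [DecidableEq W] (hF : SquareFree F) {Y : Finset W} (hY : 4 ≤ Y.card) :
    ∃ T ⊆ Y, F.IsIndepSet (T : Set W) ∧ T.card = 2 := by
  by_contra! h
  have key : ∀ a ∈ Y, ∀ b ∈ Y, a ≠ b → F.Adj a b := by
    intro a ha b hb hab
    by_contra hn
    refine h {a, b} (by simp [Finset.insert_subset_iff, ha, hb]) ?_ (Finset.card_pair hab)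
    have hn' : ¬F.Adj b a := fun h => hn h.symm
    simp [SimpleGraph.IsIndepSet, Set.pairwise_pair, hn, hn']
  obtain ⟨Z, hZ, hZ4⟩ := Finset.exists_subset_card_eq hY
  obtain ⟨a, b, c, d, hab, hac, had, hbc, hbd, hcd, rfl⟩ := Finset.card_eq_four.1 hZ4
  simp only [Finset.insert_subset_iff, Finset.singleton_subset_iff] at hZ
  obtain ⟨ha, hb, hc, hd⟩ := hZ
  exact hF a b c d hac hbd (key _ ha _ hb hab) (key _ hb _ hc hbc) (key _ hc _ hd hcd)
    (key _ hd _ ha had.symm)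

theorem SquareFree.exists_indep_three [DecidableEq W] (hF : SquareFree F) {Y : Finset W} (hY : 7 ≤ Y.card) :
    ∃ T ⊆ Y, F.IsIndepSet (T : Set W) ∧ T.card = 3 := by
  obtain ⟨Z, hZ, hZ7⟩ := Finset.exists_subset_card_eq hY
  by_cases h : ∃ y ∈ Z, {z ∈ Z | F.Adj y z}.card ≤ 2
  · obtain ⟨y, hy, hd⟩ := h
    have h1 := card_nonadj F hy
    obtain ⟨T, hT, hT1, hT2⟩ := hF.exists_indep_two (Y := {z ∈ Z.erase y | ¬F.Adj y z}) (by omega)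
    obtain ⟨h2, h3⟩ := IsIndepSet.insert_of_subset hT1 hT
    refine ⟨_, ?_, h2, by omega⟩
    refine (Finset.insert_subset hy (hT.trans ?_)).trans hZ
    exact (Finset.filter_subset _ _).trans (Finset.erase_subset _ _)
  · push Not at h
    have hs := hF.sum_degree_le Z
    have he := even_sum_degree F Z
    have h6 : ∀ y ∈ Z, 6 ≤ {z ∈ Z | F.Adj y z}.card * {z ∈ Z | F.Adj y z}.card -
        {z ∈ Z | F.Adj y z}.card := by
      intro y hy
      have := h y hy
      have := Nat.mul_le_mul_right {z ∈ Z | F.Adj y z}.card (Nat.succ_le_of_lt this)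
      omega
    have h7 : ∑ y ∈ Z, 6 = ∑ y ∈ Z, ({z ∈ Z | F.Adj y z}.card * {z ∈ Z | F.Adj y z}.card -
        {z ∈ Z | F.Adj y z}.card) := by
      refine le_antisymm (Finset.sum_le_sum h6) (hs.trans ?_)
      simp [hZ7]
    rw [Finset.sum_eq_sum_iff_of_le h6] at h7
    have h8 : ∀ y ∈ Z, {z ∈ Z | F.Adj y z}.card = 3 := by
      intro y hy
      have h1 := h7 y hy
      have h2 := h y hy
      by_contra h3
      have := Nat.mul_le_mul_right {z ∈ Z | F.Adj y z}.card 
        (show 4 ≤ {z ∈ Z | F.Adj y z}.card by omega)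
      omega
    rw [Finset.sum_congr rfl h8, Finset.sum_const, hZ7] at he
    exact absurd he (by decide)

theorem SquareFree.exists_indep_four [DecidableEq W] (hF : SquareFree F) {Y : Finset W} (hY : Y.card = 11) :
    ∃ T ⊆ Y, F.IsIndepSet (T : Set W) ∧ T.card = 4 := by
  obtain ⟨y, hy, hd⟩ : ∃ y ∈ Y, {z ∈ Y | F.Adj y z}.card ≤ 3 := by
    by_contra! h
    have hs := hF.sum_degree_le Y
    have h6 : ∀ y ∈ Y, 12 ≤ {z ∈ Y | F.Adj y z}.card * {z ∈ Y | F.Adj y z}.card -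
        {z ∈ Y | F.Adj y z}.card := by
      intro y hy
      have := h y hy
      have := Nat.mul_le_mul_right {z ∈ Y | F.Adj y z}.card (Nat.succ_le_of_lt this)
      omega
    have := (Finset.sum_le_sum h6).trans hs
    simp [hY] at this
  have h1 := card_nonadj F hy
  obtain ⟨T, hT, hT1, hT2⟩ := hF.exists_indep_three (Y := {z ∈ Y.erase y | ¬F.Adj y z}) (by omega)
  obtain ⟨h2, h3⟩ := IsIndepSet.insert_of_subset hT1 hT
  refine ⟨_, ?_, h2, by omega⟩
  refine Finset.insert_subset hy (hT.trans ?_)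
  exact (Finset.filter_subset _ _).trans (Finset.erase_subset _ _)

end

/-- `G` is the complement of the line graph of a simple graph on `W` without isolated vertices;
`E` maps each vertex of `G` to the corresponding edge. -/
structure IsEdgeRep {V W : Type*} (G : SimpleGraph V) (E : V → Finset W) : Prop where
  card_eq : ∀ x, (E x).card = 2
  inj : ∀ x y, E x = E y → x = y
  adj_iff : ∀ x y, G.Adj x y ↔ Disjoint (E x) (E y)
  surj : ∀ w, ∃ x, w ∈ E x

section
variable {V W : Type*} [DecidableEq W] {G : SimpleGraph V} {E : V → Finset W}

theorem IsEdgeRep.card_biUnion (hE : IsEdgeRep G E) {k : ℕ} {S : Finset V} (hS : G.IsNClique k S) :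
    (S.biUnion E).card = 2 * k := by
  rw [Finset.card_biUnion, Finset.sum_congr rfl fun x _ => hE.card_eq x, Finset.sum_const,
    hS.card_eq, smul_eq_mul, mul_comm]
  intro x hx y hy hxy
  exact (hE.adj_iff x y).1 (hS.isClique hx hy hxy)

theorem IsEdgeRep.hit_of_mem (hE : IsEdgeRep G E) {k : ℕ} (hk : G.CliqueFree (k + 1)) {S : Finset V}
    (hS : G.IsNClique k S) (x : V) : ∃ w ∈ E x, w ∈ S.biUnion E := by
  classical
  by_contra! h
  refine hk (insert x S) (hS.insert fun y hy => ?_)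
  rw [hE.adj_iff, Finset.disjoint_left]
  exact fun w hw hw' => h w hw (Finset.mem_biUnion.2 ⟨y, hy, hw'⟩)

/-- Gallai's argument: missing a common maximum matching is transitive. -/
theorem IsEdgeRep.hit_trans [Finite V] (hE : IsEdgeRep G E) {k : ℕ} (hk : G.CliqueFree (k + 1))
    (hmiss : ∀ w, ∃ S, G.IsNClique k S ∧ w ∉ S.biUnion E) {u v w : W}
    (huw : ∀ S, G.IsNClique k S → w ∉ S.biUnion E → u ∈ S.biUnion E)
    (hvw : ∀ S, G.IsNClique k S → w ∉ S.biUnion E → v ∈ S.biUnion E)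
    (huv : u ≠ v) {S : Finset V} (hS : G.IsNClique k S) (hu : u ∉ S.biUnion E) :
    v ∈ S.biUnion E := by
  classical
  have := Fintype.ofFinite V
  by_contra hv
  obtain ⟨R, hR, hmax⟩ := Finset.exists_max_image
    ({R | G.IsNClique k R ∧ w ∉ R.biUnion E} : Finset (Finset V)) (fun R => (S ∩ R).card)
    (by obtain ⟨R, hR⟩ := hmiss w; exact ⟨R, by simpa using hR⟩)
  simp only [Finset.mem_filter, Finset.mem_univ, true_and] at hR hmax
  obtain ⟨hR, hwR⟩ := hR
  have huR := huw R hR hwR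
  have hvR := hvw R hR hwR
  obtain ⟨l, hl, hlw⟩ : ∃ l ∈ S.biUnion E \ R.biUnion E, l ≠ w := by
    refine Finset.exists_mem_ne ?_ w
    have h1 := Finset.card_sdiff_add_card_inter (S.biUnion E) (R.biUnion E)
    have h2 := Finset.card_sdiff_add_card_inter (R.biUnion E) (S.biUnion E)
    rw [Finset.inter_comm] at h2
    rw [hE.card_biUnion hS] at h1
    rw [hE.card_biUnion hR] at h2
    have h3 : ({u, v} : Finset W) ⊆ R.biUnion E \ S.biUnion E := by
      simp only [Finset.insert_subset_iff, Finset.singleton_subset_iff, Finset.mem_sdiff]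
      exact ⟨⟨huR, hu⟩, hvR, hv⟩
    have h4 := Finset.card_le_card h3
    rw [Finset.card_pair huv] at h4
    omega
  rw [Finset.mem_sdiff] at hl
  obtain ⟨hlS, hlR⟩ := hl
  obtain ⟨z, hzS, hlz⟩ := Finset.mem_biUnion.1 hlS
  obtain ⟨m, hmz, hmR⟩ := hE.hit_of_mem hk hR z
  obtain ⟨y, hyR, hmy⟩ := Finset.mem_biUnion.1 hmR
  have hlm : l ≠ m := by rintro rfl; exact hlR hmR
  have hEz : E z = {l, m} := by
    refine (Finset.eq_of_subset_of_card_le ?_ ?_).symm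
    · simp [Finset.insert_subset_iff, hlz, hmz]
    · rw [hE.card_eq, Finset.card_pair hlm]
  have hzR : z ∉ R := fun h => hlR (Finset.mem_biUnion.2 ⟨z, h, hlz⟩)
  have hyz : y ≠ z := by rintro rfl; exact hzR hyR
  have hyS : y ∉ S := fun h => Finset.disjoint_left.1
    ((hE.adj_iff y z).1 (hS.isClique h hzS hyz)) hmy hmz
  have hR' : G.IsNClique k (insert z (R.erase y)) := by
    refine ⟨?_, ?_⟩
    · rw [Finset.coe_insert, SimpleGraph.isClique_insert]
      refine ⟨hR.isClique.subset (by simp), fun q hq _ => ?_⟩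
      simp only [Finset.coe_erase, Set.mem_sdiff, Finset.mem_coe, Set.mem_singleton_iff] at hq
      rw [hE.adj_iff, hEz, Finset.disjoint_left]
      intro a ha haq
      simp only [Finset.mem_insert, Finset.mem_singleton] at ha
      rcases ha with rfl | rfl
      · exact hlR (Finset.mem_biUnion.2 ⟨q, hq.1, haq⟩)
      · exact Finset.disjoint_left.1 ((hE.adj_iff y q).1 (hR.isClique hyR hq.1 (Ne.symm hq.2)))
          hmy haq
    · rw [Finset.card_insert_of_notMem (by simp [hzR]), Finset.card_erase_add_one hyR, hR.card_eq]
  have hwR' : w ∉ (insert z (R.erase y)).biUnion E := by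
    rw [Finset.mem_biUnion]
    rintro ⟨q, hq, hwq⟩
    rcases Finset.mem_insert.1 hq with rfl | hq
    · rw [hEz] at hwq
      simp only [Finset.mem_insert, Finset.mem_singleton] at hwq
      rcases hwq with rfl | rfl
      · exact hlw rfl
      · exact hwR hmR
    · exact hwR (Finset.mem_biUnion.2 ⟨q, Finset.mem_of_mem_erase hq, hwq⟩)
  have h1 := hmax _ ⟨hR', hwR'⟩
  have h2 : S ∩ insert z (R.erase y) = insert z (S ∩ R) := by
    ext q
    simp only [Finset.mem_inter, Finset.mem_insert, Finset.mem_erase]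
    grind
  rw [h2, Finset.card_insert_of_notMem (by simp [hzR])] at h1
  omega

theorem IsEdgeRep.card_eq_two_mul_add_one [Finite V] [Fintype W] [Nonempty W] (hE : IsEdgeRep G E)
    {k : ℕ} (hk : G.CliqueFree (k + 1)) (hmiss : ∀ w, ∃ S, G.IsNClique k S ∧ w ∉ S.biUnion E)
    (hjoin : ∀ X : Set V, X.Nonempty → Xᶜ.Nonempty → ∃ x ∈ X, ∃ y ∈ Xᶜ, ¬G.Adj x y) :
    Fintype.card W = 2 * k + 1 := by
  obtain ⟨w⟩ := ‹Nonempty W›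
  have key : ∀ v, v = w ∨ ∀ S, G.IsNClique k S → w ∉ S.biUnion E → v ∈ S.biUnion E := by
    by_contra! hc
    obtain ⟨v, hv⟩ := hc
    let P : W → Prop := fun v =>
      v = w ∨ ∀ S, G.IsNClique k S → w ∉ S.biUnion E → v ∈ S.biUnion E
    have hP : ∀ a b x, P a → a ∈ E x → b ∈ E x → P b := by
      intro a b x ha hax hbx
      by_cases hab : a = b
      · exact hab ▸ ha
      have hx : ∀ S, G.IsNClique k S → a ∈ S.biUnion E ∨ b ∈ S.biUnion E := by
        intro S hS
        obtain ⟨c, hc, hcS⟩ := hE.hit_of_mem hk hS x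
        have : E x = {a, b} := by
          refine (Finset.eq_of_subset_of_card_le ?_ ?_).symm
          · simp [Finset.insert_subset_iff, hax, hbx]
          · rw [hE.card_eq, Finset.card_pair hab]
        rw [this] at hc
        simp only [Finset.mem_insert, Finset.mem_singleton] at hc
        rcases hc with rfl | rfl <;> simp [hcS]
      rcases ha with rfl | ha
      · exact Or.inr fun S hS h => (hx S hS).resolve_left h
      · by_cases hbw : b = w
        · exact Or.inl hbw
        refine Or.inr fun S hS h => ?_
        refine hE.hit_trans hk hmiss (u := w) (w := a) ?_ ?_ (Ne.symm hbw) hS h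
        · intro R hR haR
          by_contra hwR
          exact haR (ha R hR hwR)
        · exact fun R hR haR => (hx R hR).resolve_left haR
    obtain ⟨x, hx⟩ := hE.surj w
    obtain ⟨y, hy⟩ := hE.surj v
    obtain ⟨x, hx, y, hy, hxy⟩ := hjoin {x | ∃ a ∈ E x, P a} ⟨x, w, hx, Or.inl rfl⟩
      ⟨y, by
        rintro ⟨a, ha, hPa⟩
        rcases hP a v y hPa ha hy with h | h
        · exact hv.1 h
        · obtain ⟨S, hS, h1, h2⟩ := hv.2
          exact h2 (h S hS h1)⟩
    obtain ⟨a, ha, hPa⟩ := hx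
    rw [hE.adj_iff, Finset.not_disjoint_iff] at hxy
    obtain ⟨b, hbx, hby⟩ := hxy
    exact hy ⟨b, hby, hP a b x hPa ha hbx⟩
  obtain ⟨S, hS, hwS⟩ := hmiss w
  have h1 : Finset.univ = insert w (S.biUnion E) := by
    ext v
    rcases key v with h | h
    · simp [h]
    · have := h S hS hwS
      simp only [Finset.mem_univ, Finset.mem_insert, this, or_true]
  rw [← Finset.card_univ, h1, Finset.card_insert_of_notMem hwS, hE.card_biUnion hS]

/-- The graph whose edges are the values of `E`. -/
def rootGraph {V W : Type*} (E : V → Finset W) : SimpleGraph W where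
  Adj a b := a ≠ b ∧ ∃ x, a ∈ E x ∧ b ∈ E x
  symm := ⟨fun _ _ h => ⟨h.1.symm, h.2.imp fun _ hx => hx.symm⟩⟩
  loopless := ⟨fun _ h => h.1 rfl⟩

theorem IsEdgeRep.colorable [Fintype W] (hE : IsEdgeRep G E) {T : Finset W}
    (hT : (rootGraph E).IsIndepSet (T : Set W)) {m : ℕ} (hm : Fintype.card W ≤ T.card + m) :
    G.Colorable m := by
  have h : ∀ x, ∃ w ∈ E x, w ∉ T := by
    intro x
    by_contra! hc
    obtain ⟨a, b, hab, hx⟩ := Finset.card_eq_two.1 (hE.card_eq x)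
    have ha : a ∈ E x := by simp [hx]
    have hb : b ∈ E x := by simp [hx]
    exact hT (hc a ha) (hc b hb) hab ⟨hab, x, ha, hb⟩
  choose c hc hcT using h
  let C : G.Coloring ((Tᶜ : Finset W) : Set W) := SimpleGraph.Coloring.mk
    (fun x => ⟨c x, by simpa using hcT x⟩) (by
      intro x y hxy hcxy
      have : c x = c y := congrArg Subtype.val hcxy
      exact Finset.disjoint_left.1 ((hE.adj_iff x y).1 hxy) (hc x) (this ▸ hc y))
  refine C.colorable.mono ?_
  have := Finset.card_add_card_compl T
  simp only [Finset.coe_sort_coe, Fintype.card_coe]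
  omega

end

theorem IsEdgeRep.squareFree {W : Type*} {E : V → Finset W} (hE : IsEdgeRep G E)
    (hG : Admissible G) : SquareFree (rootGraph E) := by
  classical
  rintro a b c d hac hbd ⟨hab, x, hxa, hxb⟩ ⟨hbc, y, hyb, hyc⟩ ⟨hcd, z, hzc, hzd⟩ ⟨hda, t, htd, hta⟩
  have pair : ∀ x a b, a ≠ b → a ∈ E x → b ∈ E x → E x = {a, b} := by
    intro x a b hab ha hb
    refine (Finset.eq_of_subset_of_card_le ?_ ?_).symm
    · simp [Finset.insert_subset_iff, ha, hb]
    · rw [hE.card_eq, Finset.card_pair hab]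
  have not_adj : ∀ x y a, a ∈ E x → a ∈ E y → ¬G.Adj x y := fun x y a hx hy h =>
    Finset.disjoint_left.1 ((hE.adj_iff x y).1 h) hx hy
  refine hG.diamondless x y z t ?_ ?_ (not_adj _ _ b hxb hyb) (not_adj _ _ c hyc hzc)
    (not_adj _ _ d hzd htd) (not_adj _ _ a hta hxa)
  · rw [hE.adj_iff, pair x a b hab hxa hxb, pair z c d hcd hzc hzd]
    simp [hac.symm, hbd.symm, hda, hbc.symm]
  · rw [hE.adj_iff, pair y b c hbc hyb hyc, pair t d a hda htd hta]
    simp [hac, hbd.symm, hab, hcd.symm]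

theorem Admissible.exists_isEdgeRep [Finite V] [Nontrivial V] (hG : Admissible G)
    (hR : Reduced G) : ∃ (W : Type u) (_ : Finite W) (_ : Nonempty W) (E : V → Finset W),
      IsEdgeRep G E := by
  classical
  choose s hs using exists_isSides hG hR
  have self : ∀ x i, x ∈ sideSet G x (s x i) := fun x i =>
    ⟨G.irrefl, fun h => (hs x).not_adj i h.symm⟩
  have inter : ∀ x y, y ∈ sideSet G x (s x false) → y ∈ sideSet G x (s x true) → y = x := by
    intro x y h1 h2
    by_contra hne
    exact h1.2 (((hs x).split y hne h1.1 false).2 h2.2)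
  have hne : ∀ x, sideSet G x (s x false) ≠ sideSet G x (s x true) := by
    intro x h
    have h1 : s x false ∈ sideSet G x (s x false) := ⟨(hs x).not_adj _, G.irrefl⟩
    have h2 := h ▸ h1
    exact h2.2 ((hs x).adj true)
  let W := {w : Set V // ∃ x i, w = sideSet G x (s x i)}
  let E : V → Finset W := fun x => Finset.univ.image fun i => ⟨sideSet G x (s x i), x, i, rfl⟩
  have mem : ∀ x (w : W), w ∈ E x ↔ ∃ i, w.1 = sideSet G x (s x i) := by
    intro x w
    simp only [E, Finset.mem_image, Finset.mem_univ, true_and]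
    exact exists_congr fun i => ⟨fun h => h ▸ rfl, fun h => Subtype.ext h.symm⟩
  have self' : ∀ x w, w ∈ E x → x ∈ w.1 := by
    intro x w hw
    obtain ⟨i, hi⟩ := (mem x w).1 hw
    exact hi ▸ self x i
  refine ⟨W, inferInstance, ?_, E, ?_, ?_, ?_, ?_⟩
  · obtain ⟨x⟩ := (inferInstance : Nonempty V)
    exact ⟨⟨_, x, false, rfl⟩⟩
  · intro x
    rw [Finset.card_image_of_injective, Finset.card_univ, Fintype.card_bool]
    intro i j h
    rw [Subtype.mk.injEq] at h
    cases i <;> cases j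
    · rfl
    · exact (hne x h).elim
    · exact (hne x h.symm).elim
    · rfl
  · intro x y h
    have key : ∀ i, y ∈ sideSet G x (s x i) := fun i =>
      self' y ⟨_, x, i, rfl⟩ (h ▸ (mem x _).2 ⟨i, rfl⟩)
    exact (inter x y (key false) (key true)).symm
  · intro x y
    rw [← not_iff_not, Finset.not_disjoint_iff]
    constructor
    · intro h
      by_cases hxy : y = x
      · subst hxy
        exact ⟨⟨_, y, true, rfl⟩, (mem _ _).2 ⟨_, rfl⟩, (mem _ _).2 ⟨_, rfl⟩⟩
      have side : ∀ x y, y ≠ x → ¬G.Adj x y → ∃ i, y ∈ sideSet G x (s x i) := by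
        intro x y hxy h
        by_cases h1 : G.Adj (s x true) y
        · exact ⟨false, h, ((hs x).split y hxy h true).1 h1⟩
        · exact ⟨true, h, h1⟩
      obtain ⟨i, hi⟩ := side x y hxy h
      obtain ⟨j, hj⟩ := side y x (Ne.symm hxy) fun h' => h h'.symm
      refine ⟨⟨_, x, i, rfl⟩, (mem _ _).2 ⟨_, rfl⟩, (mem _ _).2 ⟨j, ?_⟩⟩
      exact ((hs x).sideSet_subset hG hR (hs y) hxy hi hj).antisymm
        ((hs y).sideSet_subset hG hR (hs x) (Ne.symm hxy) hj hi)
    · rintro ⟨w, hwx, hwy⟩ hadj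
      obtain ⟨i, hi⟩ := (mem x w).1 hwx
      have := self' y w hwy
      rw [hi] at this
      exact this.1 hadj
  · rintro ⟨w, x, i, rfl⟩
    exact ⟨x, (mem _ _).2 ⟨i, rfl⟩⟩

theorem colorable_add {X : Set V} {m n : ℕ} (hX : (G.induce X).Colorable m)
    (hX' : (G.induce Xᶜ).Colorable n) : G.Colorable (m + n) := by
  classical
  obtain ⟨C⟩ := hX
  obtain ⟨D⟩ := hX'
  let c : V → Fin m ⊕ Fin n := fun x =>
    if h : x ∈ X then Sum.inl (C ⟨x, h⟩) else Sum.inr (D ⟨x, h⟩)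
  have hc : ∀ {x y}, G.Adj x y → c x ≠ c y := by
    intro x y hxy h
    by_cases hx : x ∈ X <;> by_cases hy : y ∈ X <;> simp only [c, hx, hy, dite_true, dite_false,
      Sum.inl.injEq, Sum.inr.injEq, reduceCtorEq] at h
    · exact C.valid (v := ⟨x, hx⟩) (w := ⟨y, hy⟩) hxy h
    · exact D.valid (v := ⟨x, hx⟩) (w := ⟨y, hy⟩) hxy h
  simpa using (SimpleGraph.Coloring.mk c hc).colorable

theorem Admissible.induce (hG : Admissible G) (X : Set V) : Admissible (G.induce X) where
  diamondless _ _ _ _ := hG.diamondless _ _ _ _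
  clawless _ _ _ _ := hG.clawless _ _ _ _
  wheelless _ _ _ _ _ _ := hG.wheelless _ _ _ _ _ _

theorem exists_max_clique {k : ℕ} (hk : G.CliqueFree (k + 1)) (X : Set V) :
    ∃ j, (G.induce X).CliqueFree (j + 1) ∧ ∃ S : Finset V, ↑S ⊆ X ∧ G.IsNClique j S := by
  classical
  have hex : ∃ j, ∀ S : Finset V, ↑S ⊆ X → ¬G.IsNClique (j + 1) S := ⟨k, fun S _ => hk S⟩
  refine ⟨Nat.find hex, (cliqueFree_induce_iff _ _ _).2 (Nat.find_spec hex), ?_⟩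
  rcases h : Nat.find hex with _ | j
  · exact ⟨∅, by simp, by simp⟩
  · have := Nat.find_min hex (m := j) (by omega)
    push Not at this
    exact this

/-- The inductive hypothesis: all proper induced subgraphs are colorable with few colors. -/
def ProperColorable (G : SimpleGraph V) : Prop :=
  ∀ X : Set V, X ≠ Set.univ → ∀ j ≤ 5, (G.induce X).CliqueFree (j + 1) →
    (G.induce X).Colorable (3 * j / 2)

theorem two_le_of_adj {k : ℕ} (hk : G.CliqueFree (k + 1)) {t u : V} (h : G.Adj t u) : 2 ≤ k := by
  classical
  by_contra hlt
  have h1 := SimpleGraph.cliqueFree_two.1 (hk.mono (show k + 1 ≤ 2 by omega))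
  exact SimpleGraph.bot_adj t u |>.1 (h1 ▸ h)

theorem Admissible.reduced (hG : Admissible G) (hP : ProperColorable G) {k : ℕ} (hk5 : k ≤ 5)
    (hk : G.CliqueFree (k + 1)) (hc : ¬G.Colorable (3 * k / 2)) : Reduced G where
  robust t u htu := by
    classical
    by_contra! h
    obtain ⟨l, rfl⟩ := Nat.exists_eq_add_of_le' (two_le_of_adj hk htu)
    obtain ⟨f, hf⟩ := hG.exists_bipartition t
    have h1 : (G.induce {x | G.Adj t x ∧ G.Adj u x}).Colorable (3 * l / 2) := by
      refine hP _ ?_ l (by omega) ((cliqueFree_induce_iff _ _ _).2 fun S hS hS' => ?_)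
      · intro h
        exact G.irrefl (h.ge (Set.mem_univ t)).1
      · refine hk _ ((hS'.insert (a := u) fun b hb => (hS hb).2).insert (a := t) fun b hb => ?_)
        rcases Finset.mem_insert.1 hb with rfl | hb
        · exact htu
        · exact (hS hb).1
    have h2 : (G.induce {x | G.Adj t x ∧ G.Adj u x}ᶜ).Colorable 3 := by
      let c : ({x | G.Adj t x ∧ G.Adj u x}ᶜ : Set V) → Option Bool :=
        fun x => if G.Adj t x then none else some (f x)
      refine (SimpleGraph.Coloring.mk c ?_).colorable
      rintro ⟨x, hx⟩ ⟨y, hy⟩ hxy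
      simp only [Set.mem_compl_iff, Set.mem_ofPred_eq, not_and] at hx hy
      by_cases htx : G.Adj t x <;> by_cases hty : G.Adj t y <;> simp [c, htx, hty]
      · exact (h x y hxy (hx htx) (hy hty) htx hty)
      · exact hf x y htx hty hxy
    exact hc ((colorable_add h1 h2).mono (by omega))
  undominated u v huv := by
    classical
    by_contra! h
    have h1 : (G.induce {v}ᶜ).Colorable (3 * k / 2) := by
      refine hP _ ?_ k hk5 ((cliqueFree_induce_iff _ _ _).2 fun S _ => hk S)
      intro h
      exact h.ge (Set.mem_univ v) rfl
    obtain ⟨C⟩ := h1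
    refine hc ⟨SimpleGraph.Coloring.mk
      (fun x => if h : x = v then C ⟨u, huv⟩ else C ⟨x, h⟩) fun {x y} hxy => ?_⟩
    by_cases hx : x = v <;> by_cases hy : y = v <;> simp only [hx, hy, dite_true, dite_false]
    · subst hx hy
      exact (G.irrefl hxy).elim
    · subst hx
      exact C.valid (v := ⟨u, huv⟩) (w := ⟨y, hy⟩) (h y hxy)
    · subst hy
      exact C.valid (v := ⟨x, hx⟩) (w := ⟨u, huv⟩) (h x hxy.symm).symm
    · exact C.valid (v := ⟨x, hx⟩) (w := ⟨y, hy⟩) hxy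

theorem ProperColorable.exists_not_adj (hP : ProperColorable G) {k : ℕ} (hk5 : k ≤ 5)
    (hk : G.CliqueFree (k + 1)) (hc : ¬G.Colorable (3 * k / 2)) {X : Set V} (hX : X.Nonempty)
    (hX' : Xᶜ.Nonempty) : ∃ x ∈ X, ∃ y ∈ Xᶜ, ¬G.Adj x y := by
  classical
  by_contra! h
  obtain ⟨i, hi, S, hSX, hS⟩ := exists_max_clique hk X
  obtain ⟨j, hj, T, hTX, hT⟩ := exists_max_clique hk Xᶜ
  have hij : i + j ≤ k := by
    by_contra hlt
    have hST : Disjoint S T := Finset.disjoint_left.2 fun a ha hb => hTX hb (hSX ha)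
    refine hk.mono (show k + 1 ≤ i + j by omega) (S ∪ T) ⟨?_, ?_⟩
    · rintro x hx y hy hxy
      simp only [Finset.coe_union, Set.mem_union] at hx hy
      rcases hx with hx | hx <;> rcases hy with hy | hy
      · exact hS.isClique hx hy hxy
      · exact h x (hSX hx) y (hTX hy)
      · exact (h y (hSX hy) x (hTX hx)).symm
      · exact hT.isClique hx hy hxy
    · rw [Finset.card_union_of_disjoint hST, hS.card_eq, hT.card_eq]
  have h1 := hP X (Set.nonempty_compl.1 hX') i (by omega) hi
  have h2 := hP Xᶜ (Set.compl_ne_univ.2 hX) j (by omega) hj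
  exact hc ((colorable_add h1 h2).mono (by omega))

theorem ProperColorable.exists_clique_avoiding (hP : ProperColorable G) {k : ℕ} (hk5 : k ≤ 5)
    (hk1 : 1 ≤ k) (hc : ¬G.Colorable (3 * k / 2)) {X : Set V} (hX : X.Nonempty)
    (hXi : ∀ x ∈ X, ∀ y ∈ X, ¬G.Adj x y) : ∃ S : Finset V, G.IsNClique k S ∧ ↑S ⊆ Xᶜ := by
  by_contra! h
  obtain ⟨l, rfl⟩ := Nat.exists_eq_add_of_le' hk1
  have h1 := hP Xᶜ (Set.compl_ne_univ.2 hX) l (by omega)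
    ((cliqueFree_induce_iff _ _ _).2 fun S hS hS' => h S hS' hS)
  have h2 : (G.induce Xᶜᶜ).Colorable 1 := by
    refine (SimpleGraph.Coloring.mk (α := Unit) (fun _ => ()) ?_).colorable
    rintro ⟨x, hx⟩ ⟨y, hy⟩ hxy
    rw [compl_compl] at hx hy
    exact (hXi x hx y hy hxy).elim
  exact hc ((colorable_add h1 h2).mono (by omega))

theorem SquareFree.exists_indep_large {W : Type*} [Fintype W] {F : SimpleGraph W}
    (hF : SquareFree F) {k : ℕ} (hk2 : 2 ≤ k) (hk5 : k ≤ 5) (hW : Fintype.card W = 2 * k + 1) :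
    ∃ T : Finset W, F.IsIndepSet (T : Set W) ∧ 2 * k + 1 ≤ T.card + 3 * k / 2 := by
  classical
  rw [← Finset.card_univ] at hW
  rcases (by omega : k = 2 ∨ k = 3 ∨ k = 4 ∨ k = 5) with rfl | rfl | rfl | rfl
  · obtain ⟨T, -, h1, h2⟩ := hF.exists_indep_two (Y := Finset.univ) (by omega)
    exact ⟨T, h1, by omega⟩
  · obtain ⟨T, -, h1, h2⟩ := hF.exists_indep_three (Y := Finset.univ) (by omega)
    exact ⟨T, h1, by omega⟩
  · obtain ⟨T, -, h1, h2⟩ := hF.exists_indep_three (Y := Finset.univ) (by omega)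
    exact ⟨T, h1, by omega⟩
  · obtain ⟨T, -, h1, h2⟩ := hF.exists_indep_four (Y := Finset.univ) hW
    exact ⟨T, h1, by omega⟩

theorem Admissible.colorable_of_properColorable [Finite V] (hG : Admissible G)
    (hP : ProperColorable G) {k : ℕ} (hk5 : k ≤ 5) (hk : G.CliqueFree (k + 1)) :
    G.Colorable (3 * k / 2) := by
  classical
  by_contra hc
  rcases subsingleton_or_nontrivial V with hV | hV
  · have h1 : G.Colorable 1 := (SimpleGraph.Coloring.mk (α := Unit) (fun _ => ())
      fun {x y} hxy => (hxy.ne (Subsingleton.elim x y)).elim).colorable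
    rcases k with _ | k
    · have : IsEmpty V := SimpleGraph.cliqueFree_one.1 hk
      exact hc (SimpleGraph.Colorable.of_isEmpty _)
    · exact hc (h1.mono (by omega))
  have hR := hG.reduced hP hk5 hk hc
  obtain ⟨u, v, huv⟩ := exists_pair_ne V
  obtain ⟨x, hvx, -⟩ := hR.undominated u v huv
  have hk2 := two_le_of_adj hk hvx
  obtain ⟨W, _, _, E, hE⟩ := hG.exists_isEdgeRep hR
  have := Fintype.ofFinite W
  have hmiss : ∀ w, ∃ S, G.IsNClique k S ∧ w ∉ S.biUnion E := by
    intro w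
    obtain ⟨S, hS, hSw⟩ := hP.exists_clique_avoiding hk5 (by omega) hc (X := {x | w ∈ E x})
      (hE.surj w) fun x hx y hy hxy => Finset.disjoint_left.1 ((hE.adj_iff x y).1 hxy) hx hy
    refine ⟨S, hS, fun h => ?_⟩
    obtain ⟨x, hx, hwx⟩ := Finset.mem_biUnion.1 h
    exact hSw hx hwx
  have hW := hE.card_eq_two_mul_add_one hk hmiss fun X hX hX' => hP.exists_not_adj hk5 hk hc hX hX'
  obtain ⟨T, hT, hT'⟩ := (hE.squareFree hG).exists_indep_large hk2 hk5 hW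
  exact hc (hE.colorable hT (by omega))

theorem Admissible.colorable_of_finite (n : ℕ) : ∀ {V : Type u} [Finite V] {G : SimpleGraph V},
    Nat.card V = n → Admissible G → ∀ k ≤ 5, G.CliqueFree (k + 1) → G.Colorable (3 * k / 2) := by
  induction n using Nat.strong_induction_on with
  | _ n ih =>
    intro V _ G hn hG k hk5 hk
    refine hG.colorable_of_properColorable (fun X hX j hj hj' => ?_) hk5 hk
    refine ih (Nat.card X) ?_ rfl (hG.induce X) j hj hj'
    have := Set.ncard_lt_card hX
    rw [← hn]
    exact this

theorem admissible_of_isEmpty_embedding (h1 : IsEmpty (twoK2 ↪g G)) (h2 : IsEmpty (K3K1 ↪g G))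
    (h3 : IsEmpty (C5K1 ↪g G)) : Admissible G where
  diamondless a b c d hac hbd hab hbc hcd hda := by
    have hs : ∀ x y, G.Adj x y → G.Adj y x := fun _ _ h => h.symm
    have hn : ∀ x y, G.Adj x y → x ≠ y := fun _ _ h => h.ne
    refine h1.elim ⟨⟨![a, c, b, d], fun i j => ?_⟩, fun {i j} => ?_⟩
    · fin_cases i <;> fin_cases j <;> simp <;> grind
    · change G.Adj (![a, c, b, d] i) (![a, c, b, d] j) ↔ _
      fin_cases i <;> fin_cases j <;> simp [twoK2, *] <;> grind
  clawless v a b c hab hac hbc hva hvb hvc := by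
    have hs : ∀ x y, G.Adj x y → G.Adj y x := fun _ _ h => h.symm
    have hn : ∀ x y, G.Adj x y → x ≠ y := fun _ _ h => h.ne
    refine h2.elim ⟨⟨![a, b, c, v], fun i j => ?_⟩, fun {i j} => ?_⟩
    · fin_cases i <;> fin_cases j <;> simp <;> grind
    · change G.Adj (![a, b, c, v] i) (![a, b, c, v] j) ↔ _
      fin_cases i <;> fin_cases j <;> simp [K3K1, *] <;> grind
  wheelless v a b c d e hab hbc hcd hde hea hac hbd hce hda heb hva hvb hvc hvd hve := by
    have hs : ∀ x y, G.Adj x y → G.Adj y x := fun _ _ h => h.symm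
    have hn : ∀ x y, G.Adj x y → x ≠ y := fun _ _ h => h.ne
    refine h3.elim ⟨⟨![a, b, c, d, e, v], fun i j => ?_⟩, fun {i j} => ?_⟩
    · fin_cases i <;> fin_cases j <;> simp <;> grind
    · change G.Adj (![a, b, c, d, e, v] i) (![a, b, c, d, e, v] j) ↔ _
      fin_cases i <;> fin_cases j <;> simp [C5K1, *] <;> grind

/-- Every (2K_2, K_3+K_1, C_5+K_1, K_6)-free graph is 7-colorable. -/
theorem stmt5 {V : Type*} (G : SimpleGraph V)
    (h1 : IsEmpty (twoK2 ↪g G))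
    (h2 : IsEmpty (K3K1 ↪g G))
    (h3 : IsEmpty (C5K1 ↪g G))
    (h6 : G.CliqueFree 6) :
    G.Colorable 7 := by
  have hG := admissible_of_isEmpty_embedding h1 h2 h3
  refine nonempty_hom_of_forall_finite_subgraph_hom fun G' hG' => ?_
  have := hG'.to_subtype
  have h : (G.induce G'.verts).Colorable 7 := (hG.induce G'.verts).colorable_of_finite _ rfl 5 le_rfl
    ((cliqueFree_induce_iff _ _ _).2 h6.cliqueFreeOn)
  exact h.some.comp ⟨id, fun h => G'.adj_sub h⟩
end

section
/- Every (P_5, kite)-free graph G with clique number at most 5 satisfies χ(G) ≤ 7. -/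
open SimpleGraph

/-- The kite: a path 0-1-2-3 plus a vertex 4 adjacent to 0, 1, 2. -/
def kite : SimpleGraph (Fin 5) :=
  SimpleGraph.fromEdgeSet {s(0, 1), s(1, 2), s(2, 3), s(4, 0), s(4, 1), s(4, 2)}

namespace P5Kite

variable {V : Type*} {G : SimpleGraph V}

/-- The vertices in `S` can be properly coloured with the numbers below `k`. -/
def ColOn (G : SimpleGraph V) (S : Set V) (k : ℕ) : Prop :=
  ∃ c : V → ℕ, (∀ v ∈ S, c v < k) ∧ ∀ u ∈ S, ∀ v ∈ S, G.Adj u v → c u ≠ c v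

/-- Every clique contained in `S` has at most `m` vertices. -/
def ClqLe (G : SimpleGraph V) (S : Set V) (m : ℕ) : Prop :=
  ∀ t : Finset V, (∀ x ∈ t, x ∈ S) → (∀ x ∈ t, ∀ y ∈ t, x ≠ y → G.Adj x y) → t.card ≤ m

/-- A minimal counterexample to the bound `3 * n / 2` for graphs of clique number `n`. -/
structure Crit (G : SimpleGraph V) (n : ℕ) : Prop where
  p5 : ∀ a b c d e, G.Adj a b → G.Adj b c → G.Adj c d → G.Adj d e → ¬ G.Adj a c → ¬ G.Adj a d →
    ¬ G.Adj a e → ¬ G.Adj b d → ¬ G.Adj b e → ¬ G.Adj c e → False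
  kite : ∀ a b c d e, G.Adj a b → G.Adj b c → G.Adj c d → G.Adj e a → G.Adj e b → G.Adj e c →
    ¬ G.Adj a c → ¬ G.Adj a d → ¬ G.Adj b d → ¬ G.Adj e d → False
  two_le : 2 ≤ n
  le_five : n ≤ 5
  clq : ClqLe G Set.univ n
  notCol : ¬ ColOn G Set.univ (3 * n / 2)
  col : ∀ S : Set V, S ≠ Set.univ → ColOn G S (3 * n / 2)
  low : ∀ m < n, ∀ S : Set V, ClqLe G S m → ColOn G S (3 * m / 2)

lemma ColOn.mono {S T : Set V} {k l : ℕ} (h : ColOn G T k) (hST : S ⊆ T) (hkl : k ≤ l) :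
    ColOn G S l := by
  obtain ⟨c, h1, h2⟩ := h
  exact ⟨c, fun v hv => (h1 v (hST hv)).trans_le hkl,
    fun u hu v hv => h2 u (hST hu) v (hST hv)⟩

lemma ColOn.union {S T : Set V} {k l : ℕ} (h : ColOn G S k) (h' : ColOn G T l) :
    ColOn G (S ∪ T) (k + l) := by
  classical
  obtain ⟨c, h1, h2⟩ := h
  obtain ⟨d, h3, h4⟩ := h'
  refine ⟨fun v => if v ∈ S then c v else k + d v, ?_, ?_⟩
  · intro v hv
    by_cases hS : v ∈ S
    · simp only [hS, if_true]; have := h1 v hS; omega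
    · simp only [hS, if_false]; have := h3 v (hv.resolve_left hS); omega
  · intro u hu v hv huv
    by_cases hS : u ∈ S <;> by_cases hS' : v ∈ S <;> simp only [hS, hS', if_true, if_false]
    · exact h2 u hS v hS' huv
    · have := h1 u hS; omega
    · have := h1 v hS'; omega
    · have := h4 u (hu.resolve_left hS) v (hv.resolve_left hS') huv; omega

lemma colOn_one {S : Set V} (h : ∀ u ∈ S, ∀ v ∈ S, ¬ G.Adj u v) : ColOn G S 1 :=
  ⟨fun _ => 0, fun _ _ => one_pos, fun u hu v hv huv => (h u hu v hv huv).elim⟩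

lemma ClqLe.mono {S T : Set V} {m : ℕ} (h : ClqLe G T m) (hST : S ⊆ T) : ClqLe G S m :=
  fun t ht ht' => h t (fun x hx => hST (ht x hx)) ht'

/-- If `S` contains no clique on more than `n` vertices, it contains a largest clique. -/
lemma exists_max_clique {S : Set V} {n : ℕ} (h : ClqLe G S n) :
    ∃ t : Finset V, (∀ x ∈ t, x ∈ S) ∧ (∀ x ∈ t, ∀ y ∈ t, x ≠ y → G.Adj x y) ∧
      ClqLe G S t.card := by
  classical
  let p : ℕ → Prop := fun k => ∃ t : Finset V, (∀ x ∈ t, x ∈ S) ∧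
    (∀ x ∈ t, ∀ y ∈ t, x ≠ y → G.Adj x y) ∧ t.card = k
  have h0 : p 0 := ⟨∅, by simp⟩
  obtain ⟨t, h1, h2, h3⟩ := Nat.findGreatest_spec (P := p) (Nat.zero_le n) h0
  refine ⟨t, h1, h2, fun t' h1' h2' => ?_⟩
  rw [h3]
  exact Nat.le_findGreatest (h t' h1' h2') ⟨t', h1', h2', rfl⟩

namespace Crit

variable {n : ℕ}

/-- A critical graph is not the join of two nonempty subgraphs. -/
lemma not_join (h : Crit G n) (A : Set V) {a b : V} (ha : a ∈ A) (hb : b ∉ A)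
    (hAB : ∀ x ∈ A, ∀ y, y ∉ A → G.Adj x y) : False := by
  classical
  obtain ⟨s, hs1, hs2, hs3⟩ := exists_max_clique (h.clq.mono (Set.subset_univ A))
  obtain ⟨t, ht1, ht2, ht3⟩ := exists_max_clique (h.clq.mono (Set.subset_univ Aᶜ))
  have hd : Disjoint s t := Finset.disjoint_left.2 fun x hx hx' => ht1 x hx' (hs1 x hx)
  have hst : s.card + t.card ≤ n := by
    rw [← Finset.card_union_of_disjoint hd]
    refine h.clq _ (fun _ _ => trivial) ?_
    intro x hx y hy hxy
    rcases Finset.mem_union.1 hx with hx | hx <;> rcases Finset.mem_union.1 hy with hy | hy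
    · exact hs2 x hx y hy hxy
    · exact hAB x (hs1 x hx) y (ht1 y hy)
    · exact (hAB y (hs1 y hy) x (ht1 x hx)).symm
    · exact ht2 x hx y hy hxy
  have hs : 1 ≤ s.card := by
    have := hs3 {a} (by simpa using ha) (by simp)
    simpa using this
  have ht : 1 ≤ t.card := by
    have := ht3 {b} (by simpa using hb) (by simp)
    simpa using this
  have := ((h.low s.card (by omega) A hs3).union (h.low t.card (by omega) Aᶜ ht3))
  refine h.notCol (this.mono (by rw [Set.union_compl_self]) ?_)
  omega

/-- No vertex is dominated by a nonadjacent one. -/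
lemma exists_adj_not_adj (h : Crit G n) {u v : V} (huv : u ≠ v) (hna : ¬ G.Adj u v) :
    ∃ w, G.Adj u w ∧ ¬ G.Adj v w := by
  classical
  by_contra! hc
  obtain ⟨c, h1, h2⟩ := h.col {u}ᶜ (by simp)
  refine h.notCol ⟨fun x => if x = u then c v else c x, ?_, ?_⟩
  · intro x _
    by_cases hx : x = u
    · simp only [hx, if_true]; exact h1 v (by simpa using huv.symm)
    · simp only [hx, if_false]; exact h1 x (by simpa using hx)
  · intro x _ y _ hxy
    have key : ∀ y, G.Adj u y → y ≠ u ∧ c v ≠ c y := fun y hy =>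
      ⟨hy.ne', h2 v (by simpa using huv.symm) y (by simpa using hy.ne') (hc y hy)⟩
    by_cases hx : x = u
    · subst hx
      simp only [if_true, (key y hxy).1, if_false]; exact (key y hxy).2
    · by_cases hy : y = u
      · subst hy
        simp only [if_true, hx, if_false]; exact (key x hxy.symm).2.symm
      · simp only [hx, hy, if_false]
        exact h2 x (by simpa using hx) y (by simpa using hy) hxy

/-- The minimum degree of a critical graph is at least the number of colours. -/
lemma le_card_of_adj (h : Crit G n) (v : V) (t : Finset V) (ht : ∀ w, G.Adj v w → w ∈ t) :
    3 * n / 2 ≤ t.card := by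
  classical
  by_contra! hlt
  obtain ⟨c, h1, h2⟩ := h.col {v}ᶜ (by simp)
  obtain ⟨k, hk, hk'⟩ : ∃ k ∈ Finset.range (3 * n / 2), k ∉ t.image c := by
    apply Finset.exists_mem_notMem_of_card_lt_card
    exact (Finset.card_image_le.trans_lt hlt).trans_eq (by simp)
  have hkw : ∀ w, G.Adj v w → k ≠ c w := fun w hw e =>
    hk' (Finset.mem_image.2 ⟨w, ht w hw, e.symm⟩)
  refine h.notCol ⟨fun x => if x = v then k else c x, ?_, ?_⟩
  · intro x _
    by_cases hx : x = v
    · simp only [hx, if_true]; simpa using hk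
    · simp only [hx, if_false]; exact h1 x (by simpa using hx)
  · intro x _ y _ hxy
    by_cases hx : x = v
    · subst hx
      simp only [if_true, hxy.ne', if_false]; exact hkw y hxy
    · by_cases hy : y = v
      · subst hy
        simp only [if_true, hx, if_false]; exact (hkw x hxy.symm).symm
      · simp only [hx, hy, if_false]
        exact h2 x (by simpa using hx) y (by simpa using hy) hxy

/-- A critical graph has no clique cutset. -/
lemma no_clique_cutset [Finite V] (h : Crit G n) (U A : Set V)
    (hU : ∀ x ∈ U, ∀ y ∈ U, x ≠ y → G.Adj x y) {a b : V} (ha : a ∈ A) (haU : ∀ x ∈ A, x ∉ U)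
    (hbA : b ∉ A) (hbU : b ∉ U) (hAB : ∀ x ∈ A, ∀ y, G.Adj x y → y ∈ A ∨ y ∈ U) : False := by
  classical
  have := Fintype.ofFinite V
  obtain ⟨c, hc1, hc2⟩ := h.col Aᶜ (by intro e; have : a ∈ Aᶜ := e ▸ trivial; exact this ha)
  obtain ⟨d, hd1, hd2⟩ := h.col (A ∪ U) (by
    intro e; have : b ∈ A ∪ U := e ▸ trivial; exact this.elim hbA hbU)
  have hd1' : ∀ x ∈ U, d x < 3 * n / 2 := fun x hx => hd1 x (Or.inr hx)
  have hinj : ∀ x ∈ U, ∀ y ∈ U, d x = d y → x = y := by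
    intro x hx y hy e
    by_contra hne
    exact hd2 x (Or.inr hx) y (Or.inr hy) (hU x hx y hy hne) e
  have hinj' : ∀ x ∈ U, ∀ y ∈ U, c x = c y → x = y := by
    intro x hx y hy e
    by_contra hne
    exact hc2 x (fun hA => haU x hA hx) y (fun hA => haU y hA hy) (hU x hx y hy hne) e
  let s : Finset (Fin (3 * n / 2)) :=
    Finset.univ.filter fun i => ∃ x ∈ U, d x = i
  let f : Fin (3 * n / 2) → ℕ := fun i => if hi : ∃ x ∈ U, d x = i then c hi.choose else 0
  have hf : ∀ x (hx : x ∈ U), f ⟨d x, hd1' x hx⟩ = c x := by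
    intro x hx
    have hi : ∃ y ∈ U, d y = ((⟨d x, hd1' x hx⟩ : Fin (3 * n / 2)) : ℕ) := ⟨x, hx, rfl⟩
    have := hi.choose_spec
    simp only [f, hi, dif_pos]
    rw [hinj _ this.1 x hx this.2]
  obtain ⟨g, hg⟩ := Finset.exists_equiv_extend_of_card_eq (α := Fin (3 * n / 2))
    (t := Finset.range (3 * n / 2)) (by simp) (s := s) (f := f) (by
      intro i hi
      obtain ⟨j, hj, rfl⟩ := Finset.mem_image.1 hi
      obtain ⟨x, hx, e⟩ := (Finset.mem_filter.1 hj).2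
      have : j = ⟨d x, hd1' x hx⟩ := Fin.ext e.symm
      rw [this, hf x hx, Finset.mem_range]
      exact hc1 x (fun hA => haU x hA hx)) (by
      intro i hi j hj e
      obtain ⟨x, hx, e1⟩ := (Finset.mem_filter.1 hi).2
      obtain ⟨y, hy, e2⟩ := (Finset.mem_filter.1 hj).2
      have h1 : i = ⟨d x, hd1' x hx⟩ := Fin.ext e1.symm
      have h2 : j = ⟨d y, hd1' y hy⟩ := Fin.ext e2.symm
      rw [h1, h2, hf x hx, hf y hy] at e
      have := hinj' x hx y hy e
      subst this
      rw [h1, h2])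
  let e : V → ℕ := fun x => if hx : d x < 3 * n / 2 then (g ⟨d x, hx⟩ : ℕ) else 0
  have he : ∀ x ∈ A ∪ U, ∃ hx : d x < 3 * n / 2, e x = (g ⟨d x, hx⟩ : ℕ) := fun x hx =>
    ⟨hd1 x hx, by simp only [e, hd1 x hx, dif_pos]⟩
  have heU : ∀ x ∈ U, e x = c x := by
    intro x hx
    obtain ⟨hx', e1⟩ := he x (Or.inr hx)
    rw [e1, hg _ (Finset.mem_filter.2 ⟨Finset.mem_univ _, x, hx, rfl⟩), hf x hx]
  have he2 : ∀ x ∈ A ∪ U, ∀ y ∈ A ∪ U, G.Adj x y → e x ≠ e y := by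
    intro x hx y hy hxy e1
    obtain ⟨hx', e2⟩ := he x hx
    obtain ⟨hy', e3⟩ := he y hy
    rw [e2, e3] at e1
    have := g.injective (Subtype.ext e1)
    exact hd2 x hx y hy hxy (by simpa using congrArg Fin.val this)
  have key : ∀ x ∈ A, ∀ y, y ∉ A → G.Adj x y → e x ≠ c y := by
    intro x hx y hy hxy
    have hyU := (hAB x hx y hxy).resolve_left hy
    rw [← heU y hyU]
    exact he2 x (Or.inl hx) y (Or.inr hyU) hxy
  refine h.notCol ⟨fun x => if x ∈ A then e x else c x, ?_, ?_⟩
  · intro x _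
    by_cases hx : x ∈ A
    · simp only [hx, if_true]
      obtain ⟨hx', e1⟩ := he x (Or.inl hx)
      rw [e1]
      exact Finset.mem_range.1 (g _).2
    · simp only [hx, if_false]; exact hc1 x hx
  · intro x _ y _ hxy
    by_cases hx : x ∈ A <;> by_cases hy : y ∈ A <;> simp only [hx, hy, if_true, if_false]
    · exact he2 x (Or.inl hx) y (Or.inl hy) hxy
    · exact key x hx y hy hxy
    · exact (key y hy x hx hxy.symm).symm
    · exact hc2 x hx y hy hxy

end Crit
lemma exists_injOn_of_card_le (A B : Finset ℕ) (h : A.card ≤ B.card) :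
    ∃ f : ℕ → ℕ, (∀ x ∈ A, f x ∈ B) ∧ ∀ x ∈ A, ∀ y ∈ A, f x = f y → x = y := by
  obtain ⟨g⟩ := Function.Embedding.nonempty_of_card_le (α := A) (β := B) (by simpa using h)
  refine ⟨fun x => if hx : x ∈ A then g ⟨x, hx⟩ else 0, ?_, ?_⟩
  · intro x hx
    simp only [hx, dif_pos]
    exact (g _).2
  · intro x hx y hy e
    simp only [hx, hy, dif_pos] at e
    simpa using g.injective (Subtype.ext e)

namespace Crit

variable {n : ℕ}

/-- A critical graph has no nontrivial homogeneous set. -/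
lemma no_module [Finite V] (h : Crit G n) (M : Set V) {a₀ b₀ z : V} (ha₀ : a₀ ∈ M) (hb₀ : b₀ ∈ M)
    (hab₀ : a₀ ≠ b₀) (hz : z ∉ M)
    (hM : ∀ w, w ∉ M → ∀ x ∈ M, ∀ y ∈ M, G.Adj w x → G.Adj w y) : False := by
  classical
  have := Fintype.ofFinite V
  by_cases hE : ∀ x ∈ M, ∀ y ∈ M, ¬ G.Adj x y
  · obtain ⟨w, hw, hw'⟩ := h.exists_adj_not_adj hab₀ (hE a₀ ha₀ b₀ hb₀)
    have hwM : w ∉ M := fun hwM => hE _ ha₀ _ hwM hw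
    exact hw' (hM w hwM a₀ ha₀ b₀ hb₀ hw.symm).symm
  push Not at hE
  obtain ⟨a, ha, b, hb, hab⟩ := hE
  by_cases hJ : ∀ w, w ∉ M → G.Adj w a
  · exact h.not_join M ha hz fun x hx y hy => (hM y hy a ha x hx (hJ y hy)).symm
  push Not at hJ
  obtain ⟨o, hoM, hoa⟩ := hJ
  let N : Set V := {w | w ∉ M ∧ G.Adj w a}
  have hNM : ∀ w ∈ N, ∀ x ∈ M, G.Adj w x := fun w hw x hx => hM w hw.1 a ha x hx hw.2
  have hON : ∀ w, w ∉ M → w ∉ N → ∀ x ∈ M, ¬ G.Adj w x := fun w hw hw' x hx hwx =>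
    hw' ⟨hw, hM w hw x hx a ha hwx⟩
  let r : V → V → Prop := fun x y => x ∈ N ∧ y ∈ N ∧ x ≠ y ∧ ¬ G.Adj x y
  let q : V → Quot r := Quot.mk r
  have hr1 : ∀ x y d, r x y → d ∉ M → d ∉ N → G.Adj d x → G.Adj d y := by
    intro x y d hxy hd hd' hdx
    by_contra hdy
    exact h.kite y a x d b (hNM y hxy.2.1 a ha) (hNM x hxy.1 a ha).symm hdx.symm
      (hNM y hxy.2.1 b hb).symm hab.symm (hNM x hxy.1 b hb).symm
      (fun e => hxy.2.2.2 e.symm) (fun e => hdy e.symm)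
      (fun e => hON d hd hd' a ha e.symm) (fun e => hON d hd hd' b hb e.symm)
  have hr : ∀ x y d, q x = q y → d ∉ M → d ∉ N → (G.Adj d x ↔ G.Adj d y) := by
    intro x y d hxy hd hd'
    have hE : Relation.EqvGen r x y := Quot.eq.1 hxy
    clear hxy
    induction hE with
    | rel x y hxy =>
      exact ⟨hr1 x y d hxy hd hd', hr1 y x d ⟨hxy.2.1, hxy.1, hxy.2.2.1.symm,
        fun e => hxy.2.2.2 e.symm⟩ hd hd'⟩
    | refl => rfl
    | symm x y hxy ih => exact ih.symm
    | trans x y z hxy hyz ih1 ih2 => exact ih1.trans ih2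
  have hq : ∀ x ∈ N, ∀ y ∈ N, q x ≠ q y → G.Adj x y := by
    intro x hx y hy hne
    by_contra hxy
    exact hne (Quot.sound ⟨hx, hy, fun e => hne (by rw [e]), hxy⟩)
  obtain ⟨c, hc1, hc2⟩ := h.col Mᶜ (by intro e; have : a ∈ Mᶜ := e ▸ trivial; exact this ha)
  obtain ⟨d, hd1, hd2⟩ := h.col (M ∪ N) (by
    intro e; have : o ∈ M ∪ N := e ▸ trivial; exact this.elim hoM (fun e => hoa e.2))
  let cl : Quot r → Finset V := fun Q => Finset.univ.filter fun x => x ∈ N ∧ q x = Q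
  have hcl : ∀ x ∈ N, x ∈ cl (q x) := fun x hx => Finset.mem_filter.2 ⟨Finset.mem_univ _, hx, rfl⟩
  have hcl' : ∀ x Q, x ∈ cl Q → x ∈ N ∧ q x = Q := fun x Q hx => (Finset.mem_filter.1 hx).2
  have hφ : ∀ Q, ∃ f : ℕ → ℕ, ((cl Q).image d).card ≤ ((cl Q).image c).card →
      (∀ x ∈ (cl Q).image d, f x ∈ (cl Q).image c) ∧
      ∀ x ∈ (cl Q).image d, ∀ y ∈ (cl Q).image d, f x = f y → x = y := by
    intro Q
    by_cases hQ : ((cl Q).image d).card ≤ ((cl Q).image c).card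
    · obtain ⟨f, hf⟩ := exists_injOn_of_card_le _ _ hQ
      exact ⟨f, fun _ => hf⟩
    · exact ⟨id, fun e => (hQ e).elim⟩
  choose φ hφ using hφ
  let e : V → ℕ := fun x => if x ∈ N ∧ ((cl (q x)).image d).card ≤ ((cl (q x)).image c).card then
    φ (q x) (d x) else c x
  have he1 : ∀ x ∈ N, e x ∈ (cl (q x)).image c := by
    intro x hx
    by_cases hQ : ((cl (q x)).image d).card ≤ ((cl (q x)).image c).card
    · simp only [e, hx, hQ, and_self, if_true]
      exact (hφ _ hQ).1 _ (Finset.mem_image_of_mem _ (hcl x hx))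
    · simp only [e, hQ, and_false, if_false]
      exact Finset.mem_image_of_mem _ (hcl x hx)
  have he2 : ∀ Q, ((cl Q).image e).card ≤ ((cl Q).image d).card := by
    intro Q
    by_cases hQ : ((cl Q).image d).card ≤ ((cl Q).image c).card
    · have : (cl Q).image e = ((cl Q).image d).image (φ Q) := by
        rw [Finset.image_image]
        refine Finset.image_congr fun x hx => ?_
        obtain ⟨hxN, rfl⟩ := hcl' x Q hx
        simp only [e, hxN, hQ, and_self, if_true, Function.comp]
      rw [this]
      exact Finset.card_image_le
    · have : (cl Q).image e = (cl Q).image c := by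
        refine Finset.image_congr fun x hx => ?_
        obtain ⟨hx, rfl⟩ := hcl' x Q hx
        simp only [e, hQ, and_false, if_false]
      rw [this]
      omega
  have he3 : ∀ x, x ∉ N → e x = c x := fun x hx => by simp only [e, hx, false_and, if_false]
  have heN : ∀ x ∈ N, ∃ y ∈ N, q y = q x ∧ e x = c y := by
    intro x hx
    obtain ⟨y, hy, e1⟩ := Finset.mem_image.1 (he1 x hx)
    exact ⟨y, (hcl' _ _ hy).1, (hcl' _ _ hy).2, e1.symm⟩
  have he4 : ∀ x, x ∉ M → e x < 3 * n / 2 := by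
    intro x hx
    by_cases hxN : x ∈ N
    · obtain ⟨y, hy, -, e1⟩ := heN x hxN
      rw [e1]
      exact hc1 y hy.1
    · rw [he3 x hxN]
      exact hc1 x hx
  have he5 : ∀ x ∈ N, ∀ y, y ∉ M → y ∉ N → G.Adj x y → e x ≠ e y := by
    intro x hx y hy hy' hxy
    obtain ⟨x', hx', e1, e2⟩ := heN x hx
    rw [e2, he3 y hy']
    exact hc2 x' hx'.1 y hy ((hr x' x y e1 hy hy').2 hxy.symm).symm
  have he6 : ∀ x, x ∉ M → ∀ y, y ∉ M → G.Adj x y → e x ≠ e y := by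
    intro x hx y hy hxy
    by_cases hxN : x ∈ N <;> by_cases hyN : y ∈ N
    · by_cases hQ : q x = q y
      · by_cases hC : ((cl (q x)).image d).card ≤ ((cl (q x)).image c).card
        · intro e1
          have hC' := hC
          rw [hQ] at hC'
          simp only [e, hxN, hyN, hC, hC', and_self, if_true] at e1
          rw [← hQ] at e1
          refine hd2 x (Or.inr hxN) y (Or.inr hyN) hxy ?_
          exact (hφ _ hC).2 _ (Finset.mem_image_of_mem _ (hcl x hxN)) _
            (Finset.mem_image_of_mem _ (hQ ▸ hcl y hyN)) e1
        · have hC' := hC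
          rw [hQ] at hC'
          simp only [e, hC, hC', and_false, if_false]
          exact hc2 x hx y hy hxy
      · obtain ⟨x', hx', e1, e2⟩ := heN x hxN
        obtain ⟨y', hy', e3, e4⟩ := heN y hyN
        rw [e2, e4]
        exact hc2 x' hx'.1 y' hy'.1 (hq x' hx' y' hy' (by rw [e1, e3]; exact hQ))
    · exact he5 x hxN y hy hyN hxy
    · exact (he5 y hyN x hx hxN hxy.symm).symm
    · rw [he3 x hxN, he3 y hyN]
      exact hc2 x hx y hy hxy
  let NF : Finset V := Finset.univ.filter fun x => x ∈ N
  let MF : Finset V := Finset.univ.filter fun x => x ∈ M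
  have hNF : NF = (NF.image q).biUnion cl := by
    ext x
    simp only [NF, cl, Finset.mem_biUnion, Finset.mem_image, Finset.mem_filter, Finset.mem_univ,
      true_and]
    constructor
    · intro hx
      exact ⟨_, ⟨x, hx, rfl⟩, hx, rfl⟩
    · rintro ⟨_, _, hx, _⟩
      exact hx
  have hcard : (NF.image e).card ≤ (NF.image d).card := by
    have h1 : (NF.image e).card ≤ ∑ Q ∈ NF.image q, ((cl Q).image e).card := by
      conv_lhs => rw [hNF, Finset.biUnion_image]
      exact Finset.card_biUnion_le
    have h2 : (NF.image d).card = ∑ Q ∈ NF.image q, ((cl Q).image d).card := by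
      conv_lhs => rw [hNF, Finset.biUnion_image]
      refine Finset.card_biUnion fun Q _ Q' _ hne => Finset.disjoint_left.2 fun k hk hk' => ?_
      obtain ⟨x, hx, e1⟩ := Finset.mem_image.1 hk
      obtain ⟨y, hy, e2⟩ := Finset.mem_image.1 hk'
      obtain ⟨hxN, rfl⟩ := hcl' _ _ hx
      obtain ⟨hyN, rfl⟩ := hcl' _ _ hy
      exact hd2 x (Or.inr hxN) y (Or.inr hyN) (hq x hxN y hyN hne) (e1.trans e2.symm)
    rw [h2]
    exact h1.trans (Finset.sum_le_sum fun Q _ => he2 Q)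
  have hdis : Disjoint (MF.image d) (NF.image d) := by
    refine Finset.disjoint_left.2 fun k hk hk' => ?_
    obtain ⟨x, hx, e1⟩ := Finset.mem_image.1 hk
    obtain ⟨y, hy, e2⟩ := Finset.mem_image.1 hk'
    have hx := (Finset.mem_filter.1 hx).2
    have hy := (Finset.mem_filter.1 hy).2
    exact hd2 x (Or.inl hx) y (Or.inr hy) (hNM y hy x hx).symm (e1.trans e2.symm)
  have hle : (MF.image d ∪ NF.image d).card ≤ 3 * n / 2 := by
    have : MF.image d ∪ NF.image d ⊆ Finset.range (3 * n / 2) := by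
      intro k hk
      rcases Finset.mem_union.1 hk with hk | hk
      · obtain ⟨x, hx, rfl⟩ := Finset.mem_image.1 hk
        exact Finset.mem_range.2 (hd1 x (Or.inl (Finset.mem_filter.1 hx).2))
      · obtain ⟨x, hx, rfl⟩ := Finset.mem_image.1 hk
        exact Finset.mem_range.2 (hd1 x (Or.inr (Finset.mem_filter.1 hx).2))
    simpa using Finset.card_le_card this
  rw [Finset.card_union_of_disjoint hdis] at hle
  have hle' : (MF.image d).card ≤ (Finset.range (3 * n / 2) \ NF.image e).card := by
    have := Finset.le_card_sdiff (NF.image e) (Finset.range (3 * n / 2))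
    rw [Finset.card_range] at this
    omega
  obtain ⟨ψ, hψ1, hψ2⟩ := exists_injOn_of_card_le _ _ hle'
  have hMF : ∀ x ∈ M, d x ∈ MF.image d := fun x hx =>
    Finset.mem_image_of_mem _ (Finset.mem_filter.2 ⟨Finset.mem_univ _, hx⟩)
  have key : ∀ x ∈ M, ∀ y, y ∉ M → G.Adj x y → ψ (d x) ≠ e y := by
    intro x hx y hy hxy e1
    have hyN : y ∈ N := by
      by_contra hyN
      exact hON y hy hyN x hx hxy.symm
    have := (Finset.mem_sdiff.1 (hψ1 _ (hMF x hx))).2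
    rw [e1] at this
    exact this (Finset.mem_image_of_mem _ (Finset.mem_filter.2 ⟨Finset.mem_univ _, hyN⟩))
  refine h.notCol ⟨fun x => if x ∈ M then ψ (d x) else e x, ?_, ?_⟩
  · intro x _
    by_cases hx : x ∈ M
    · simp only [hx, if_true]
      exact Finset.mem_range.1 (Finset.mem_sdiff.1 (hψ1 _ (hMF x hx))).1
    · simp only [hx, if_false]
      exact he4 x hx
  · intro x _ y _ hxy
    by_cases hx : x ∈ M <;> by_cases hy : y ∈ M <;> simp only [hx, hy, if_true, if_false]
    · exact fun e1 => hd2 x (Or.inl hx) y (Or.inl hy) hxy (hψ2 _ (hMF x hx) _ (hMF y hy) e1)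
    · exact key x hx y hy hxy
    · exact (key y hy x hx hxy.symm).symm
    · exact he6 x hx y hy hxy

/-- If nonadjacent vertices of a proper subset `U` have the same neighbours outside `U`, then `U`
is a clique. -/
lemma isClique_of_same_nbrs [Finite V] (h : Crit G n) (U : Set V) {z : V} (hz : z ∉ U)
    (hU : ∀ x ∈ U, ∀ y ∈ U, x ≠ y → ¬ G.Adj x y → ∀ w, w ∉ U → G.Adj w x → G.Adj w y) :
    ∀ x ∈ U, ∀ y ∈ U, x ≠ y → G.Adj x y := by
  intro a ha b hb hab
  by_contra hn
  let r : V → V → Prop := fun x y => x ∈ U ∧ y ∈ U ∧ x ≠ y ∧ ¬ G.Adj x y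
  have hsymm : ∀ x y, r x y → r y x := fun x y hxy =>
    ⟨hxy.2.1, hxy.1, hxy.2.2.1.symm, fun e => hxy.2.2.2 e.symm⟩
  let M : Set V := {x | Relation.ReflTransGen r a x}
  have hMU : ∀ x ∈ M, x ∈ U := by
    intro x hx
    rcases Relation.ReflTransGen.cases_tail hx with e | ⟨y, -, hy⟩
    · exact e ▸ ha
    · exact hy.2.1
  refine h.no_module M (a₀ := a) (b₀ := b) (z := z) Relation.ReflTransGen.refl
    (Relation.ReflTransGen.single ⟨ha, hb, hab, hn⟩) hab (fun e => hz (hMU z e)) ?_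
  intro w hw x hx y hy hwx
  by_cases hwU : w ∈ U
  · by_contra hwy
    exact hw (Relation.ReflTransGen.tail hy ⟨hMU y hy, hwU, fun e => hw (e ▸ hy),
      fun e => hwy e.symm⟩)
  · have key : ∀ x ∈ M, (G.Adj w a ↔ G.Adj w x) := by
      intro x hx
      induction hx with
      | refl => rfl
      | tail _ hyz ih =>
        refine ih.trans ⟨hU _ hyz.1 _ hyz.2.1 hyz.2.2.1 hyz.2.2.2 w hwU, ?_⟩
        have hzy := hsymm _ _ hyz
        exact hU _ hzy.1 _ hzy.2.1 hzy.2.2.1 hzy.2.2.2 w hwU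
    exact (key y hy).1 ((key x hx).2 hwx)

end Crit
/-- `C` is the vertex set of a connected component of the subgraph induced on `S`. -/
structure IsComp (G : SimpleGraph V) (S C : Set V) : Prop where
  sub : ∀ x ∈ C, x ∈ S
  closed : ∀ x ∈ C, ∀ y ∈ S, G.Adj x y → y ∈ C
  conn : ∀ p : V → Prop, (∃ x ∈ C, p x) → (∀ x ∈ C, p x → ∀ y ∈ C, G.Adj x y → p y) → ∀ x ∈ C, p x

lemma exists_isComp {S : Set V} {a : V} (ha : a ∈ S) : ∃ C, IsComp G S C ∧ a ∈ C := by
  let r : V → V → Prop := fun x y => x ∈ S ∧ y ∈ S ∧ G.Adj x y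
  have hsymm : Std.Symm r := ⟨fun x y hxy => ⟨hxy.2.1, hxy.1, hxy.2.2.symm⟩⟩
  have hS : ∀ x, Relation.ReflTransGen r a x → x ∈ S := by
    intro x hx
    rcases Relation.ReflTransGen.cases_tail hx with e | ⟨y, -, hy⟩
    · exact e ▸ ha
    · exact hy.2.1
  refine ⟨{x | Relation.ReflTransGen r a x}, ⟨hS, ?_, ?_⟩, Relation.ReflTransGen.refl⟩
  · intro x hx y hy hxy
    exact Relation.ReflTransGen.tail hx ⟨hS x hx, hy, hxy⟩
  · rintro p ⟨x, hx, hpx⟩ hp y hy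
    have hxy : Relation.ReflTransGen r x y :=
      (Relation.ReflTransGen.stdSymm.symm _ _ hx).trans hy
    have key : ∀ z, Relation.ReflTransGen r x z → p z := by
      intro z hz
      induction hz with
      | refl => exact hpx
      | tail hxz hzw ih =>
        exact hp _ (hx.trans hxz) ih _ ((hx.trans hxz).tail hzw) hzw.2.2
    exact key y hxy

/-- The set of nonneighbours of `v`. -/
def non (G : SimpleGraph V) (v : V) : Set V := {x | x ≠ v ∧ ¬ G.Adj v x}

namespace Crit

variable {n : ℕ}

lemma p5_adj (h : Crit G n) {v u x q r : V} (hvu : G.Adj v u) (hvx : ¬ G.Adj v x)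
    (hvq : ¬ G.Adj v q) (hvr : ¬ G.Adj v r) (hux : G.Adj u x) (huq : ¬ G.Adj u q)
    (hur : ¬ G.Adj u r) (hxq : G.Adj x q) (hqr : G.Adj q r) : G.Adj x r := by
  by_contra hxr
  exact h.p5 v u x q r hvu hux hxq hqr hvx hvq hvr huq hur hxr

lemma kite_not (h : Crit G n) {v u x y q : V} (hvu : G.Adj v u) (hvx : ¬ G.Adj v x)
    (hvy : ¬ G.Adj v y) (hvq : ¬ G.Adj v q) (hux : G.Adj u x) (huy : G.Adj u y)
    (huq : ¬ G.Adj u q) (hxy : G.Adj x y) (hqx : G.Adj q x) (hqy : G.Adj q y) : False :=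
  h.kite q x u v y hqx hux.symm hvu.symm hqy.symm hxy.symm huy.symm
    (fun e => huq e.symm) (fun e => hvq e.symm) (fun e => hvx e.symm) (fun e => hvy e.symm)

lemma complete_of_adj (h : Crit G n) {v u s k : V} {C K : Set V} (hvu : G.Adj v u)
    (hC : IsComp G (non G v) C) (hK : IsComp G {y | y ∈ C ∧ ¬ G.Adj u y} K) (hs : s ∈ C)
    (hus : G.Adj u s) (hk : k ∈ K) (hsk : G.Adj s k) : ∀ x ∈ K, G.Adj s x := by
  have hK1 : ∀ y ∈ K, ¬ G.Adj v y := fun y hy => (hC.sub y (hK.sub y hy).1).2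
  refine hK.conn _ ⟨k, hk, hsk⟩ ?_
  intro x hx hsx y hy hxy
  exact h.p5_adj hvu (hC.sub s hs).2 (hK1 x hx) (hK1 y hy) hus (hK.sub x hx).2 (hK.sub y hy).2
    hsx hxy

/-- A component of the nonneighbourhood of `v` in which some vertex `u` adjacent to `v` has a
neighbour and misses an edge is a clique. -/
lemma clique_of_edge (h : Crit G n) [Finite V] {v u x₀ q r : V} {C : Set V}
    (hC : IsComp G (non G v) C) (hvu : G.Adj v u) (hx₀ : x₀ ∈ C) (hux₀ : G.Adj u x₀) (hq : q ∈ C)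
    (hr : r ∈ C) (huq : ¬ G.Adj u q) (hur : ¬ G.Adj u r) (hqr : G.Adj q r) :
    (∀ x ∈ C, ∀ y ∈ C, x ≠ y → G.Adj x y) ∧ ∀ w, G.Adj v w → ∀ x ∈ C, ∀ y ∈ C, x ≠ y →
      G.Adj w x → G.Adj w y → ∀ z ∈ C, G.Adj w z := by
  have hv : ∀ y ∈ C, ¬ G.Adj v y := fun y hy => (hC.sub y hy).2
  obtain ⟨K, hK, hqK⟩ := exists_isComp (G := G) (S := {y | y ∈ C ∧ ¬ G.Adj u y}) ⟨hq, huq⟩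
  have hrK : r ∈ K := hK.closed q hqK r ⟨hr, hur⟩ hqr
  obtain ⟨s, hs, hus, hsK⟩ : ∃ s ∈ C, G.Adj u s ∧ ∀ k ∈ K, G.Adj s k := by
    by_contra! hc
    refine (hK.sub x₀ (hC.conn (fun x => x ∈ K) ⟨q, hq, hqK⟩ ?_ x₀ hx₀)).2 hux₀
    intro x hx hxK y hy hxy
    by_cases huy : G.Adj u y
    · obtain ⟨k, hk, hk'⟩ := hc y hy huy
      exact (hk' (h.complete_of_adj hvu hC hK hy huy hxK hxy.symm k hk)).elim
    · exact hK.closed x hxK y ⟨hy, huy⟩ hxy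
  obtain ⟨w, hvw, p₀, hp₀, hwp₀, q₀, hq₀, hwq₀⟩ : ∃ w, G.Adj v w ∧ ∃ p ∈ K, G.Adj w p ∧
      ∃ q ∈ K, ¬ G.Adj w q := by
    by_contra! hc
    refine h.no_module K (z := v) hqK hrK hqr.ne (fun hvK => (hC.sub v (hK.sub v hvK).1).1 rfl) ?_
    intro w hw x hx y hy hwx
    by_cases hvw : G.Adj v w
    · exact hc w hvw x hx hwx y hy
    · have hwv : w ≠ v := by
        rintro rfl
        exact hv x (hK.sub x hx).1 hwx
      have hwC := hC.closed x (hK.sub x hx).1 w ⟨hwv, hvw⟩ hwx.symm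
      have huw : G.Adj u w := by
        by_contra huw
        exact hw (hK.closed x hx w ⟨hwC, huw⟩ hwx.symm)
      exact h.complete_of_adj hvu hC hK hwC huw hx hwx y hy
  obtain ⟨p, hp, hwp, q₁, hq₁, hwq₁, hpq⟩ : ∃ p ∈ K, G.Adj w p ∧ ∃ q ∈ K, ¬ G.Adj w q ∧
      G.Adj p q := by
    by_contra! hc
    refine hwq₀ (hK.conn (fun x => G.Adj w x) ⟨p₀, hp₀, hwp₀⟩ ?_ q₀ hq₀)
    intro x hx hwx y hy hxy
    by_contra hwy
    exact hc x hx hwx y hy hwy hxy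
  have hKC : ∀ k ∈ K, k ∈ C := fun k hk => (hK.sub k hk).1
  have hSw : ∀ s ∈ C, (∀ k ∈ K, G.Adj s k) → ¬ G.Adj w s := fun s hs hsK hws =>
    h.kite_not hvw (hv s hs) (hv p (hKC p hp)) (hv q₁ (hKC _ hq₁)) hws hwp hwq₁ (hsK p hp)
      (hsK q₁ hq₁).symm hpq.symm
  obtain ⟨L, hL, hqL⟩ := exists_isComp (G := G) (S := {y | y ∈ C ∧ ¬ G.Adj w y})
    ⟨hKC q₁ hq₁, hwq₁⟩
  have hSL : ∀ s ∈ C, (∀ k ∈ K, G.Adj s k) → s ∈ L := fun s hs hsK =>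
    hL.closed q₁ hqL s ⟨hs, hSw s hs hsK⟩ (hsK q₁ hq₁).symm
  have hsL := hSL s hs hsK
  have hKL : ∀ k ∈ K, ¬ G.Adj w k → k ∈ L := fun k hk hwk =>
    hL.closed s hsL k ⟨hKC k hk, hwk⟩ (hsK k hk)
  have hPL : ∀ k ∈ K, G.Adj w k → ∀ x ∈ L, G.Adj k x := fun k hk hwk =>
    h.complete_of_adj hvw hC hL (hKC k hk) hwk hsL (hsK k hk).symm
  have hcases : ∀ z ∈ C, (∃ k ∈ K, G.Adj k z) → z ∈ K ∨ (G.Adj u z ∧ ∀ k ∈ K, G.Adj z k) := by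
    rintro z hz ⟨k, hk, hkz⟩
    by_cases huz : G.Adj u z
    · exact Or.inr ⟨huz, h.complete_of_adj hvu hC hK hz huz hk hkz.symm⟩
    · exact Or.inl (hK.closed k hk z ⟨hz, huz⟩ hkz)
  have hCcases : ∀ z ∈ C, z ∈ K ∨ (G.Adj u z ∧ ∀ k ∈ K, G.Adj z k) := by
    have : ∀ z ∈ C, (z ∈ K ∨ z ∈ L) := by
      refine hC.conn _ ⟨q, hq, Or.inl hqK⟩ ?_
      intro x hx hx' y hy hxy
      rcases hx' with hxK | hxL
      · rcases hcases y hy ⟨x, hxK, hxy⟩ with hy' | hy'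
        · exact Or.inl hy'
        · exact Or.inr (hSL y hy hy'.2)
      · by_cases hwy : G.Adj w y
        · have := h.complete_of_adj hvw hC hL hy hwy hxL hxy.symm q₁ hqL
          rcases hcases y hy ⟨q₁, hq₁, this.symm⟩ with hy' | hy'
          · exact Or.inl hy'
          · exact (hSw y hy hy'.2 hwy).elim
        · exact Or.inr (hL.closed x hxL y ⟨hy, hwy⟩ hxy)
    intro z hz
    rcases this z hz with hzK | hzL
    · exact Or.inl hzK
    · exact hcases z hz ⟨p, hp, hPL p hp hwp z hzL⟩
  have hyz : ∀ c₁ ∈ C, ∀ c₂ ∈ C, ¬ G.Adj c₁ c₂ → ∃ y ∈ C, ∃ z ∈ C, G.Adj y z ∧ G.Adj y c₁ ∧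
      G.Adj y c₂ ∧ G.Adj z c₁ ∧ G.Adj z c₂ := by
    intro c₁ hc₁ c₂ hc₂ hn
    rcases hCcases c₁ hc₁ with h1 | h1
    · rcases hCcases c₂ hc₂ with h2 | h2
      · by_cases hw1 : G.Adj w c₁
        · have hw2 : G.Adj w c₂ := by
            by_contra hw2
            exact hn (hPL c₁ h1 hw1 c₂ (hKL c₂ h2 hw2))
          exact ⟨s, hs, q₁, hKC q₁ hq₁, hsK q₁ hq₁, hsK c₁ h1, hsK c₂ h2,
            (hPL c₁ h1 hw1 q₁ hqL).symm, (hPL c₂ h2 hw2 q₁ hqL).symm⟩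
        · have hw2 : ¬ G.Adj w c₂ := by
            intro hw2
            exact hn (hPL c₂ h2 hw2 c₁ (hKL c₁ h1 hw1)).symm
          exact ⟨s, hs, p, hKC p hp, hsK p hp, hsK c₁ h1, hsK c₂ h2,
            (hPL p hp hwp c₁ (hKL _ h1 hw1)), (hPL p hp hwp c₂ (hKL _ h2 hw2))⟩
      · exact (hn (h2.2 c₁ h1).symm).elim
    · rcases hCcases c₂ hc₂ with h2 | h2
      · exact (hn (h1.2 c₂ h2)).elim
      · exact ⟨p, hKC p hp, q₁, hKC q₁ hq₁, hpq, (h1.2 p hp).symm, (h2.2 p hp).symm,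
          (h1.2 q₁ hq₁).symm, (h2.2 q₁ hq₁).symm⟩
  have hclique : ∀ x ∈ C, ∀ y ∈ C, x ≠ y → G.Adj x y := by
    refine h.isClique_of_same_nbrs C (z := v) (fun e => (hC.sub v e).1 rfl) ?_
    intro c₁ hc₁ c₂ hc₂ hne hn w hw hw1
    by_contra hw2
    have hvw : G.Adj v w := by
      by_contra hvw
      refine hw (hC.closed c₁ hc₁ w ⟨?_, hvw⟩ hw1.symm)
      rintro rfl
      exact hv c₁ hc₁ hw1
    obtain ⟨y, hy, z, hz, h1, h2, h3, h4, h5⟩ := hyz c₁ hc₁ c₂ hc₂ hn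
    by_cases hwy : G.Adj w y <;> by_cases hwz : G.Adj w z
    · exact h.kite_not hvw (hv y hy) (hv z hz) (hv c₂ hc₂) hwy hwz hw2 h1 h3.symm h5.symm
    · exact h.kite_not hvw (hv c₁ hc₁) (hv y hy) (hv z hz) hw1 hwy hwz h2.symm h4 h1.symm
    · exact h.kite_not hvw (hv c₁ hc₁) (hv z hz) (hv y hy) hw1 hwz hwy h4.symm h2 h1
    · exact hn (h.p5_adj hvw (hv c₁ hc₁) (hv y hy) (hv c₂ hc₂) hw1 hwy hw2 h2.symm h3)
  refine ⟨hclique, ?_⟩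
  intro w hvw x hx y hy hxy hwx hwy z hz
  by_contra hwz
  exact h.kite_not hvw (hv x hx) (hv y hy) (hv z hz) hwx hwy hwz (hclique x hx y hy hxy)
    (hclique z hz x hx (fun e => hwz (e ▸ hwx))) (hclique z hz y hy (fun e => hwz (e ▸ hwy)))

/-- A neighbour of `v` with a neighbour in a component of the nonneighbourhood of `v` meets every
edge of that component. -/
lemma not_adj_of_comp (h : Crit G n) [Finite V] {v u x₀ q r : V} {C : Set V}
    (hC : IsComp G (non G v) C) (hvu : G.Adj v u) (hx₀ : x₀ ∈ C) (hux₀ : G.Adj u x₀) (hq : q ∈ C)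
    (hr : r ∈ C) (huq : ¬ G.Adj u q) (hur : ¬ G.Adj u r) : ¬ G.Adj q r := by
  classical
  intro hqr
  have := Fintype.ofFinite V
  obtain ⟨hcl, htwo⟩ := h.clique_of_edge hC hvu hx₀ hux₀ hq hr huq hur hqr
  have hv : ∀ y ∈ C, ¬ G.Adj v y := fun y hy => (hC.sub y hy).2
  have hxq : x₀ ≠ q := fun e => huq (e ▸ hux₀)
  have hxr : x₀ ≠ r := fun e => hur (e ▸ hux₀)
  have hqr' := hqr.ne
  let U : Set V := {w | G.Adj v w ∧ ∀ z ∈ C, G.Adj w z}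
  have hmiss : ∀ w, w ∉ U → w ∉ C → w ≠ v → ∃ t₁ ∈ C, ∃ t₂ ∈ C, t₁ ≠ t₂ ∧ ¬ G.Adj w t₁ ∧
      ¬ G.Adj w t₂ := by
    intro w hwU hwC hwv
    by_cases hvw : G.Adj v w
    · have key : ∀ x ∈ C, ∀ y ∈ C, x ≠ y → G.Adj w x → ¬ G.Adj w y :=
        fun x hx y hy hxy hwx hwy => hwU ⟨hvw, htwo w hvw x hx y hy hxy hwx hwy⟩
      by_cases h1 : G.Adj w x₀
      · exact ⟨q, hq, r, hr, hqr', key _ hx₀ _ hq hxq h1, key _ hx₀ _ hr hxr h1⟩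
      · by_cases h2 : G.Adj w q
        · exact ⟨x₀, hx₀, r, hr, hxr, h1, key _ hq _ hr hqr' h2⟩
        · exact ⟨x₀, hx₀, q, hq, hxq, h1, h2⟩
    · have key : ∀ x ∈ C, ¬ G.Adj w x := fun x hx hwx =>
        hwC (hC.closed x hx w ⟨hwv, hvw⟩ hwx.symm)
      exact ⟨q, hq, r, hr, hqr', key q hq, key r hr⟩
  have hU : ∀ x ∈ U, ∀ y ∈ U, x ≠ y → G.Adj x y := by
    refine h.isClique_of_same_nbrs U (z := v) (fun e => e.1.ne rfl) ?_
    intro a ha b hb hab hn w hw hwa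
    by_contra hwb
    have hwv : w ≠ v := by
      rintro rfl
      exact hwb hb.1
    have hwC : w ∉ C := fun hwC => hwb (hb.2 w hwC).symm
    obtain ⟨t₁, ht₁, t₂, ht₂, hne, h1, h2⟩ := hmiss w hw hwC hwv
    exact h.kite b t₁ a w t₂ (hb.2 t₁ ht₁) (ha.2 t₁ ht₁).symm hwa.symm (hb.2 t₂ ht₂).symm
      (hcl t₂ ht₂ t₁ ht₁ hne.symm) (ha.2 t₂ ht₂).symm (fun e => hn e.symm) (fun e => hwb e.symm)
      (fun e => h1 e.symm) (fun e => h2 e.symm)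
  have hn2 := h.two_le
  let T : Finset V := Finset.univ.filter fun x => x ∈ C ∨ x ∈ U
  have hT : T.card ≤ n := by
    refine h.clq T (fun _ _ => trivial) ?_
    intro x hx y hy hxy
    rcases (Finset.mem_filter.1 hx).2 with hx | hx <;>
      rcases (Finset.mem_filter.1 hy).2 with hy | hy
    · exact hcl x hx y hy hxy
    · exact (hy.2 x hx).symm
    · exact hx.2 y hy
    · exact hU x hx y hy hxy
  have hTc : ∀ c ∈ C, (T.erase c).card + 1 ≤ n := by
    intro c hc
    have hcT : c ∈ T := Finset.mem_filter.2 ⟨Finset.mem_univ _, Or.inl hc⟩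
    have := Finset.card_erase_add_one hcT
    omega
  have hnbr : ∀ c ∈ C, ∀ w, G.Adj c w → w ∈ T.erase c ∨ (G.Adj v w ∧ w ∉ U) := by
    intro c hc w hcw
    by_cases hw : w ∈ C ∨ w ∈ U
    · exact Or.inl (Finset.mem_erase.2 ⟨hcw.ne', Finset.mem_filter.2 ⟨Finset.mem_univ _, hw⟩⟩)
    · push Not at hw
      refine Or.inr ⟨?_, hw.2⟩
      by_contra hvw
      refine hw.1 (hC.closed c hc w ⟨?_, hvw⟩ hcw)
      rintro rfl
      exact hv c hc hcw.symm
  have hex : ∀ c ∈ C, ∃ w, G.Adj c w ∧ G.Adj v w ∧ w ∉ U := by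
    intro c hc
    by_contra! hcon
    have := h.le_card_of_adj c (T.erase c) (fun w hw =>
      (hnbr c hc w hw).resolve_right fun e => e.2 (hcon w hw e.1))
    have := hTc c hc
    omega
  obtain ⟨w₁, hw₁, hvw₁, hw₁U⟩ := hex x₀ hx₀
  obtain ⟨w₂, hw₂, hvw₂, hw₂U⟩ := hex r hr
  have huniq : ∀ w, G.Adj v w → w ∉ U → ∀ x ∈ C, ∀ y ∈ C, x ≠ y → G.Adj x w → ¬ G.Adj y w :=
    fun w hvw hwU x hx y hy hxy hwx hwy =>
      hwU ⟨hvw, htwo w hvw x hx y hy hxy hwx.symm hwy.symm⟩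
  have hvq : v ∈ non G q := ⟨fun e => (hC.sub v (e ▸ hq)).1 rfl, fun e => hv q hq e.symm⟩
  obtain ⟨D, hD, hvD⟩ := exists_isComp (G := G) (S := non G q) hvq
  have hDw : ∀ w, G.Adj v w → ¬ G.Adj q w → w ∈ D := fun w hvw hqw =>
    hD.closed v hvD w ⟨fun e => hv q hq (e ▸ hvw), hqw⟩ hvw
  have hw₁D : w₁ ∈ D := hDw w₁ hvw₁ (huniq w₁ hvw₁ hw₁U x₀ hx₀ q hq hxq hw₁)
  have hw₂D : w₂ ∈ D := hDw w₂ hvw₂ (huniq w₂ hvw₂ hw₂U r hr q hq hqr'.symm hw₂)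
  obtain ⟨-, hD2⟩ := h.clique_of_edge hD (hcl q hq x₀ hx₀ hxq.symm) hw₁D hw₁ hvD hw₂D
    (fun e => hv x₀ hx₀ e.symm) (huniq w₂ hvw₂ hw₂U r hr x₀ hx₀ hxr.symm hw₂) hvw₂
  have hle := h.le_card_of_adj x₀ (insert w₁ (T.erase x₀)) (by
    intro w hw
    rcases hnbr x₀ hx₀ w hw with e | ⟨hvw, hwU⟩
    · exact Finset.mem_insert_of_mem e
    · by_cases e : w = w₁
      · exact e ▸ Finset.mem_insert_self _ _
      · have hwD := hDw w hvw (huniq w hvw hwU x₀ hx₀ q hq hxq hw)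
        exact (hv x₀ hx₀ (hD2 x₀ (hcl q hq x₀ hx₀ hxq.symm) w hwD w₁ hw₁D e hw hw₁ v hvD).symm).elim)
  have := Finset.card_insert_le w₁ (T.erase x₀)
  have := hTc x₀ hx₀
  omega

end Crit
/-- `S` is a stable set. -/
def Stb (G : SimpleGraph V) (S : Set V) : Prop := ∀ x ∈ S, ∀ y ∈ S, ¬ G.Adj x y

lemma IsComp.eq_of_mem {S C D : Set V} {x : V} (hC : IsComp G S C) (hD : IsComp G S D)
    (hxC : x ∈ C) (hxD : x ∈ D) : C = D :=
  Set.Subset.antisymm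
    (hC.conn (fun y => y ∈ D) ⟨x, hxC, hxD⟩ fun y _ hyD z hz hyz => hD.closed y hyD z (hC.sub z hz) hyz)
    (hD.conn (fun y => y ∈ C) ⟨x, hxD, hxC⟩ fun y _ hyC z hz hyz => hC.closed y hyC z (hD.sub z hz) hyz)

lemma colOn_of_isComp {S : Set V} {k : ℕ} (hS : ∀ C, IsComp G S C → ColOn G C k) :
    ColOn G S k := by
  classical
  have h1 : ∀ x, ∃ C, x ∈ S → IsComp G S C ∧ x ∈ C := by
    intro x
    by_cases hx : x ∈ S
    · obtain ⟨C, hC⟩ := exists_isComp (G := G) hx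
      exact ⟨C, fun _ => hC⟩
    · exact ⟨∅, fun e => (hx e).elim⟩
  choose C hC using h1
  have h2 : ∀ C : Set V, ∃ c : V → ℕ, IsComp G S C →
      (∀ v ∈ C, c v < k) ∧ ∀ u ∈ C, ∀ v ∈ C, G.Adj u v → c u ≠ c v := by
    intro C
    by_cases hC : IsComp G S C
    · obtain ⟨c, hc⟩ := hS C hC
      exact ⟨c, fun _ => hc⟩
    · exact ⟨fun _ => 0, fun e => (hC e).elim⟩
  choose c hc using h2
  refine ⟨fun x => c (C x) x, fun x hx => (hc _ (hC x hx).1).1 x (hC x hx).2, ?_⟩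
  intro x hx y hy hxy
  have hyC : y ∈ C x := (hC x hx).1.closed x (hC x hx).2 y hy hxy
  have e := (hC x hx).1.eq_of_mem (hC y hy).1 hyC (hC y hy).2
  simp only [← e]
  exact (hc _ (hC x hx).1).2 x (hC x hx).2 y hyC hxy

namespace Crit

variable {n : ℕ}

lemma exists_nbr_of_comp (h : Crit G n) [Finite V] {v x : V} {C : Set V}
    (hC : IsComp G (non G v) C) (hx : x ∈ C) : ∃ u, G.Adj v u ∧ ∃ y ∈ C, G.Adj u y := by
  by_contra! hc
  refine h.no_clique_cutset ∅ C (a := x) (b := v) (by simp) hx (by simp)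
    (fun e => (hC.sub v e).1 rfl) (by simp) ?_
  intro y hy w hyw
  refine Or.inl (hC.closed y hy w ⟨?_, fun hvw => hc w hvw y hy hyw.symm⟩ hyw)
  rintro rfl
  exact (hC.sub y hy).2 hyw.symm

lemma clq_le_three_vertices (h : Crit G n) (hn : n ≤ 2) {x y z : V} (hxy : G.Adj x y)
    (hxz : G.Adj x z) : ¬ G.Adj y z := by
  classical
  intro hyz
  have h3 : ({x, y, z} : Finset V).card = 3 := by
    rw [Finset.card_eq_three]
    exact ⟨x, y, z, hxy.ne, hxz.ne, hyz.ne, rfl⟩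
  have := h.clq {x, y, z} (fun _ _ => trivial) (by
    intro a ha b hb hab
    simp only [Finset.mem_insert, Finset.mem_singleton] at ha hb
    rcases ha with rfl | rfl | rfl <;> rcases hb with rfl | rfl | rfl <;>
      first | exact (hab rfl).elim | assumption | (apply SimpleGraph.Adj.symm; assumption))
  omega

lemma three_le (h : Crit G n) [Finite V] : 3 ≤ n := by
  classical
  by_contra! hlt
  have hn : n ≤ 2 := by omega
  have hn2 := h.two_le
  obtain ⟨v⟩ : Nonempty V := by
    by_contra hV
    rw [not_nonempty_iff] at hV
    exact h.notCol ⟨fun _ => 0, fun v => hV.elim v, fun v => hV.elim v⟩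
  have hH : ColOn G (non G v) 2 := by
    refine colOn_of_isComp fun C hC => ?_
    by_cases hne : ∃ x, x ∈ C
    · obtain ⟨x, hx⟩ := hne
      obtain ⟨u, hvu, y, hy, huy⟩ := h.exists_nbr_of_comp hC hx
      have h1 : ColOn G {y | y ∈ C ∧ G.Adj u y} 1 := colOn_one fun a ha b hb =>
        h.clq_le_three_vertices hn ha.2 hb.2
      have h2 : ColOn G {y | y ∈ C ∧ ¬ G.Adj u y} 1 := colOn_one fun a ha b hb =>
        h.not_adj_of_comp hC hvu hy huy ha.1 hb.1 ha.2 hb.2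
      refine (h1.union h2).mono (fun a ha => ?_) le_rfl
      by_cases hua : G.Adj u a
      · exact Or.inl ⟨ha, hua⟩
      · exact Or.inr ⟨ha, hua⟩
    · exact ⟨fun _ => 0, fun x hx => (hne ⟨x, hx⟩).elim, fun x hx => (hne ⟨x, hx⟩).elim⟩
  have hH' : ColOn G {x | ¬ G.Adj v x} 2 := by
    obtain ⟨c, hc1, hc2⟩ := hH
    refine ⟨fun x => if x = v then 0 else c x, ?_, ?_⟩
    · intro x hx
      by_cases hxv : x = v
      · simp [hxv]
      · simp only [hxv, if_false]
        exact hc1 x ⟨hxv, hx⟩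
    · intro x hx y hy hxy
      have hxv : x ≠ v := fun e => hy (e ▸ hxy)
      have hyv : y ≠ v := fun e => hx (e ▸ hxy.symm)
      simp only [hxv, hyv, if_false]
      exact hc2 x ⟨hxv, hx⟩ y ⟨hyv, hy⟩ hxy
  have hN : ColOn G {x | G.Adj v x} 1 := colOn_one fun a ha b hb =>
    h.clq_le_three_vertices hn ha hb
  refine h.notCol ((hH'.union hN).mono (fun x _ => ?_) (by omega))
  by_cases hvx : G.Adj v x
  · exact Or.inr hvx
  · exact Or.inl hvx

/-- Every vertex has a neighbour in, or belongs to, every triangle. -/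
lemma no_triangle_in_non (h : Crit G n) [Finite V] {v t₀ t₁ t₂ : V} (h₀ : t₀ ∈ non G v)
    (h₁ : t₁ ∈ non G v) (h₂ : t₂ ∈ non G v) (h01 : G.Adj t₀ t₁) (h02 : G.Adj t₀ t₂)
    (h12 : G.Adj t₁ t₂) : False := by
  obtain ⟨C, hC, ht₀⟩ := exists_isComp (G := G) h₀
  have ht₁ := hC.closed t₀ ht₀ t₁ h₁ h01
  have ht₂ := hC.closed t₀ ht₀ t₂ h₂ h02
  have hv : ∀ y ∈ C, ¬ G.Adj v y := fun y hy => (hC.sub y hy).2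
  let U : Set V := {u | G.Adj v u ∧ ∃ x ∈ C, G.Adj u x}
  have hcomp : ∀ u ∈ U, ∀ x ∈ C, ∀ y ∈ C, ∀ z ∈ C, G.Adj x y → G.Adj x z → G.Adj y z →
      G.Adj u x := by
    rintro u ⟨hvu, w, hw, huw⟩ x hx y hy z hz hxy hxz hyz
    by_contra hux
    have huy : G.Adj u y := by
      by_contra huy
      exact h.not_adj_of_comp hC hvu hw huw hx hy hux huy hxy
    have huz : G.Adj u z := by
      by_contra huz
      exact h.not_adj_of_comp hC hvu hw huw hx hz hux huz hxz
    exact h.kite_not hvu (hv y hy) (hv z hz) (hv x hx) huy huz hux hyz hxy hxz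
  have hU : ∀ x ∈ U, ∀ y ∈ U, x ≠ y → G.Adj x y := by
    refine h.isClique_of_same_nbrs U (z := v) (fun e => e.1.ne rfl) ?_
    intro a ha b hb hab hn w hw hwa
    by_contra hwb
    have hwv : w ≠ v := by
      rintro rfl
      exact hwb hb.1
    have hk : ∀ x ∈ C, ∀ y ∈ C, ∀ z ∈ C, G.Adj x y → G.Adj x z → G.Adj y z →
        G.Adj w x ∨ G.Adj w y := by
      intro x hx y hy z hz hxy hxz hyz
      by_contra! hwxy
      have hax := hcomp a ha x hx y hy z hz hxy hxz hyz
      have hay := hcomp a ha y hy x hx z hz hxy.symm hyz hxz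
      have hbx := hcomp b hb x hx y hy z hz hxy hxz hyz
      have hby := hcomp b hb y hy x hx z hz hxy.symm hyz hxz
      exact h.kite b x a w y hbx hax.symm hwa.symm hby.symm hxy.symm hay.symm (fun e => hn e.symm)
        (fun e => hwb e.symm) (fun e => hwxy.1 e.symm) (fun e => hwxy.2 e.symm)
    have hwC : w ∈ C := by
      by_contra hwC
      have hno : ∀ x ∈ C, ¬ G.Adj w x := by
        intro x hx hwx
        by_cases hvw : G.Adj v w
        · exact hw ⟨hvw, x, hx, hwx⟩
        · exact hwC (hC.closed x hx w ⟨hwv, hvw⟩ hwx.symm)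
      exact (hk t₀ ht₀ t₁ ht₁ t₂ ht₂ h01 h02 h12).elim (hno t₀ ht₀) (hno t₁ ht₁)
    have hno : ∀ x ∈ C, ∀ y ∈ C, G.Adj x y → G.Adj w x → ¬ G.Adj w y := fun x hx y hy hxy hwx hwy =>
      hwb (hcomp b hb w hwC x hx y hy hwx hwy hxy).symm
    have k1 := hk t₀ ht₀ t₁ ht₁ t₂ ht₂ h01 h02 h12
    have k2 := hk t₀ ht₀ t₂ ht₂ t₁ ht₁ h02 h01 h12.symm
    have k3 := hk t₁ ht₁ t₂ ht₂ t₀ ht₀ h12 h01.symm h02.symm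
    have k4 := hno t₀ ht₀ t₁ ht₁ h01
    have k5 := hno t₀ ht₀ t₂ ht₂ h02
    have k6 := hno t₁ ht₁ t₂ ht₂ h12
    tauto
  refine h.no_clique_cutset U C (a := t₀) (b := v) hU ht₀ (fun x hx hxU => hv x hx hxU.1)
    (fun e => (hC.sub v e).1 rfl) (fun e => e.1.ne rfl) ?_
  intro x hx y hxy
  by_cases hvy : G.Adj v y
  · exact Or.inr ⟨hvy, x, hx, hxy.symm⟩
  · refine Or.inl (hC.closed x hx y ⟨?_, hvy⟩ hxy)
    rintro rfl
    exact hv x hx hxy.symm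

lemma exists_triangle (h : Crit G n) [Finite V] : ∃ x y z, G.Adj x y ∧ G.Adj x z ∧ G.Adj y z := by
  classical
  have hn := h.three_le
  by_contra! hc
  refine h.notCol ((h.low 2 (by omega) Set.univ ?_).mono le_rfl (by omega))
  intro t _ ht
  by_contra! hlt
  obtain ⟨x, y, z, hx, hy, hz, hxy, hxz, hyz⟩ := Finset.two_lt_card_iff.1 hlt
  exact hc x y z (ht x hx y hy hxy) (ht x hx z hz hxz) (ht y hy z hz hyz)

lemma no_two_K2 (h : Crit G n) [Finite V] {a b c d : V} (hab : G.Adj a b) (hcd : G.Adj c d)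
    (hac : ¬ G.Adj a c) (had : ¬ G.Adj a d) (hbc : ¬ G.Adj b c) (hbd : ¬ G.Adj b d) : False := by
  have k1 : ∀ {a b c d : V}, G.Adj a b → G.Adj c d → ¬ G.Adj a c → ¬ G.Adj a d → ¬ G.Adj b c →
      ¬ G.Adj b d → ∀ f, G.Adj f a → G.Adj f b → G.Adj f c := by
    intro a b c d hab hcd hac had hbc hbd f hfa hfb
    by_contra hfc
    exact h.no_triangle_in_non (v := c) ⟨by rintro rfl; exact hac hfa.symm, fun e => hfc e.symm⟩
      ⟨by rintro rfl; exact had hcd, fun e => hac e.symm⟩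
      ⟨by rintro rfl; exact hbd hcd, fun e => hbc e.symm⟩ hfa hfb hab
  have k2 : ∀ {a b c d : V}, G.Adj a b → G.Adj c d → ¬ G.Adj a c → ¬ G.Adj a d → ¬ G.Adj b c →
      ¬ G.Adj b d → ∀ f, G.Adj f a → G.Adj f c → G.Adj f b := by
    intro a b c d hab hcd hac had hbc hbd f hfa hfc
    by_contra hfb
    by_cases hfd : G.Adj f d
    · exact hfb (k1 hcd hab.symm (fun e => hbc e.symm) (fun e => hac e.symm)
        (fun e => hbd e.symm) (fun e => had e.symm) f hfc hfd)
    · exact h.p5 b a f c d hab.symm hfa.symm hfc hcd (fun e => hfb e.symm) hbc hbd hac had hfd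
  have hac' : ¬ G.Adj c a := fun e => hac e.symm
  have had' : ¬ G.Adj d a := fun e => had e.symm
  have hbc' : ¬ G.Adj c b := fun e => hbc e.symm
  have hbd' : ¬ G.Adj d b := fun e => hbd e.symm
  let F : Set V := {f | G.Adj f a ∧ G.Adj f b ∧ G.Adj f c ∧ G.Adj f d}
  have f1 : ∀ f, G.Adj f a → G.Adj f b → f ∈ F := fun f h1 h2 =>
    ⟨h1, h2, k1 hab hcd hac had hbc hbd f h1 h2, k1 hab hcd.symm had hac hbd hbc f h1 h2⟩
  have f2 : ∀ f, G.Adj f c → G.Adj f d → f ∈ F := fun f h1 h2 =>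
    ⟨k1 hcd hab hac' hbc' had' hbd' f h1 h2, k1 hcd hab.symm hbc' hac' hbd' had' f h1 h2, h1, h2⟩
  have f3 : ∀ f, G.Adj f a → G.Adj f c → f ∈ F := fun f h1 h2 =>
    f1 f h1 (k2 hab hcd hac had hbc hbd f h1 h2)
  have f4 : ∀ f, G.Adj f a → G.Adj f d → f ∈ F := fun f h1 h2 =>
    f1 f h1 (k2 hab hcd.symm had hac hbd hbc f h1 h2)
  have f5 : ∀ f, G.Adj f b → G.Adj f c → f ∈ F := fun f h1 h2 =>
    f1 f (k2 hab.symm hcd hbc hbd hac had f h1 h2) h1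
  have f6 : ∀ f, G.Adj f b → G.Adj f d → f ∈ F := fun f h1 h2 =>
    f1 f (k2 hab.symm hcd.symm hbd hbc had hac f h1 h2) h1
  have hit : ∀ v x y z, G.Adj x y → G.Adj x z → G.Adj y z → v ≠ x → v ≠ y → v ≠ z →
      G.Adj x v ∨ G.Adj y v ∨ G.Adj z v := by
    intro v x y z hxy hxz hyz hvx hvy hvz
    by_contra! hc
    exact h.no_triangle_in_non (v := v) ⟨hvx.symm, fun e => hc.1 e.symm⟩
      ⟨hvy.symm, fun e => hc.2.1 e.symm⟩ ⟨hvz.symm, fun e => hc.2.2 e.symm⟩ hxy hxz hyz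
  by_cases hF : ∃ f, f ∈ F
  · obtain ⟨f₀, hf₀⟩ := hF
    refine h.not_join F (a := f₀) (b := a) hf₀ (fun e => e.1.ne rfl) ?_
    intro f hf y hy
    by_contra hfy
    have hya : y ≠ a := by rintro rfl; exact hfy hf.1
    have hyb : y ≠ b := by rintro rfl; exact hfy hf.2.1
    have hyc : y ≠ c := by rintro rfl; exact hfy hf.2.2.1
    have hyd : y ≠ d := by rintro rfl; exact hfy hf.2.2.2
    have hyf : y ≠ f := by rintro rfl; exact hy hf
    have e1 := (hit y f a b hf.1 hf.2.1 hab hyf hya hyb).resolve_left hfy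
    have e2 := (hit y f c d hf.2.2.1 hf.2.2.2 hcd hyf hyc hyd).resolve_left hfy
    rcases e1 with e1 | e1 <;> rcases e2 with e2 | e2
    · exact hy (f3 y e1.symm e2.symm)
    · exact hy (f4 y e1.symm e2.symm)
    · exact hy (f5 y e1.symm e2.symm)
    · exact hy (f6 y e1.symm e2.symm)
  · have hF' : ∀ f, f ∉ F := fun f hf => hF ⟨f, hf⟩
    have hne : ∀ {a b c : V}, G.Adj a b → ¬ G.Adj a c → ¬ G.Adj b c → c ≠ a →
        (∀ f, G.Adj f a → ¬ G.Adj f c) → ∀ x y z, G.Adj x y → G.Adj x z → G.Adj y z → x ≠ a := by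
      rintro a b c hab hac hbc hca hf x y z hxy hxz hyz rfl
      rcases hit c x y z hxy hxz hyz hca (by rintro rfl; exact hac hxy)
        (by rintro rfl; exact hac hxz) with e | e | e
      · exact hac e
      · exact hf y hxy.symm e
      · exact hf z hxz.symm e
    have na := hne hab hac hbc (by rintro rfl; exact had hcd) fun f e1 e2 => hF' f (f3 f e1 e2)
    have nb := hne hab.symm hbc hac (by rintro rfl; exact hbd hcd) fun f e1 e2 => hF' f (f5 f e1 e2)
    have nc := hne hcd hac' had' (by rintro rfl; exact had hcd) fun f e1 e2 => hF' f (f3 f e2 e1)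
    have nd := hne hcd.symm had' hac' (by rintro rfl; exact hac hcd.symm) fun f e1 e2 =>
      hF' f (f4 f e2 e1)
    obtain ⟨x, y, z, hxy, hxz, hyz⟩ := h.exists_triangle
    have hhit : ∀ v, (∀ x y z, G.Adj x y → G.Adj x z → G.Adj y z → x ≠ v) →
        G.Adj x v ∨ G.Adj y v ∨ G.Adj z v := fun v hv => hit v x y z hxy hxz hyz
      (hv x y z hxy hxz hyz).symm (hv y x z hxy.symm hyz hxz).symm
      (hv z x y hxz.symm hyz.symm hxy).symm
    have ha := hhit a na
    have hb := hhit b nb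
    have hc := hhit c nc
    have hd := hhit d nd
    have g : ∀ f, ¬ (G.Adj f a ∧ G.Adj f b) ∧ ¬ (G.Adj f c ∧ G.Adj f d) ∧
        ¬ (G.Adj f a ∧ G.Adj f c) ∧ ¬ (G.Adj f a ∧ G.Adj f d) ∧ ¬ (G.Adj f b ∧ G.Adj f c) ∧
        ¬ (G.Adj f b ∧ G.Adj f d) := fun f => ⟨fun e => hF' f (f1 f e.1 e.2),
      fun e => hF' f (f2 f e.1 e.2), fun e => hF' f (f3 f e.1 e.2), fun e => hF' f (f4 f e.1 e.2),
      fun e => hF' f (f5 f e.1 e.2), fun e => hF' f (f6 f e.1 e.2)⟩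
    have gx := g x
    have gy := g y
    have gz := g z
    clear g hhit na nb nc nd hne hF' hF hit f1 f2 f3 f4 f5 f6 k1 k2
    grind

lemma exists_adj_of_mem_non (h : Crit G n) {v x : V} (hx : x ∈ non G v) :
    ∃ w ∈ non G v, G.Adj x w := by
  obtain ⟨w, hxw, hvw⟩ := h.exists_adj_not_adj hx.1 fun e => hx.2 e.symm
  exact ⟨w, ⟨by rintro rfl; exact hx.2 hxw.symm, hvw⟩, hxw⟩

lemma exists_mem_non (h : Crit G n) [Finite V] (v : V) : ∃ x, x ∈ non G v := by
  by_contra! hc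
  have hv : ∀ x, x ≠ v → G.Adj v x := by
    intro x hx
    by_contra hvx
    exact hc x ⟨hx, hvx⟩
  obtain ⟨b, hb⟩ : ∃ b, b ≠ v := by
    obtain ⟨x, y, z, hxy, -, -⟩ := h.exists_triangle
    by_cases hx : x = v
    · exact ⟨y, fun e => hxy.ne (hx.trans e.symm)⟩
    · exact ⟨x, hx⟩
  refine h.not_join {v} (a := v) (b := b) rfl hb ?_
  rintro x rfl y hy
  exact hv y hy

/-- An edge whose ends have few common non-neighbours does not exist. -/
lemma not_three_stable (h : Crit G n) {u v : V} (huv : G.Adj u v) {X Y Z : Set V}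
    (hX : Stb G X) (hY : Stb G Y) (hZ : Stb G Z)
    (hc : ∀ w, ¬ (G.Adj u w ∧ G.Adj v w) → w ∈ X ∪ Y ∪ Z) : False := by
  classical
  have hn := h.two_le
  have h1 : ColOn G {w | G.Adj u w ∧ G.Adj v w} (3 * (n - 2) / 2) := by
    refine h.low _ (by omega) _ ?_
    intro t ht ht'
    have hv : v ∉ t := fun e => (ht v e).2.ne rfl
    have hu : u ∉ insert v t := fun e => by
      rcases Finset.mem_insert.1 e with e | e
      · exact huv.ne e
      · exact (ht u e).1.ne rfl
    have := h.clq (insert u (insert v t)) (fun _ _ => trivial) (by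
      intro a ha b hb hab
      simp only [Finset.mem_insert] at ha hb
      rcases ha with rfl | rfl | ha <;> rcases hb with rfl | rfl | hb
      · exact (hab rfl).elim
      · exact huv
      · exact (ht _ hb).1
      · exact huv.symm
      · exact (hab rfl).elim
      · exact (ht _ hb).2
      · exact (ht _ ha).1.symm
      · exact (ht _ ha).2.symm
      · exact ht' _ ha _ hb hab)
    rw [Finset.card_insert_of_notMem hu, Finset.card_insert_of_notMem hv] at this
    omega
  refine h.notCol ((h1.union (((colOn_one hX).union (colOn_one hY)).union
    (colOn_one hZ))).mono (fun w _ => ?_) (by omega))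
  by_cases hw : G.Adj u w ∧ G.Adj v w
  · exact Or.inl hw
  · exact Or.inr (hc w hw)

/-- Every stable set is missed by some maximum clique. -/
lemma exists_clique_disjoint (h : Crit G n) {S : Set V} (hS : Stb G S) :
    ∃ t : Finset V, (∀ x ∈ t, x ∉ S) ∧ (∀ x ∈ t, ∀ y ∈ t, x ≠ y → G.Adj x y) ∧ t.card = n := by
  by_contra! hc
  have hn := h.two_le
  have h1 : ColOn G Sᶜ (3 * (n - 1) / 2) := by
    refine h.low _ (by omega) _ ?_
    intro t ht ht'
    have h1 := h.clq t (fun _ _ => trivial) ht'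
    have h2 := hc t ht ht'
    omega
  refine h.notCol ((h1.union (colOn_one hS)).mono (fun w _ => ?_) (by omega))
  by_cases hw : w ∈ S
  · exact Or.inr hw
  · exact Or.inl hw

/-- If the nonneighbourhood of `v` contains no induced 5-cycle, it is a bipartite graph with a
complete vertex on each side. -/
lemma exists_sides (h : Crit G n) [Finite V] (v : V)
    (h5 : ∀ a ∈ non G v, ∀ b ∈ non G v, ∀ c ∈ non G v, ∀ d ∈ non G v, ∀ e ∈ non G v, G.Adj a b →
      G.Adj b c → G.Adj c d → G.Adj d e → G.Adj e a → ¬ G.Adj a c → ¬ G.Adj b d → ¬ G.Adj c e →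
      ¬ G.Adj d a → ¬ G.Adj e b → False) :
    ∃ X Y : Set V, ∃ x₀ ∈ X, ∃ y₀ ∈ Y, Stb G X ∧ Stb G Y ∧
      (∀ w, w ∈ non G v ↔ w ∈ X ∨ w ∈ Y) ∧ (∀ w ∈ X, w ∉ Y) ∧ (∀ y ∈ Y, G.Adj x₀ y) ∧
      ∀ x ∈ X, G.Adj y₀ x := by
  classical
  have := Fintype.ofFinite V
  let N : V → Finset V := fun x => Finset.univ.filter fun y => y ∈ non G v ∧ G.Adj x y
  have hN : ∀ x y, y ∈ N x ↔ y ∈ non G v ∧ G.Adj x y := fun x y => by simp [N]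
  have htri : ∀ a ∈ non G v, ∀ b ∈ non G v, ∀ c ∈ non G v, G.Adj a b → G.Adj a c → ¬ G.Adj b c :=
    fun a ha b hb c hc hab hac hbc => h.no_triangle_in_non ha hb hc hab hac hbc
  obtain ⟨z, hz⟩ := h.exists_mem_non v
  obtain ⟨x₀, hx₀, hmax⟩ := Finset.exists_max_image (Finset.univ.filter fun x => x ∈ non G v)
    (fun x => (N x).card) ⟨z, by simpa using hz⟩
  have hx₀ : x₀ ∈ non G v := by simpa using hx₀
  have hmax : ∀ x ∈ non G v, (N x).card ≤ (N x₀).card := fun x hx => hmax x (by simpa using hx)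
  let Y : Set V := {y | y ∈ non G v ∧ G.Adj x₀ y}
  let X : Set V := {x | x ∈ non G v ∧ ¬ G.Adj x₀ x}
  have hY : Stb G Y := fun a ha b hb => htri x₀ hx₀ a ha.1 b hb.1 ha.2 hb.2
  have hX : Stb G X := by
    have key : ∀ p ∈ X, ∀ q ∈ X, G.Adj p q → ∃ y ∈ Y, ¬ G.Adj p y ∧ G.Adj q y := by
      intro p hp q hq hpq
      have hex : ∃ y ∈ Y, ¬ G.Adj p y := by
        by_contra! hc
        have hlt : N x₀ ⊂ N p := by
          refine Finset.ssubset_iff_subset_ne.2 ⟨fun y hy => ?_, fun e => ?_⟩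
          · have hy := (hN x₀ y).1 hy
            exact (hN p y).2 ⟨hy.1, hc y hy⟩
          · have : q ∈ N x₀ := e ▸ (hN p q).2 ⟨hq.1, hpq⟩
            exact hq.2 ((hN x₀ q).1 this).2
        exact (Finset.card_lt_card hlt).not_ge (hmax p hp.1)
      obtain ⟨y, hy, hpy⟩ := hex
      refine ⟨y, hy, hpy, ?_⟩
      by_contra hqy
      exact h.no_two_K2 hy.2 hpq hp.2 hq.2 (fun e => hpy e.symm) (fun e => hqy e.symm)
    intro p hp q hq hpq
    obtain ⟨y₁, hy₁, hpy₁, hqy₁⟩ := key p hp q hq hpq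
    obtain ⟨y₂, hy₂, hqy₂, hpy₂⟩ := key q hq p hp hpq.symm
    exact h5 x₀ hx₀ y₁ hy₁.1 q hq.1 p hp.1 y₂ hy₂.1 hy₁.2 hqy₁.symm hpq.symm hpy₂ hy₂.2.symm
      hq.2 (fun e => hpy₁ e.symm) hqy₂ (fun e => hp.2 e.symm) (hY y₂ hy₂ y₁ hy₁)
  obtain ⟨y₁, hy₁, hxy₁⟩ := h.exists_adj_of_mem_non hx₀
  obtain ⟨y₀, hy₀, hmax'⟩ := Finset.exists_max_image (Finset.univ.filter fun y => y ∈ Y)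
    (fun x => (N x).card) ⟨y₁, Finset.mem_filter.2 ⟨Finset.mem_univ _, hy₁, hxy₁⟩⟩
  have hy₀ : y₀ ∈ Y := by simpa using hy₀
  have hmax' : ∀ x ∈ Y, (N x).card ≤ (N y₀).card := fun x hx => hmax' x (by simpa using hx)
  have hXY : ∀ w ∈ non G v, w ∈ X ∨ w ∈ Y := by
    intro w hw
    by_cases e : G.Adj x₀ w
    · exact Or.inr ⟨hw, e⟩
    · exact Or.inl ⟨hw, e⟩
  refine ⟨X, Y, x₀, ⟨hx₀, fun e => e.ne rfl⟩, y₀, hy₀, hX, hY, fun w => ⟨hXY w, ?_⟩,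
    fun w hw hw' => hw.2 hw'.2, fun y hy => hy.2, ?_⟩
  · rintro (hw | hw)
    · exact hw.1
    · exact hw.1
  · intro x hx
    by_contra hyx
    obtain ⟨y, hy, hxy⟩ := h.exists_adj_of_mem_non hx.1
    have hyY : y ∈ Y := (hXY y hy).resolve_left fun e => hX x hx y e hxy
    obtain ⟨x', hx', hyx'⟩ : ∃ x' ∈ N y₀, x' ∉ N y := by
      by_contra! hc
      have hlt : N y₀ ⊂ N y := by
        refine Finset.ssubset_iff_subset_ne.2 ⟨fun w hw => hc w hw, fun e => ?_⟩
        have : x ∈ N y₀ := e ▸ (hN y x).2 ⟨hx.1, hxy.symm⟩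
        exact hyx ((hN y₀ x).1 this).2
      exact (Finset.card_lt_card hlt).not_ge (hmax' y hyY)
    have hx' := (hN _ _).1 hx'
    have hyx'' : ¬ G.Adj y x' := fun e => hyx' ((hN _ _).2 ⟨hx'.1, e⟩)
    have hx'X : x' ∈ X := (hXY x' hx'.1).resolve_right fun e => hY y₀ hy₀ x' e hx'.2
    exact h.no_two_K2 hxy hx'.2 (fun e => hyx e.symm) (hX x hx x' hx'X) (hY y hyY y₀ hy₀) hyx''

end Crit
/-- `a b c d e` is an induced 5-cycle of nonneighbours of `z`. -/
structure Ring (G : SimpleGraph V) (z a b c d e : V) : Prop where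
  ab : G.Adj a b
  bc : G.Adj b c
  cd : G.Adj c d
  de : G.Adj d e
  ea : G.Adj e a
  ac : ¬ G.Adj a c
  bd : ¬ G.Adj b d
  ce : ¬ G.Adj c e
  da : ¬ G.Adj d a
  eb : ¬ G.Adj e b
  za : a ∈ non G z
  zb : b ∈ non G z
  zc : c ∈ non G z
  zd : d ∈ non G z
  ze : e ∈ non G z

namespace Ring

variable {z a b c d e : V}

lemma rot (R : Ring G z a b c d e) : Ring G z b c d e a :=
  ⟨R.bc, R.cd, R.de, R.ea, R.ab, R.bd, R.ce, R.da, R.eb, R.ac, R.zb, R.zc, R.zd, R.ze, R.za⟩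

end Ring

/-- The neighbours of `z` whose neighbours on the cycle `a b c d e` are `a`, `b` and `d`. -/
def band (G : SimpleGraph V) (z a b c d e : V) : Set V :=
  {u | G.Adj z u ∧ G.Adj u a ∧ G.Adj u b ∧ G.Adj u d ∧ ¬ G.Adj u c ∧ ¬ G.Adj u e}

namespace Crit

variable {n : ℕ}

lemma ring_cover (h : Crit G n) [Finite V] {z a b c d e u : V} (R : Ring G z a b c d e)
    (hu : G.Adj z u) : G.Adj u a ∨ G.Adj u b := by
  by_contra! hc
  exact h.no_two_K2 hu R.ab R.za.2 R.zb.2 hc.1 hc.2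

lemma ring_opp (h : Crit G n) [Finite V] {z a b c d e : V} (u : V) (R : Ring G z a b c d e)
    (hua : G.Adj u a) (hub : G.Adj u b) : G.Adj u d := by
  by_contra hud
  exact h.no_triangle_in_non (v := d) ⟨by rintro rfl; exact R.da hua, fun e => hud e.symm⟩
    ⟨by rintro rfl; exact R.bd R.ab.symm, R.da⟩
    ⟨by rintro rfl; exact R.da R.ab.symm, fun e => R.bd e.symm⟩ hua hub R.ab

lemma ring_tri (h : Crit G n) [Finite V] {z a b c d e u : V} (R : Ring G z a b c d e)
    (hu : u ∈ non G z) : ¬ (G.Adj u a ∧ G.Adj u b) :=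
  fun e => h.no_triangle_in_non hu R.za R.zb e.1 e.2 R.ab

lemma ring_one (h : Crit G n) [Finite V] {z a b c d e u : V} (R : Ring G z a b c d e)
    (hua : G.Adj u a) : G.Adj u c ∨ G.Adj u d := by
  by_contra! hc
  exact h.no_two_K2 hua R.cd hc.1 hc.2 R.ac (fun e => R.da e.symm)

lemma ring_pair (h : Crit G n) [Finite V] {z a b c d e u : V} (R : Ring G z a b c d e)
    (hu : u ∈ non G z) :
    (G.Adj u b ∧ G.Adj u e) ∨ (G.Adj u c ∧ G.Adj u a) ∨ (G.Adj u d ∧ G.Adj u b) ∨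
      (G.Adj u e ∧ G.Adj u c) ∨ (G.Adj u a ∧ G.Adj u d) := by
  have k1 := h.ring_one (u := u) R
  have k2 := h.ring_one (u := u) R.rot
  have k3 := h.ring_one (u := u) R.rot.rot
  have k4 := h.ring_one (u := u) R.rot.rot.rot
  have k5 := h.ring_one (u := u) R.rot.rot.rot.rot
  by_cases hno : G.Adj u a ∨ G.Adj u b ∨ G.Adj u c ∨ G.Adj u d ∨ G.Adj u e
  · grind
  · push Not at hno
    obtain ⟨n1, n2, n3, n4, n5⟩ := hno
    obtain ⟨g, hg, hug⟩ := h.exists_adj_of_mem_non hu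
    have m : ∀ {z a b c d e}, Ring G z a b c d e → ¬ G.Adj u a → ¬ G.Adj u b →
        G.Adj g a ∨ G.Adj g b := by
      intro z a b c d e R n1 n2
      by_contra! hc
      exact h.no_two_K2 hug R.ab n1 n2 hc.1 hc.2
    have m1 := m R n1 n2
    have m2 := m R.rot n2 n3
    have m3 := m R.rot.rot n3 n4
    have m4 := m R.rot.rot.rot n4 n5
    have m5 := m R.rot.rot.rot.rot n5 n1
    have t1 := h.ring_tri R hg
    have t2 := h.ring_tri R.rot hg
    have t3 := h.ring_tri R.rot.rot hg
    have t4 := h.ring_tri R.rot.rot.rot hg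
    have t5 := h.ring_tri R.rot.rot.rot.rot hg
    grind

lemma ring_no_twin (h : Crit G n) [Finite V] {z a b c d e u : V} (R : Ring G z a b c d e)
    (hu : u ∈ non G z) (ha : u ≠ a) (hub : G.Adj u b) (hue : G.Adj u e) : False := by
  have nua : ¬ G.Adj u a := fun e => h.ring_tri R hu ⟨e, hub⟩
  have nuc : ¬ G.Adj u c := fun e => h.ring_tri R.rot hu ⟨hub, e⟩
  have nud : ¬ G.Adj u d := fun e => h.ring_tri R.rot.rot.rot hu ⟨e, hue⟩
  have R' : Ring G z u b c d e := ⟨hub, R.bc, R.cd, R.de, hue.symm, nuc, R.bd, R.ce,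
    fun e => nud e.symm, R.eb, hu, R.zb, R.zc, R.zd, R.ze⟩
  obtain ⟨w, huw, haw⟩ := h.exists_adj_not_adj ha nua
  have hwu := huw.symm
  have hwa : ¬ G.Adj w a := fun e => haw e.symm
  by_cases hzw : G.Adj z w
  · have k1 := h.ring_cover R hzw
    have k2 := h.ring_cover R.rot hzw
    have k3 := h.ring_cover R.rot.rot hzw
    have k5 := h.ring_cover R.rot.rot.rot.rot hzw
    have o2 := h.ring_opp w R.rot
    have o3 := h.ring_opp w R.rot.rot
    have o4 := h.ring_opp w R.rot.rot.rot
    have p1 := h.ring_opp w R'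
    have p5 := h.ring_opp w R'.rot.rot.rot.rot
    grind
  · have hwz : w ∈ non G z := ⟨by rintro rfl; exact hu.2 hwu, hzw⟩
    have q1 := h.ring_pair R hwz
    have q2 := h.ring_pair R' hwz
    have t1 := h.ring_tri R' hwz
    have t2 := h.ring_tri R'.rot.rot.rot.rot hwz
    have t3 := h.ring_tri R'.rot hwz
    have t4 := h.ring_tri R'.rot.rot hwz
    have t5 := h.ring_tri R'.rot.rot.rot hwz
    grind

lemma ring_eq (h : Crit G n) [Finite V] {z a b c d e u : V} (R : Ring G z a b c d e)
    (hu : u ∈ non G z) : u = a ∨ u = b ∨ u = c ∨ u = d ∨ u = e := by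
  by_contra! hc
  obtain ⟨ha, hb, hc, hd, he⟩ := hc
  rcases h.ring_pair R hu with ⟨p, q⟩ | ⟨p, q⟩ | ⟨p, q⟩ | ⟨p, q⟩ | ⟨p, q⟩
  · exact h.ring_no_twin R hu ha p q
  · exact h.ring_no_twin R.rot hu hb p q
  · exact h.ring_no_twin R.rot.rot hu hc p q
  · exact h.ring_no_twin R.rot.rot.rot hu hd p q
  · exact h.ring_no_twin R.rot.rot.rot.rot hu he p q

/-- The neighbours of `z` complete to the cycle `a b c d e`. -/
def core (G : SimpleGraph V) (z a b c d e : V) : Set V :=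
  {u | G.Adj z u ∧ G.Adj u a ∧ G.Adj u b ∧ G.Adj u c ∧ G.Adj u d ∧ G.Adj u e}

lemma core_rot {z a b c d e u : V} (hu : u ∈ core G z a b c d e) : u ∈ core G z b c d e a :=
  ⟨hu.1, hu.2.2.1, hu.2.2.2.1, hu.2.2.2.2.1, hu.2.2.2.2.2, hu.2.1⟩

lemma ring_cases (h : Crit G n) [Finite V] {z a b c d e u : V} (R : Ring G z a b c d e)
    (hu : G.Adj z u) : u ∈ core G z a b c d e ∨ u ∈ band G z a b c d e ∨ u ∈ band G z b c d e a ∨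
      u ∈ band G z c d e a b ∨ u ∈ band G z d e a b c ∨ u ∈ band G z e a b c d := by
  have k1 := h.ring_cover R hu
  have k2 := h.ring_cover R.rot hu
  have k3 := h.ring_cover R.rot.rot hu
  have k4 := h.ring_cover R.rot.rot.rot hu
  have k5 := h.ring_cover R.rot.rot.rot.rot hu
  have o1 := h.ring_opp u R
  have o2 := h.ring_opp u R.rot
  have o3 := h.ring_opp u R.rot.rot
  have o4 := h.ring_opp u R.rot.rot.rot
  have o5 := h.ring_opp u R.rot.rot.rot.rot
  simp only [core, band, Set.mem_ofPred_eq, hu, true_and]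
  grind

lemma band_not_adj (h : Crit G n) [Finite V] {z u w x : V} (hx : x ∈ non G z)
    (hu : G.Adj z u) (hw : G.Adj z w) (hux : ¬ G.Adj u x) (hwx : ¬ G.Adj w x) : ¬ G.Adj u w := by
  intro huw
  exact h.no_triangle_in_non (v := x) ⟨hx.1.symm, fun e => hx.2 e.symm⟩
    ⟨by rintro rfl; exact hx.2 hu, fun e => hux e.symm⟩
    ⟨by rintro rfl; exact hx.2 hw, fun e => hwx e.symm⟩ hu hw huw

lemma band_stable (h : Crit G n) [Finite V] {z a b c d e : V} (R : Ring G z a b c d e) :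
    Stb G (band G z a b c d e) := fun _ hu _ hw =>
  h.band_not_adj R.zc hu.1 hw.1 hu.2.2.2.2.1 hw.2.2.2.2.1

lemma band_anti (h : Crit G n) [Finite V] {z a b c d e u w : V} (R : Ring G z a b c d e)
    (hu : u ∈ band G z a b c d e) (hw : w ∈ band G z c d e a b) : ¬ G.Adj u w :=
  h.band_not_adj R.ze hu.1 hw.1 hu.2.2.2.2.2 hw.2.2.2.2.1

lemma band_adj (h : Crit G n) [Finite V] {z a b c d e u w : V} (R : Ring G z a b c d e)
    (hu : u ∈ band G z a b c d e) (hw : w ∈ band G z b c d e a) : G.Adj u w := by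
  by_contra huw
  exact h.no_two_K2 hu.2.1 hw.2.2.1 huw hu.2.2.2.2.1 (fun e => hw.2.2.2.2.2 e.symm) R.ac

lemma band_nonempty (h : Crit G n) [Finite V] {z a b c d e : V} (R : Ring G z a b c d e) :
    ∃ u, u ∈ band G z c d e a b := by
  by_contra! hno
  refine h.not_three_stable R.ab
    (X := {u | u ∈ band G z b c d e a ∨ u ∈ band G z e a b c d ∨ u = d})
    (Y := {u | u ∈ band G z d e a b c ∨ u = a ∨ u = c}) (Z := {u | u = z ∨ u = e ∨ u = b})
    ?_ ?_ ?_ ?_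
  · have k1 := h.band_stable R.rot
    have k2 := h.band_stable R.rot.rot.rot.rot
    have k3 : ∀ u ∈ band G z e a b c d, ∀ w ∈ band G z b c d e a, ¬ G.Adj u w := fun u hu w hw =>
      h.band_anti R.rot.rot.rot.rot hu hw
    rintro u (hu | hu | rfl) w (hw | hw | rfl) huw
    · exact k1 u hu w hw huw
    · exact k3 w hw u hu huw.symm
    · exact hu.2.2.2.2.1 huw
    · exact k3 u hu w hw huw
    · exact k2 u hu w hw huw
    · exact hu.2.2.2.2.2 huw
    · exact hw.2.2.2.2.1 huw.symm
    · exact hw.2.2.2.2.2 huw.symm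
    · exact huw.ne rfl
  · have k1 := h.band_stable R.rot.rot.rot
    rintro u (hu | rfl | rfl) w (hw | rfl | rfl) huw
    · exact k1 u hu w hw huw
    · exact hu.2.2.2.2.1 huw
    · exact hu.2.2.2.2.2 huw
    · exact hw.2.2.2.2.1 huw.symm
    · exact huw.ne rfl
    · exact R.ac huw
    · exact hw.2.2.2.2.2 huw.symm
    · exact R.ac huw.symm
    · exact huw.ne rfl
  · rintro u (rfl | rfl | rfl) w (rfl | rfl | rfl) huw
    · exact huw.ne rfl
    · exact R.ze.2 huw
    · exact R.zb.2 huw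
    · exact R.ze.2 huw.symm
    · exact huw.ne rfl
    · exact R.eb huw
    · exact R.zb.2 huw.symm
    · exact R.eb huw.symm
    · exact huw.ne rfl
  · intro w hw
    by_cases hzw : G.Adj z w
    · rcases h.ring_cases R hzw with e | e | e | e | e | e
      · exact (hw ⟨e.2.1.symm, e.2.2.1.symm⟩).elim
      · exact (hw ⟨e.2.1.symm, e.2.2.1.symm⟩).elim
      · exact Or.inl (Or.inl (Or.inl e))
      · exact (hno w e).elim
      · exact Or.inl (Or.inr (Or.inl e))
      · exact Or.inl (Or.inl (Or.inr (Or.inl e)))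
    · by_cases hwz : w = z
      · exact Or.inr (Or.inl hwz)
      · rcases h.ring_eq R ⟨hwz, hzw⟩ with e | e | e | e | e
        · exact Or.inl (Or.inr (Or.inr (Or.inl e)))
        · exact Or.inr (Or.inr (Or.inr e))
        · exact Or.inl (Or.inr (Or.inr (Or.inr e)))
        · exact Or.inl (Or.inl (Or.inr (Or.inr e)))
        · exact Or.inr (Or.inr (Or.inl e))

lemma core_anti_step (h : Crit G n) [Finite V] {z a b c d e u w : V} (R : Ring G z a b c d e)
    (hu : u ∈ core G z a b c d e) (hw : w ∈ band G z a b c d e) (huw : ¬ G.Adj u w) :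
    ∀ x ∈ band G z c d e a b, ¬ G.Adj u x := by
  intro x hx hux
  exact h.no_triangle_in_non (v := w) ⟨by rintro rfl; exact R.zc.2 hw.1,
    fun e => hw.2.2.2.2.1 e⟩ ⟨by rintro rfl; exact hw.2.2.2.2.1 hu.2.2.2.1, fun e => huw e.symm⟩
    ⟨by rintro rfl; exact huw hux, fun e => h.band_anti R hw hx e⟩
    hu.2.2.2.1.symm hx.2.1.symm hux

lemma core_anti (h : Crit G n) [Finite V] {z a b c d e u w : V} (R : Ring G z a b c d e)
    (hu : u ∈ core G z a b c d e) (hw : w ∈ band G z a b c d e) (huw : ¬ G.Adj u w) :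
    (∀ x ∈ band G z a b c d e, ¬ G.Adj u x) ∧ (∀ x ∈ band G z b c d e a, ¬ G.Adj u x) ∧
    (∀ x ∈ band G z c d e a b, ¬ G.Adj u x) ∧ (∀ x ∈ band G z d e a b c, ¬ G.Adj u x) ∧
    ∀ x ∈ band G z e a b c d, ¬ G.Adj u x := by
  have h3 := h.core_anti_step R hu hw huw
  obtain ⟨y, hy⟩ := h.band_nonempty R
  have hu3 := core_rot (core_rot hu)
  have h5 := h.core_anti_step R.rot.rot hu3 hy (h3 y hy)
  obtain ⟨y, hy⟩ := h.band_nonempty R.rot.rot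
  have hu5 := core_rot (core_rot hu3)
  have h2 := h.core_anti_step R.rot.rot.rot.rot hu5 hy (h5 y hy)
  obtain ⟨y, hy⟩ := h.band_nonempty R.rot.rot.rot.rot
  have h4 := h.core_anti_step R.rot (core_rot hu) hy (h2 y hy)
  obtain ⟨y, hy⟩ := h.band_nonempty R.rot
  have h1 := h.core_anti_step R.rot.rot.rot (core_rot hu3) hy (h4 y hy)
  exact ⟨h1, h2, h3, h4, h5⟩

/-- The nonneighbourhood of a vertex contains no induced 5-cycle. -/
lemma no_ring (h : Crit G n) [Finite V] {z a b c d e : V} (R : Ring G z a b c d e) : False := by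
  let B : Set V := {u | u ∈ band G z a b c d e ∨ u ∈ band G z b c d e a ∨ u ∈ band G z c d e a b ∨
    u ∈ band G z d e a b c ∨ u ∈ band G z e a b c d}
  have hanti : ∀ u ∈ core G z a b c d e, ∀ w ∈ B, ¬ G.Adj u w → ∀ x ∈ B, ¬ G.Adj u x := by
    intro u hu w hw huw x hx
    have hu2 := core_rot hu
    have hu3 := core_rot hu2
    have hu4 := core_rot hu3
    have hu5 := core_rot hu4
    rcases hw with hw | hw | hw | hw | hw
    · obtain ⟨g1, g2, g3, g4, g5⟩ := h.core_anti R hu hw huw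
      rcases hx with e | e | e | e | e
      exacts [g1 x e, g2 x e, g3 x e, g4 x e, g5 x e]
    · obtain ⟨g2, g3, g4, g5, g1⟩ := h.core_anti R.rot hu2 hw huw
      rcases hx with e | e | e | e | e
      exacts [g1 x e, g2 x e, g3 x e, g4 x e, g5 x e]
    · obtain ⟨g3, g4, g5, g1, g2⟩ := h.core_anti R.rot.rot hu3 hw huw
      rcases hx with e | e | e | e | e
      exacts [g1 x e, g2 x e, g3 x e, g4 x e, g5 x e]
    · obtain ⟨g4, g5, g1, g2, g3⟩ := h.core_anti R.rot.rot.rot hu4 hw huw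
      rcases hx with e | e | e | e | e
      exacts [g1 x e, g2 x e, g3 x e, g4 x e, g5 x e]
    · obtain ⟨g5, g1, g2, g3, g4⟩ := h.core_anti R.rot.rot.rot.rot hu5 hw huw
      rcases hx with e | e | e | e | e
      exacts [g1 x e, g2 x e, g3 x e, g4 x e, g5 x e]
  obtain ⟨b₁, hb₁⟩ := h.band_nonempty R.rot.rot.rot
  obtain ⟨b₂, hb₂⟩ := h.band_nonempty R.rot.rot.rot.rot
  have hb₁B : b₁ ∈ B := Or.inl hb₁
  have hb₂B : b₂ ∈ B := Or.inr (Or.inl hb₂)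
  have hb₁₂ : G.Adj b₁ b₂ := h.band_adj R hb₁ hb₂
  have hcases : ∀ u, u = z ∨ u ∈ core G z a b c d e ∨ u ∈ B ∨ u = a ∨ u = b ∨ u = c ∨ u = d ∨
      u = e := by
    intro u
    by_cases hzu : G.Adj z u
    · rcases h.ring_cases R hzu with e | e
      · exact Or.inr (Or.inl e)
      · exact Or.inr (Or.inr (Or.inl e))
    · by_cases huz : u = z
      · exact Or.inl huz
      · exact Or.inr (Or.inr (Or.inr (h.ring_eq R ⟨huz, hzu⟩)))
  have hD : ∀ u ∈ core G z a b c d e, ¬ G.Adj u b₁ := by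
    intro d₁ hd₁ hd₁b₁
    have hfull : ∀ u ∈ core G z a b c d e, G.Adj u b₁ → ∀ w ∈ B, G.Adj u w := by
      intro u hu hub w hw
      by_contra huw
      exact hanti u hu w hw huw b₁ hb₁B hub
    refine h.not_join {u | u ∈ core G z a b c d e ∧ G.Adj u b₁} (a := d₁) (b := z) ⟨hd₁, hd₁b₁⟩
      (fun e => e.1.1.ne rfl) ?_
    rintro u ⟨hu, hub⟩ w hw
    rcases hcases w with rfl | hw' | hw' | rfl | rfl | rfl | rfl | rfl
    · exact hu.1.symm
    · by_contra huw
      have hwb₁ : ¬ G.Adj w b₁ := fun e => hw ⟨hw', e⟩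
      have hwb₂ : ¬ G.Adj w b₂ := hanti w hw' b₁ hb₁B hwb₁ b₂ hb₂B
      exact h.no_triangle_in_non (v := w) ⟨by rintro rfl; exact hw ⟨hu, hub⟩, fun e => huw e.symm⟩
        ⟨by rintro rfl; exact huw hub, hwb₁⟩
        ⟨by rintro rfl; exact hwb₁ hb₁₂.symm, hwb₂⟩ hub (hfull u hu hub b₂ hb₂B) hb₁₂
    · exact hfull u hu hub w hw'
    · exact hu.2.1
    · exact hu.2.2.1
    · exact hu.2.2.2.1
    · exact hu.2.2.2.2.1
    · exact hu.2.2.2.2.2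
  have hDB : ∀ u ∈ core G z a b c d e, ∀ w ∈ B, ¬ G.Adj u w := fun u hu w hw =>
    hanti u hu b₁ hb₁B (hD u hu) w hw
  have hDD : Stb G (core G z a b c d e) := fun u hu w hw huw =>
    h.no_two_K2 huw hb₁₂ (hDB u hu b₁ hb₁B) (hDB u hu b₂ hb₂B) (hDB w hw b₁ hb₁B)
      (hDB w hw b₂ hb₂B)
  have c1 : ColOn G {u | u = z ∨ u = a ∨ u = c} 1 := by
    refine colOn_one ?_
    rintro u (rfl | rfl | rfl) w (rfl | rfl | rfl) huw
    · exact huw.ne rfl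
    · exact R.za.2 huw
    · exact R.zc.2 huw
    · exact R.za.2 huw.symm
    · exact huw.ne rfl
    · exact R.ac huw
    · exact R.zc.2 huw.symm
    · exact R.ac huw.symm
    · exact huw.ne rfl
  have c2 : ColOn G {u | u ∈ band G z c d e a b ∨ u = e ∨ u = b} 1 := by
    refine colOn_one ?_
    have k1 := h.band_stable R.rot.rot
    rintro u (hu | rfl | rfl) w (hw | rfl | rfl) huw
    · exact k1 u hu w hw huw
    · exact hu.2.2.2.2.1 huw
    · exact hu.2.2.2.2.2 huw
    · exact hw.2.2.2.2.1 huw.symm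
    · exact huw.ne rfl
    · exact R.eb huw
    · exact hw.2.2.2.2.2 huw.symm
    · exact R.eb huw.symm
    · exact huw.ne rfl
  have c3 : ColOn G {u | u ∈ band G z b c d e a ∨ u ∈ band G z e a b c d ∨ u = d} 1 := by
    refine colOn_one ?_
    have k1 := h.band_stable R.rot
    have k2 := h.band_stable R.rot.rot.rot.rot
    have k3 : ∀ u ∈ band G z e a b c d, ∀ w ∈ band G z b c d e a, ¬ G.Adj u w := fun u hu w hw =>
      h.band_anti R.rot.rot.rot.rot hu hw
    rintro u (hu | hu | rfl) w (hw | hw | rfl) huw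
    · exact k1 u hu w hw huw
    · exact k3 w hw u hu huw.symm
    · exact hu.2.2.2.2.1 huw
    · exact k3 u hu w hw huw
    · exact k2 u hu w hw huw
    · exact hu.2.2.2.2.2 huw
    · exact hw.2.2.2.2.1 huw.symm
    · exact hw.2.2.2.2.2 huw.symm
    · exact huw.ne rfl
  have c4 : ColOn G {u | u ∈ core G z a b c d e ∨ u ∈ band G z a b c d e ∨
      u ∈ band G z d e a b c} 1 := by
    refine colOn_one ?_
    have k1 := h.band_stable R
    have k2 := h.band_stable R.rot.rot.rot
    have k3 : ∀ u ∈ band G z d e a b c, ∀ w ∈ band G z a b c d e, ¬ G.Adj u w := fun u hu w hw =>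
      h.band_anti R.rot.rot.rot hu hw
    have k4 : ∀ u ∈ band G z a b c d e, u ∈ B := fun u hu => Or.inl hu
    have k5 : ∀ u ∈ band G z d e a b c, u ∈ B := fun u hu => Or.inr (Or.inr (Or.inr (Or.inl hu)))
    rintro u (hu | hu | hu) w (hw | hw | hw) huw
    · exact hDD u hu w hw huw
    · exact hDB u hu w (k4 w hw) huw
    · exact hDB u hu w (k5 w hw) huw
    · exact hDB w hw u (k4 u hu) huw.symm
    · exact k1 u hu w hw huw
    · exact k3 w hw u hu huw.symm
    · exact hDB w hw u (k5 u hu) huw.symm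
    · exact k3 u hu w hw huw
    · exact k2 u hu w hw huw
  have hn := h.three_le
  refine h.notCol (((c1.union c2).union (c3.union c4)).mono (fun u _ => ?_) (by omega))
  simp only [Set.mem_union, Set.mem_ofPred_eq]
  rcases hcases u with e | e | (e | e | e | e | e) | e | e | e | e | e <;> grind

end Crit
/-- `x` and `y` lie on the same side of the bipartite graph formed by the nonneighbours of `v`. -/
def Same (G : SimpleGraph V) (v x y : V) : Prop :=
  x ∈ non G v ∧ y ∈ non G v ∧ ∃ w ∈ non G v, G.Adj w x ∧ G.Adj w y

lemma Same.symm {v x y : V} (h : Same G v x y) : Same G v y x :=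
  ⟨h.2.1, h.1, h.2.2.imp fun _ e => ⟨e.1, e.2.2, e.2.1⟩⟩

lemma mem_non_comm {x y : V} : x ∈ non G y ↔ y ∈ non G x :=
  ⟨fun e => ⟨e.1.symm, fun e' => e.2 e'.symm⟩, fun e => ⟨e.1.symm, fun e' => e.2 e'.symm⟩⟩

lemma ne_left_of_not_adj {a b c : V} (hac : G.Adj a c) (hbc : ¬ G.Adj b c) : a ≠ b := by
  rintro rfl; exact hbc hac

namespace Crit

variable {n : ℕ}

lemma exists_sides_same (h : Crit G n) [Finite V] (v : V) :
    ∃ X Y : Set V, ∃ x₀ ∈ X, ∃ y₀ ∈ Y, Stb G X ∧ Stb G Y ∧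
      (∀ w, w ∈ non G v ↔ w ∈ X ∨ w ∈ Y) ∧ (∀ y ∈ Y, G.Adj x₀ y) ∧ (∀ x ∈ X, G.Adj y₀ x) ∧
      ∀ x y, Same G v x y ↔ x ∈ X ∧ y ∈ X ∨ x ∈ Y ∧ y ∈ Y := by
  obtain ⟨X, Y, x₀, hx₀, y₀, hy₀, hX, hY, hXY, hd, h1, h2⟩ := h.exists_sides v
    fun a ha b hb c hc d hd e he hab hbc hcd hde hea hac hbd hce hda heb =>
      h.no_ring ⟨hab, hbc, hcd, hde, hea, hac, hbd, hce, hda, heb, ha, hb, hc, hd, he⟩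
  refine ⟨X, Y, x₀, hx₀, y₀, hy₀, hX, hY, hXY, h1, h2, fun x y => ⟨?_, ?_⟩⟩
  · rintro ⟨hx, hy, w, hw, hwx, hwy⟩
    rcases (hXY w).1 hw with hw | hw
    · exact Or.inr ⟨((hXY x).1 hx).resolve_left fun e => hX w hw x e hwx,
        ((hXY y).1 hy).resolve_left fun e => hX w hw y e hwy⟩
    · exact Or.inl ⟨((hXY x).1 hx).resolve_right fun e => hY w hw x e hwx,
        ((hXY y).1 hy).resolve_right fun e => hY w hw y e hwy⟩
  · rintro (⟨hx, hy⟩ | ⟨hx, hy⟩)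
    · exact ⟨(hXY x).2 (Or.inl hx), (hXY y).2 (Or.inl hy), y₀, (hXY _).2 (Or.inr hy₀), h2 x hx,
        h2 y hy⟩
    · exact ⟨(hXY x).2 (Or.inr hx), (hXY y).2 (Or.inr hy), x₀, (hXY _).2 (Or.inl hx₀), h1 x hx,
        h1 y hy⟩

lemma same_refl (h : Crit G n) {v x : V} (hx : x ∈ non G v) : Same G v x x := by
  obtain ⟨w, hw, hxw⟩ := h.exists_adj_of_mem_non hx
  exact ⟨hx, hx, w, hw, hxw.symm, hxw.symm⟩

lemma not_adj_of_same (h : Crit G n) [Finite V] {v x y : V} (hxy : Same G v x y) :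
    ¬ G.Adj x y := fun e => by
  obtain ⟨hx, hy, w, hw, hwx, hwy⟩ := hxy
  exact h.no_triangle_in_non hw hx hy hwx hwy e

lemma same_trans (h : Crit G n) [Finite V] {v x y z : V} (hxy : Same G v x y)
    (hyz : Same G v y z) : Same G v x z := by
  obtain ⟨X, Y, x₀, hx₀, y₀, hy₀, hX, hY, hXY, h1, h2, hs⟩ := h.exists_sides_same v
  have hd : ∀ w ∈ X, w ∉ Y := fun w hw hw' => hX x₀ hx₀ w hw (h1 w hw')
  rw [hs] at *
  grind

lemma same_of_not (h : Crit G n) [Finite V] {v x y z : V} (hx : x ∈ non G v) (hy : y ∈ non G v)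
    (hz : z ∈ non G v) (hxy : ¬ Same G v x y) (hxz : ¬ Same G v x z) : Same G v y z := by
  obtain ⟨X, Y, x₀, hx₀, y₀, hy₀, hX, hY, hXY, h1, h2, hs⟩ := h.exists_sides_same v
  rw [hs] at *
  rw [hXY] at hx hy hz
  grind

/-- Each side contains a vertex complete to the opposite side. -/
lemma exists_rep (h : Crit G n) [Finite V] {v x : V} (hx : x ∈ non G v) :
    ∃ r, Same G v x r ∧ ∀ y ∈ non G v, ¬ Same G v x y → G.Adj r y := by
  obtain ⟨X, Y, x₀, hx₀, y₀, hy₀, hX, hY, hXY, h1, h2, hs⟩ := h.exists_sides_same v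
  rcases (hXY x).1 hx with e | e
  · refine ⟨x₀, (hs _ _).2 (Or.inl ⟨e, hx₀⟩), fun y hy hxy => h1 y ?_⟩
    exact ((hXY y).1 hy).resolve_left fun e' => hxy ((hs _ _).2 (Or.inl ⟨e, e'⟩))
  · refine ⟨y₀, (hs _ _).2 (Or.inr ⟨e, hy₀⟩), fun y hy hxy => h2 y ?_⟩
    exact ((hXY y).1 hy).resolve_right fun e' => hxy ((hs _ _).2 (Or.inr ⟨e, e'⟩))

lemma exists_not_same (h : Crit G n) [Finite V] {v x : V} (hx : x ∈ non G v) :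
    ∃ y ∈ non G v, ¬ Same G v x y := by
  obtain ⟨w, hw, hxw⟩ := h.exists_adj_of_mem_non hx
  exact ⟨w, hw, fun e => h.not_adj_of_same e hxw⟩

section Lines

variable [Finite V] {y v w : V}

/-- The hub representative of the side of `v` sees everything opposite to `v`. -/
lemma exists_hub_rep (h : Crit G n) (hv : v ∈ non G y) (hw : w ∈ non G y) (hvw : v ∈ non G w)
    (h1 : ¬ Same G y v w) :
    ∃ l, Same G y v l ∧ l ∈ non G v ∧ ∀ x ∈ non G y, ¬ Same G y v x → G.Adj l x := by
  obtain ⟨l, hl, hl'⟩ := h.exists_rep hv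
  exact ⟨l, hl, ⟨ne_left_of_not_adj (hl' w hw h1) fun e => hvw.2 e.symm,
    h.not_adj_of_same hl⟩, hl'⟩

/-- In an inconsistent triangle, the third vertex can be chosen to see the opposite side. -/
lemma exists_bad_rep (h : Crit G n) (hv : v ∈ non G y) (hw : w ∈ non G y) (hvw : v ∈ non G w)
    (h1 : ¬ Same G y v w) (h2 : Same G v y w) :
    ∃ r, r ∈ non G y ∧ v ∈ non G r ∧ ¬ Same G y v r ∧ Same G v y r ∧
      ∀ x ∈ non G v, ¬ Same G v y x → G.Adj r x := by
  obtain ⟨l, hl, hlv, hl'⟩ := h.exists_hub_rep hv hw hvw h1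
  have hyl : ¬ Same G v y l := fun e => by
    exact h.not_adj_of_same (h.same_trans h2.symm e) (hl' w hw h1).symm
  obtain ⟨r, hr, hr'⟩ := h.exists_rep (mem_non_comm.1 hv)
  have hrl := hr' l hlv hyl
  refine ⟨r, ⟨ne_left_of_not_adj hrl hl.2.1.2, h.not_adj_of_same hr⟩, mem_non_comm.1 hr.2.1,
    fun e => h.not_adj_of_same (h.same_trans hl.symm e) hrl.symm, hr, hr'⟩

/-- Inconsistency passes to a vertex of the same hub side with more opposite nonneighbours. -/
lemma bad_of_le (h : Crit G n) (hv : v ∈ non G y) (hw : w ∈ non G y) (hvw : v ∈ non G w)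
    (h1 : ¬ Same G y v w) (h2 : Same G v y w) {v' : V} (hv' : Same G y v v')
    (hle : ∀ t ∈ non G y, ¬ Same G y v t → t ∈ non G v → t ∈ non G v') :
    ∃ r, r ∈ non G y ∧ v' ∈ non G r ∧ ¬ Same G y v' r ∧ Same G v' y r := by
  obtain ⟨r, hry, hvr, hr1, hr2, hr3⟩ := h.exists_bad_rep hv hw hvw h1 h2
  have hrv' := hle r hry hr1 (mem_non_comm.1 hvr)
  have hr1' : ¬ Same G y v' r := fun e => hr1 (h.same_trans hv' e)
  refine ⟨r, hry, mem_non_comm.1 hrv', hr1', ?_⟩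
  by_contra hc
  obtain ⟨f, hf, hf'⟩ := h.exists_rep hrv'
  have hyv' : y ∈ non G v' := mem_non_comm.1 hv'.2.1
  have hfy : G.Adj f y := hf' y hyv' fun e => hc e.symm
  have hfv : G.Adj f v := by
    by_contra hfv
    have hfn : f ∈ non G v :=
      ⟨ne_left_of_not_adj hfy fun e => hv.2 e.symm, fun e => hfv e.symm⟩
    exact h.not_adj_of_same hf (hr3 f hfn fun e => h.not_adj_of_same e hfy.symm)
  obtain ⟨s, hs, hs'⟩ := h.exists_rep hry
  have hsv : G.Adj s v := hs' v hv fun e => hr1 e.symm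
  have hsv' : G.Adj s v' := hs' v' hv'.2.1 fun e => hr1' e.symm
  have hsf : Same G r s f := by
    refine ⟨⟨ne_left_of_not_adj hsv hvr.2, h.not_adj_of_same hs⟩,
      ⟨ne_left_of_not_adj hfy fun e => hry.2 e.symm, h.not_adj_of_same hf⟩, v, hvr, hsv.symm,
      hfv.symm⟩
  exact h.no_two_K2 hfy hsv' (fun e => h.not_adj_of_same hsf e.symm)
    (fun e => hf.2.1.2 e.symm) hs.2.1.2 hv'.2.1.2

/-- The case of a maximal vertex in the proof that lines are consistent. -/
lemma bad_max_false (h : Crit G n) (hv : v ∈ non G y) (hw : w ∈ non G y) (hvw : v ∈ non G w)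
    (h1 : ¬ Same G y v w) (h2 : Same G v y w) (hw' : ∀ x ∈ non G v, ¬ Same G v y x → G.Adj w x)
    (hmax : ∀ x, Same G y v x → ∀ t ∈ non G y, ¬ Same G y v t → t ∈ non G x → t ∈ non G v) :
    False := by
  obtain ⟨l, hl, hlv, hl'⟩ := h.exists_hub_rep hv hw hvw h1
  obtain ⟨u, hu, hu'⟩ := h.exists_rep hw
  have hyv := mem_non_comm.1 hv
  have hyw := mem_non_comm.1 hw
  have huL : ∀ x, Same G y v x → G.Adj u x := fun x hx =>
    hu' x hx.2.1 fun e => h1 (h.same_trans hx e.symm)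
  have huv : G.Adj u v := huL v (h.same_refl hv)
  have huw : u ∈ non G w := ⟨ne_left_of_not_adj huv hvw.2, h.not_adj_of_same hu⟩
  have hyu := mem_non_comm.1 hu.2.1
  have hside : ∀ x ∈ non G y, ¬ Same G y w x → Same G y v x := fun x hx e =>
    h.same_of_not hw hv hx (fun e' => h1 e'.symm) e
  have key : ∀ t, Same G u y t → Same G v y t := by
    intro t ht
    by_cases hty : t = y
    · rw [hty]; exact h.same_refl hyv
    have hty : t ∈ non G y := ⟨hty, h.not_adj_of_same ht⟩
    have htR : ¬ Same G y v t := fun e => ht.2.1.2 (huL t e)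
    by_cases htv : t ∈ non G v
    · have e1 : ¬ Same G v l t := fun e => h.not_adj_of_same e (hl' t hty htR)
      have e2 : ¬ Same G v l y := fun e =>
        h.not_adj_of_same (h.same_trans e h2) (hl' w hw h1)
      exact h.same_of_not hlv hyv htv e2 e1
    exfalso
    have hne : ∀ x, Same G y v x → t ≠ x := by rintro x hx rfl; exact htR hx
    have htL : ∀ x, Same G y v x → G.Adj t x := by
      intro x hx
      by_contra e
      exact htv (hmax x hx t hty htR ⟨hne x hx, fun e' => e e'.symm⟩)
    have htv' : G.Adj t v := htL v (h.same_refl hv)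
    have htw : t ∈ non G w := ⟨ne_left_of_not_adj htv' hvw.2,
      h.not_adj_of_same (h.same_of_not hv hw hty h1 htR)⟩
    have hwu : Same G w u t := ⟨huw, htw, v, hvw, huv.symm, htv'.symm⟩
    have hwuv : ¬ Same G w u v := fun e => h.not_adj_of_same e huv
    have hwv : Same G w v y := by
      by_contra hc
      obtain ⟨m, hm, hm'⟩ := h.exists_rep hvw
      have hmy := hm' y hyw hc
      have hmv : m ∈ non G v :=
        ⟨ne_left_of_not_adj hmy fun e => hv.2 e.symm, h.not_adj_of_same hm⟩
      exact hm.2.1.2 (hw' m hmv fun e => h.not_adj_of_same e hmy.symm)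
    obtain ⟨r, hr, hr'⟩ := h.exists_rep huw
    have hrv := hr' v hvw hwuv
    have hry := hr' y hyw fun e => hwuv (h.same_trans e hwv.symm)
    have hru : r ∈ non G u :=
      ⟨ne_left_of_not_adj hry fun e => hyu.2 e, h.not_adj_of_same hr⟩
    have hrt : r ∈ non G t :=
      ⟨ne_left_of_not_adj hry fun e => hty.2 e.symm,
        h.not_adj_of_same (h.same_trans hwu.symm hr)⟩
    have hury : ¬ Same G u y r := fun e => h.not_adj_of_same e hry.symm
    have hyt := mem_non_comm.1 hty
    have htry : ¬ Same G t y r := fun e => h.not_adj_of_same e hry.symm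
    have hut := mem_non_comm.1 ht.2.1
    have hLof : ∀ e, G.Adj e u ∨ G.Adj e w → e ∈ non G y → Same G y v e := by
      rintro e (he | he) hey
      · exact hside e hey fun e' => h.not_adj_of_same (h.same_trans hu.symm e') he.symm
      · exact hside e hey fun e' => h.not_adj_of_same e' he.symm
    by_cases htu : Same G t u r
    · obtain ⟨e, he, he'⟩ := h.exists_rep hyt
      have heu := he' u hut fun e => htry (h.same_trans e htu)
      have hey : e ∈ non G y := ⟨ne_left_of_not_adj heu fun e => hyu.2 e.symm,
        h.not_adj_of_same he⟩
      exact he.2.1.2 (htL e (hLof e (Or.inl heu) hey))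
    have htyu : Same G t y u :=
      h.same_of_not hrt hyt hut (fun e => htry e.symm) (fun e => htu e.symm)
    obtain ⟨z', hz, hz'⟩ := h.exists_rep hrt
    obtain ⟨z, hx, hx'⟩ := h.exists_rep hru
    have hwu' := mem_non_comm.1 huw
    have hwt' := mem_non_comm.1 htw
    have hSu : Same G u y w := by
      by_contra hc
      obtain ⟨e, he, he'⟩ := h.exists_rep hyu
      have hew := he' w hwu' hc
      have hey : e ∈ non G y := ⟨ne_left_of_not_adj hew hw.2, h.not_adj_of_same he⟩
      exact he.2.1.2 (huL e (hLof e (Or.inr hew) hey))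
    have hSt : Same G t y w := by
      by_contra hc
      obtain ⟨e, he, he'⟩ := h.exists_rep hyt
      have hew := he' w hwt' hc
      have hey : e ∈ non G y := ⟨ne_left_of_not_adj hew hw.2, h.not_adj_of_same he⟩
      exact he.2.1.2 (htL e (hLof e (Or.inr hew) hey))
    have hzu := hz' u hut fun e => htry (h.same_trans htyu e.symm)
    have hzw := hz' w hwt' fun e => htry (h.same_trans hSt e.symm)
    have hxt := hx' t ht.2.1 fun e => hury (h.same_trans ht e.symm)
    have hxw := hx' w hwu' fun e => hury (h.same_trans hSu e.symm)
    have hzx : Same G r z z' :=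
      ⟨⟨ne_left_of_not_adj hxt fun e => hrt.2 e.symm, h.not_adj_of_same hx⟩,
        ⟨ne_left_of_not_adj hzu fun e => hru.2 e.symm, h.not_adj_of_same hz⟩,
        w, mem_non_comm.1 hr.2.1, hxw.symm, hzw.symm⟩
    exact h.no_two_K2 hzu hxt (fun e => h.not_adj_of_same hzx e.symm) (fun e => hz.2.1.2 e.symm)
      hx.2.1.2 ht.2.1.2
  refine h.not_three_stable huv (X := {x | x = v ∨ x ∈ non G v ∧ ¬ Same G v y x})
    (Y := {x | Same G v y x}) (Z := {x | x = u ∨ x ∈ non G u ∧ ¬ Same G u y x}) ?_ ?_ ?_ ?_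
  · rintro a (rfl | ha) b (rfl | hb)
    · exact fun e => e.ne rfl
    · exact hb.1.2
    · exact fun e => ha.1.2 e.symm
    · exact h.not_adj_of_same (h.same_of_not hyv ha.1 hb.1 ha.2 hb.2)
  · exact fun a ha b hb => h.not_adj_of_same (h.same_trans (Same.symm ha) hb)
  · rintro a (rfl | ha) b (rfl | hb)
    · exact fun e => e.ne rfl
    · exact hb.1.2
    · exact fun e => ha.1.2 e.symm
    · exact h.not_adj_of_same (h.same_of_not hyu ha.1 hb.1 ha.2 hb.2)
  · intro x hx
    have e1 : x ∈ non G v ↔ x ≠ v ∧ ¬ G.Adj v x := Iff.rfl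
    have e2 : x ∈ non G u ↔ x ≠ u ∧ ¬ G.Adj u x := Iff.rfl
    have := key x
    simp only [Set.mem_union, Set.mem_ofPred_eq]
    grind

/-- Sides at different vertices are consistent. -/
lemma same_rotate (h : Crit G n) (hvw : Same G y v w) (hne : v ≠ w) : Same G v y w := by
  classical
  have := Fintype.ofFinite V
  have hvw' : v ∈ non G w := ⟨hne, fun e => h.not_adj_of_same hvw e.symm⟩
  by_contra hc
  let N : V → Finset V := fun x => Finset.univ.filter fun t =>
    t ∈ non G v ∧ ¬ Same G v y t ∧ t ∈ non G x
  have hN : ∀ x t, t ∈ N x ↔ t ∈ non G v ∧ ¬ Same G v y t ∧ t ∈ non G x := fun x t => by simp [N]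
  have hyv := mem_non_comm.1 hvw.1
  obtain ⟨m, hm, hmax⟩ := Finset.exists_max_image (Finset.univ.filter fun x => Same G v y x)
    (fun x => (N x).card) ⟨y, by simpa using h.same_refl hyv⟩
  have hm : Same G v y m := by simpa using hm
  have hmax : ∀ x, Same G v y x → N x ⊆ N m := by
    intro x hx
    by_contra hsub
    obtain ⟨s, hs, hs'⟩ := Finset.not_subset.1 hsub
    have hlt : ¬ N m ⊆ N x := fun hsub' => by
      have hss : N m ⊂ N x := ⟨hsub', hsub⟩
      exact (Finset.card_lt_card hss).not_ge (hmax x (by simpa using hx))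
    obtain ⟨t, ht, ht'⟩ := Finset.not_subset.1 hlt
    rw [hN] at hs hs' ht ht'
    have hne : ∀ p q, Same G v y p → ¬ Same G v y q → q ≠ p := by rintro p q hp hq rfl; exact hq hp
    have hms : G.Adj m s := by
      by_contra e; exact hs' ⟨hs.1, hs.2.1, hne m s hm hs.2.1, e⟩
    have hxt : G.Adj x t := by
      by_contra e; exact ht' ⟨ht.1, ht.2.1, hne x t hx ht.2.1, e⟩
    exact h.no_two_K2 hms hxt (h.not_adj_of_same (h.same_trans hm.symm hx)) ht.2.2.2
      (fun e => hs.2.2.2 e.symm) (h.not_adj_of_same (h.same_of_not hyv hs.1 ht.1 hs.2.1 ht.2.1))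
  have hwv : w ∈ non G v := mem_non_comm.1 hvw'
  obtain ⟨r, hr1, hr2, hr3, hr4⟩ := h.bad_of_le hyv hwv (mem_non_comm.1 hvw.2.1) hc hvw hm
    fun t ht1 ht2 ht3 => ((hN m t).1 (hmax y (h.same_refl hyv) ((hN y t).2 ⟨ht1, ht2, ht3⟩))).2.2
  obtain ⟨s, hs1, hs2, hs3, hs4, hs5⟩ := h.exists_bad_rep hm.2.1 hr1 hr2 hr3 hr4
  refine h.bad_max_false hm.2.1 hs1 hs2 hs3 hs4 hs5 fun x hx t ht1 ht2 ht3 => ?_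
  exact ((hN m t).1 (hmax x (h.same_trans hm hx)
    ((hN x t).2 ⟨ht1, fun e => ht2 (h.same_trans hm.symm e), ht3⟩))).2.2

end Lines
end Crit
/-- `G` is the complement of the line graph of a simple graph on `E`, where `ends v` is the set of
the two endpoints of the edge `v`. -/
structure CoLine (G : SimpleGraph V) {E : Type*} [DecidableEq E] (ends : V → Finset E) : Prop where
  card : ∀ v, (ends v).card = 2
  adj : ∀ u v, u ≠ v → (G.Adj u v ↔ Disjoint (ends u) (ends v))
  inj : Function.Injective ends
  surj : ∀ e, ∃ v, e ∈ ends v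

namespace CoLine

variable {n : ℕ} {E : Type*} [DecidableEq E] {ends : V → Finset E}

lemma stb (g : CoLine G ends) (e : E) : Stb G {v | e ∈ ends v} := fun u hu v hv huv =>
  Finset.disjoint_left.1 ((g.adj u v huv.ne).1 huv) hu hv

lemma card_biUnion (g : CoLine G ends) {t : Finset V}
    (ht : ∀ x ∈ t, ∀ y ∈ t, x ≠ y → G.Adj x y) : (t.biUnion ends).card = 2 * t.card := by
  rw [Finset.card_biUnion fun x hx y hy hxy => (g.adj x y hxy).1 (ht x hx y hy hxy),
    Finset.sum_const_nat fun x _ => g.card x, mul_comm]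

lemma ends_eq (g : CoLine G ends) {v : V} {e f : E} (he : e ∈ ends v) (hf : f ∈ ends v)
    (hne : e ≠ f) : ends v = {e, f} := by
  symm
  refine Finset.eq_of_subset_of_card_le ?_ ?_
  · intro x hx
    rcases Finset.mem_insert.1 hx with rfl | hx
    · exact he
    · rwa [Finset.mem_singleton.1 hx]
  · rw [g.card, Finset.card_pair hne]

/-- Some clique on `n` vertices misses both `e` and `f`. -/
def Missed (G : SimpleGraph V) (ends : V → Finset E) (n : ℕ) (e f : E) : Prop :=
  ∃ t : Finset V, (∀ x ∈ t, ∀ y ∈ t, x ≠ y → G.Adj x y) ∧ t.card = n ∧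
    e ∉ t.biUnion ends ∧ f ∉ t.biUnion ends

lemma missed_self (g : CoLine G ends) (h : Crit G n) (e : E) : Missed G ends n e e := by
  obtain ⟨t, ht1, ht2, ht3⟩ := h.exists_clique_disjoint (g.stb e)
  have : e ∉ t.biUnion ends := fun he => by
    obtain ⟨x, hx, hxe⟩ := Finset.mem_biUnion.1 he
    exact ht1 x hx hxe
  exact ⟨t, ht2, ht3, this, this⟩

/-- A clique missing both endpoints of a vertex can be enlarged. -/
lemma adj_of_not_mem (g : CoLine G ends) {t : Finset V} {v : V}
    (hv : ∀ e ∈ ends v, e ∉ t.biUnion ends) : ∀ x ∈ t, v ≠ x ∧ G.Adj v x := by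
  intro x hx
  have hd : Disjoint (ends v) (ends x) := Finset.disjoint_left.2 fun e he hex =>
    hv e he (Finset.mem_biUnion.2 ⟨x, hx, hex⟩)
  have hne : v ≠ x := by
    rintro rfl
    have h1 := g.card v
    rw [disjoint_self.1 hd] at h1
    simp at h1
  exact ⟨hne, (g.adj v x hne).2 hd⟩

lemma clique_insert [DecidableEq V] {t : Finset V} {v : V}
    (ht : ∀ x ∈ t, ∀ y ∈ t, x ≠ y → G.Adj x y) (hv : ∀ x ∈ t, v ≠ x ∧ G.Adj v x) :
    (∀ x ∈ insert v t, ∀ y ∈ insert v t, x ≠ y → G.Adj x y) ∧ v ∉ t := by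
  refine ⟨?_, fun e => (hv v e).1 rfl⟩
  intro x hx y hy hxy
  rcases Finset.mem_insert.1 hx with hx' | hx' <;> rcases Finset.mem_insert.1 hy with hy' | hy'
  · exact (hxy (hx'.trans hy'.symm)).elim
  · exact hx' ▸ (hv y hy').2
  · exact hy' ▸ (hv x hx').2.symm
  · exact ht x hx' y hy' hxy

lemma exists_mem_biUnion (g : CoLine G ends) (h : Crit G n) {t : Finset V}
    (ht : ∀ x ∈ t, ∀ y ∈ t, x ≠ y → G.Adj x y) (htn : t.card = n) (v : V) :
    ∃ e ∈ ends v, e ∈ t.biUnion ends := by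
  classical
  by_contra! hc
  obtain ⟨h1, h2⟩ := clique_insert ht (g.adj_of_not_mem hc)
  have := h.clq _ (fun _ _ => trivial) h1
  rw [Finset.card_insert_of_notMem h2] at this
  omega

lemma not_missed_of_mem (g : CoLine G ends) (h : Crit G n) {v : V} {e f : E} (he : e ∈ ends v)
    (hf : f ∈ ends v) (hne : e ≠ f) : ¬ Missed G ends n e f := by
  rintro ⟨t, ht, htn, h1, h2⟩
  obtain ⟨z, hz, hz'⟩ := g.exists_mem_biUnion h ht htn v
  rw [g.ends_eq he hf hne] at hz
  simp only [Finset.mem_insert, Finset.mem_singleton] at hz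
  rcases hz with rfl | rfl
  · exact h1 hz'
  · exact h2 hz'

lemma not_missed_trans [Finite V] (g : CoLine G ends) (h : Crit G n) {u t w : E} (huw : u ≠ w)
    (hut : ¬ Missed G ends n u t) (htw : ¬ Missed G ends n t w) : ¬ Missed G ends n u w := by
  classical
  have := Fintype.ofFinite V
  rintro ⟨K, hK, hKn, hKu, hKw⟩
  obtain ⟨N₀, hN₀, hN₀n, hN₀t, -⟩ := g.missed_self h t
  obtain ⟨N, hN, hmax⟩ := Finset.exists_max_image
    (Finset.univ.filter fun N : Finset V => (∀ x ∈ N, ∀ y ∈ N, x ≠ y → G.Adj x y) ∧ N.card = n ∧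
      t ∉ N.biUnion ends) (fun N => (K ∩ N).card)
    ⟨N₀, Finset.mem_filter.2 ⟨Finset.mem_univ _, hN₀, hN₀n, hN₀t⟩⟩
  obtain ⟨-, hN, hNn, hNt⟩ := Finset.mem_filter.1 hN
  have hNu : u ∈ N.biUnion ends := by
    by_contra e; exact hut ⟨N, hN, hNn, e, hNt⟩
  have hNw : w ∈ N.biUnion ends := by
    by_contra e; exact htw ⟨N, hN, hNn, hNt, e⟩
  obtain ⟨x, hx, hxN, hxt⟩ : ∃ x ∈ K.biUnion ends, x ∉ N.biUnion ends ∧ x ≠ t := by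
    by_contra! hc
    have hsub : K.biUnion ends ⊆ insert t (((N.biUnion ends).erase u).erase w) := by
      intro x hx
      by_cases hxN : x ∈ N.biUnion ends
      · refine Finset.mem_insert_of_mem (Finset.mem_erase.2 ⟨?_, Finset.mem_erase.2 ⟨?_, hxN⟩⟩)
        · rintro rfl; exact hKw hx
        · rintro rfl; exact hKu hx
      · rw [hc x hx hxN]; exact Finset.mem_insert_self _ _
    have h1 := (Finset.card_le_card hsub).trans (Finset.card_insert_le _ _)
    rw [Finset.card_erase_of_mem (Finset.mem_erase.2 ⟨huw.symm, hNw⟩),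
      Finset.card_erase_of_mem hNu, g.card_biUnion hK, g.card_biUnion hN] at h1
    have := h.two_le
    omega
  obtain ⟨k, hk, hxk⟩ := Finset.mem_biUnion.1 hx
  obtain ⟨y, hyk, hyN⟩ := g.exists_mem_biUnion h hN hNn k
  obtain ⟨m, hm, hym⟩ := Finset.mem_biUnion.1 hyN
  have hxy : x ≠ y := by rintro rfl; exact hxN hyN
  have hends : ∀ z ∈ ends k, z = x ∨ z = y := by
    intro z hz
    rw [g.ends_eq hxk hyk hxy] at hz
    simpa using hz
  have hkm : k ≠ m := by
    rintro rfl
    exact hxN (Finset.mem_biUnion.2 ⟨k, hm, hxk⟩)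
  have hmK : m ∉ K := fun e => g.stb y k hyk m hym (hK k hk m e hkm)
  have hclq : ∀ a ∈ N.erase m, ∀ b ∈ N.erase m, a ≠ b → G.Adj a b := fun a ha b hb =>
    hN a (Finset.mem_of_mem_erase ha) b (Finset.mem_of_mem_erase hb)
  have hkmiss : ∀ e ∈ ends k, e ∉ (N.erase m).biUnion ends := by
    intro e he hc
    obtain ⟨z, hz, hez⟩ := Finset.mem_biUnion.1 hc
    obtain ⟨hzm, hzN⟩ := Finset.mem_erase.1 hz
    rcases hends e he with rfl | rfl
    · exact hxN (Finset.mem_biUnion.2 ⟨z, hzN, hez⟩)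
    · exact g.stb e z hez m hym (hN z hzN m hm hzm)
  obtain ⟨h1, h2⟩ := clique_insert hclq (g.adj_of_not_mem hkmiss)
  have hcard : (insert k (N.erase m)).card = n := by
    rw [Finset.card_insert_of_notMem h2, Finset.card_erase_of_mem hm, hNn]
    have := h.two_le
    omega
  have hmem : t ∉ (insert k (N.erase m)).biUnion ends := by
    intro hc
    obtain ⟨z, hz, hez⟩ := Finset.mem_biUnion.1 hc
    rcases Finset.mem_insert.1 hz with rfl | hz
    · rcases hends t hez with e | e
      · exact hxt e.symm
      · exact hNt (e ▸ hyN)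
    · exact hNt (Finset.mem_biUnion.2 ⟨z, Finset.mem_of_mem_erase hz, hez⟩)
  have hle := hmax (insert k (N.erase m)) (Finset.mem_filter.2 ⟨Finset.mem_univ _, h1, hcard, hmem⟩)
  have hlt : K ∩ N ⊂ K ∩ insert k (N.erase m) := by
    refine Finset.ssubset_iff_subset_ne.2 ⟨fun a ha => ?_, fun e => ?_⟩
    · obtain ⟨haK, haN⟩ := Finset.mem_inter.1 ha
      refine Finset.mem_inter.2 ⟨haK, Finset.mem_insert_of_mem (Finset.mem_erase.2 ⟨?_, haN⟩)⟩
      rintro rfl; exact hmK haK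
    · have : k ∈ K ∩ N := e ▸ Finset.mem_inter.2 ⟨hk, Finset.mem_insert_self _ _⟩
      exact hxN (Finset.mem_biUnion.2 ⟨k, (Finset.mem_inter.1 this).2, hxk⟩)
  exact (Finset.card_lt_card hlt).not_ge hle

/-- Gallai's lemma: a clique on `n` vertices misses at most one element of `E`. -/
lemma eq_of_missed [Finite V] (g : CoLine G ends) (h : Crit G n) {u w : E}
    (huw : Missed G ends n u w) : u = w := by
  by_contra hne
  obtain ⟨a, ha⟩ := g.surj u
  obtain ⟨b, hb⟩ := g.surj w
  let C : Set E := {e | e = u ∨ ¬ Missed G ends n u e}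
  have hC : ∀ v, ∀ e ∈ ends v, ∀ f ∈ ends v, e ∈ C → f ∈ C := by
    intro v e he f hf heC
    by_cases hef : e = f
    · exact hef ▸ heC
    by_cases hfu : f = u
    · exact Or.inl hfu
    have hm := g.not_missed_of_mem h he hf hef
    rcases heC with rfl | heC
    · exact Or.inr hm
    · exact Or.inr (g.not_missed_trans h (fun e => hfu e.symm) heC hm)
  have hwC : w ∉ C := by
    rintro (e | e)
    · exact hne e.symm
    · exact e huw
  refine h.not_join {v | ∃ e ∈ ends v, e ∈ C} (a := a) (b := b) ⟨u, ha, Or.inl rfl⟩ ?_ ?_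
  · rintro ⟨e, he, heC⟩
    exact hwC (hC b e he w hb heC)
  · rintro x ⟨e, he, heC⟩ y hy
    have hd : ∀ f ∈ ends y, f ∉ C := fun f hf hfC => hy ⟨f, hf, hfC⟩
    have hne : x ≠ y := by rintro rfl; exact hd e he heC
    refine (g.adj x y hne).2 (Finset.disjoint_left.2 fun f hf hf' => hd f hf' (hC x e he f hf heC))

lemma card_le [Fintype E] [Finite V] (g : CoLine G ends) (h : Crit G n) :
    Fintype.card E ≤ 2 * n + 1 := by
  obtain ⟨t, -, ht, htn⟩ := h.exists_clique_disjoint (S := ∅) fun _ e => e.elim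
  have h1 : (t.biUnion ends)ᶜ.card ≤ 1 := Finset.card_le_one.2 fun a ha b hb =>
    g.eq_of_missed h ⟨t, ht, htn, Finset.mem_compl.1 ha, Finset.mem_compl.1 hb⟩
  have h2 := Finset.card_add_card_compl (t.biUnion ends)
  rw [g.card_biUnion ht, htn] at h2
  omega

lemma le_card [Fintype E] (g : CoLine G ends) (h : Crit G n) : 2 * n ≤ Fintype.card E := by
  obtain ⟨t, -, ht, htn⟩ := h.exists_clique_disjoint (S := ∅) fun _ e => e.elim
  rw [← htn, ← g.card_biUnion ht]
  exact Finset.card_le_univ _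

/-- The elements of `E` joined to `e`. -/
noncomputable def nbr [Fintype E] (ends : V → Finset E) (e : E) : Finset E := by
  classical exact Finset.univ.filter fun f => f ≠ e ∧ ∃ v, e ∈ ends v ∧ f ∈ ends v

lemma mem_nbr [Fintype E] {e f : E} :
    f ∈ nbr ends e ↔ f ≠ e ∧ ∃ v, e ∈ ends v ∧ f ∈ ends v := by
  simp [nbr]

lemma four_le_card_nbr [Fintype E] [Finite V] (g : CoLine G ends) (h : Crit G n) (e : E) :
    4 ≤ (nbr ends e).card := by
  by_contra! hlt
  have hn := h.three_le
  have h1 := g.le_card h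
  have h2 := g.card_le h
  obtain ⟨D, hD1, hD2, hD3⟩ := Finset.exists_subsuperset_card_eq (s := nbr ends e)
    (t := Finset.univ.erase e) (n := 3)
    (fun f hf => Finset.mem_erase.2 ⟨(mem_nbr.1 hf).1, Finset.mem_univ _⟩) (by omega)
    (by rw [Finset.card_erase_of_mem (Finset.mem_univ _), Finset.card_univ]; omega)
  obtain ⟨x, y, z, -, -, -, rfl⟩ := Finset.card_eq_three.1 hD3
  have hdisj : ∀ v, Disjoint (ends v) {x, y, z} → Disjoint (ends v) (insert e {x, y, z}) := by
    intro v hv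
    refine Finset.disjoint_insert_right.2 ⟨fun he => ?_, hv⟩
    obtain ⟨f, hf, hfe⟩ := Finset.exists_mem_ne (by rw [g.card v]; omega) e
    exact Finset.disjoint_left.1 hv hf (hD1 (mem_nbr.2 ⟨hfe, v, he, hf⟩))
  have h3 : ColOn G {v | Disjoint (ends v) {x, y, z}} (3 * (n - 2) / 2) := by
    refine h.low _ (by omega) _ ?_
    intro t ht ht'
    have hs : t.biUnion ends ⊆ (insert e {x, y, z})ᶜ := by
      intro f hf
      obtain ⟨v, hv, hfv⟩ := Finset.mem_biUnion.1 hf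
      exact Finset.mem_compl.2 (Finset.disjoint_left.1 (hdisj v (ht v hv)) hfv)
    have h4 := Finset.card_le_card hs
    have h5 : e ∉ ({x, y, z} : Finset E) := fun e' => (Finset.mem_erase.1 (hD2 e')).1 rfl
    rw [Finset.card_compl, Finset.card_insert_of_notMem h5, hD3, g.card_biUnion ht'] at h4
    omega
  refine h.notCol ((h3.union ((colOn_one (g.stb x)).union ((colOn_one (g.stb y)).union
    (colOn_one (g.stb z))))).mono (fun v _ => ?_) (by omega))
  simp only [Set.mem_union, Set.mem_ofPred_eq, Finset.disjoint_insert_right,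
    Finset.disjoint_singleton_right]
  grind

lemma nbr_inter [Fintype E] [Finite V] (g : CoLine G ends) (h : Crit G n) {p q r s : E}
    (hpr : p ≠ r) (hqs : q ≠ s) (hq : q ∈ nbr ends p) (hs : s ∈ nbr ends p)
    (hrq : r ∈ nbr ends q) (hrs : r ∈ nbr ends s) : False := by
  obtain ⟨hqp, a, hap, haq⟩ := mem_nbr.1 hq
  obtain ⟨hsp, b, hbp, hbs⟩ := mem_nbr.1 hs
  obtain ⟨hrq, c, hcq, hcr⟩ := mem_nbr.1 hrq
  obtain ⟨hrs, d, hds, hdr⟩ := mem_nbr.1 hrs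
  have e1 := g.ends_eq hap haq hqp.symm
  have e2 := g.ends_eq hbp hbs hsp.symm
  have e3 := g.ends_eq hcq hcr hrq.symm
  have e4 := g.ends_eq hds hdr hrs.symm
  have hadj : ∀ u v, Disjoint (ends u) (ends v) → G.Adj u v := by
    intro u v hd
    refine (g.adj u v ?_).2 hd
    rintro rfl
    have h1 := g.card u
    rw [disjoint_self.1 hd] at h1
    simp at h1
  refine h.no_two_K2 (hadj a d ?_) (hadj b c ?_) (g.stb p a hap b hbp) (g.stb q a haq c hcq)
    (g.stb s d hds b hbs) (g.stb r d hdr c hcr)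
  · rw [e1, e4]; simp; grind
  · rw [e2, e3]; simp; grind

lemma false [Fintype E] [Finite V] (g : CoLine G ends) (h : Crit G n) : False := by
  have hn := h.two_le
  have hn5 := h.le_five
  have hle := g.card_le h
  have hge := g.le_card h
  obtain ⟨x⟩ : Nonempty E := Fintype.card_pos_iff.1 (by omega)
  have hsub : ((nbr ends x).biUnion fun y => (nbr ends y).erase x) ⊆ Finset.univ.erase x := by
    intro z hz
    obtain ⟨y, -, hz⟩ := Finset.mem_biUnion.1 hz
    exact Finset.mem_erase.2 ⟨(Finset.mem_erase.1 hz).1, Finset.mem_univ _⟩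
  have h1 := Finset.card_le_card hsub
  rw [Finset.card_biUnion, Finset.card_erase_of_mem (Finset.mem_univ _), Finset.card_univ] at h1
  · have h2 : (nbr ends x).card * 3 ≤ ∑ y ∈ nbr ends x, ((nbr ends y).erase x).card := by
      rw [← smul_eq_mul]
      refine Finset.card_nsmul_le_sum _ _ _ fun y _ => ?_
      have := g.four_le_card_nbr h y
      have := Finset.pred_card_le_card_erase (s := nbr ends y) (a := x)
      omega
    have := g.four_le_card_nbr h x
    omega
  · intro y hy y' hy' hne
    refine Finset.disjoint_left.2 fun z hz hz' => ?_
    obtain ⟨hzx, hz⟩ := Finset.mem_erase.1 hz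
    exact g.nbr_inter h hzx.symm hne hy hy' hz (Finset.mem_erase.1 hz').2

end CoLine
/-- The vertex `v` together with the nonneighbours of `v` on the side of `x`. -/
def line (G : SimpleGraph V) (v x : V) : Set V := {t | t = v ∨ Same G v x t}

namespace Crit

variable {n : ℕ} [Finite V]

lemma line_eq_of_same (h : Crit G n) {v x y : V} (hxy : Same G v x y) :
    line G v x = line G v y := by
  ext t
  exact or_congr Iff.rfl ⟨h.same_trans hxy.symm, h.same_trans hxy⟩

lemma line_comm (h : Crit G n) {v x : V} (hx : x ∈ non G v) : line G v x = line G x v := by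
  have key : ∀ {v x : V}, x ∈ non G v → line G v x ⊆ line G x v := by
    rintro v x hx t (rfl | ht)
    · exact Or.inr (h.same_refl (mem_non_comm.1 hx))
    · by_cases hxt : x = t
      · exact Or.inl hxt.symm
      · exact Or.inr (h.same_rotate ht hxt)
  exact (key hx).antisymm (key (mem_non_comm.1 hx))

lemma line_eq (h : Crit G n) {v x a b : V} (hx : x ∈ non G v) (ha : a ∈ line G v x)
    (hb : b ∈ line G v x) (hab : a ≠ b) : b ∈ non G a ∧ line G v x = line G a b := by
  have key : ∀ {a x : V}, b ∈ line G a x → a ≠ b → b ∈ non G a ∧ line G a x = line G a b := by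
    rintro a x (rfl | hb) hab
    · exact (hab rfl).elim
    · exact ⟨hb.2.1, h.line_eq_of_same hb⟩
  rcases ha with rfl | ha
  · exact key hb hab
  · have e : line G v x = line G a v := by rw [h.line_eq_of_same ha, h.line_comm ha.2.1]
    rw [e] at hb ⊢
    exact key hb hab

/-- A critical graph is the complement of a line graph. -/
lemma exists_coLine (h : Crit G n) : ∃ (E : Set (Set V)) (_ : Fintype E) (_ : DecidableEq E)
    (ends : V → Finset E), CoLine G ends := by
  classical
  have := Fintype.ofFinite V
  let E : Set (Set V) := {l | ∃ v x, x ∈ non G v ∧ l = line G v x}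
  let mk : ∀ v x : V, x ∈ non G v → E := fun v x hx => ⟨line G v x, v, x, hx, rfl⟩
  have hE : Fintype E := Fintype.ofFinite E
  have hmem : ∀ {v x t : V} (hx : x ∈ non G v), t = v ∨ Same G v x t → t ∈ (mk v x hx).1 :=
    fun _ ht => ht
  have heq : ∀ (l : E) (a b : V), a ∈ l.1 → b ∈ l.1 → a ≠ b →
      ∃ hb : b ∈ non G a, l = mk a b hb := by
    rintro ⟨l, v, x, hx, rfl⟩ a b ha hb hab
    obtain ⟨h1, h2⟩ := h.line_eq hx ha hb hab
    exact ⟨h1, Subtype.ext h2⟩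
  have hex : ∀ (l : E) (a : V), a ∈ l.1 → ∃ b ∈ l.1, a ≠ b := by
    rintro ⟨l, v, x, hx, rfl⟩ a ha
    by_cases hav : a = v
    · exact ⟨x, Or.inr (h.same_refl hx), hav ▸ hx.1.symm⟩
    · exact ⟨v, Or.inl rfl, hav⟩
  let ends : V → Finset E := fun v => Finset.univ.filter fun l => v ∈ l.1
  have hends : ∀ v l, l ∈ ends v ↔ v ∈ l.1 := fun v l => by simp [ends]
  have htwo : ∀ v, ∃ a b, a ≠ b ∧ ends v = {a, b} := by
    intro v
    obtain ⟨x, hx⟩ := h.exists_mem_non v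
    obtain ⟨y, hy, hxy⟩ := h.exists_not_same hx
    refine ⟨mk v x hx, mk v y hy, fun e => ?_, ?_⟩
    · have e1 : y ∈ line G v x := by
        rw [show line G v x = line G v y from congrArg Subtype.val e]
        exact Or.inr (h.same_refl hy)
      exact hxy (e1.resolve_left hy.1)
    · ext l
      rw [hends, Finset.mem_insert, Finset.mem_singleton]
      constructor
      · intro hl
        obtain ⟨b, hb, hvb⟩ := hex l v hl
        obtain ⟨hbn, rfl⟩ := heq l v b hl hb hvb
        by_cases hxb : Same G v x b
        · exact Or.inl (Subtype.ext (h.line_eq_of_same hxb.symm))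
        · exact Or.inr (Subtype.ext (h.line_eq_of_same (h.same_of_not hx hbn hy hxb hxy)))
      · rintro (rfl | rfl)
        · exact Or.inl rfl
        · exact Or.inl rfl
  refine ⟨E, hE, inferInstance, ends, ⟨fun v => ?_, fun u v huv => ?_, fun u v huv => ?_, ?_⟩⟩
  · obtain ⟨a, b, hab, e⟩ := htwo v
    rw [e, Finset.card_pair hab]
  · rw [Finset.disjoint_left]
    constructor
    · intro hadj l hl hl'
      obtain ⟨hv, -⟩ := heq l u v ((hends u l).1 hl) ((hends v l).1 hl') huv
      exact hv.2 hadj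
    · intro hd
      by_contra hadj
      have hv : v ∈ non G u := ⟨huv.symm, hadj⟩
      exact hd ((hends u (mk u v hv)).2 (Or.inl rfl))
        ((hends v (mk u v hv)).2 (Or.inr (h.same_refl hv)))
  · by_contra hne
    obtain ⟨a, b, hab, e⟩ := htwo u
    have ha : a ∈ ends u := by simp [e]
    have hb : b ∈ ends u := by simp [e]
    obtain ⟨_, e1⟩ := heq a u v ((hends u a).1 ha) ((hends v a).1 (huv ▸ ha)) hne
    obtain ⟨_, e2⟩ := heq b u v ((hends u b).1 hb) ((hends v b).1 (huv ▸ hb)) hne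
    exact hab (e1.trans e2.symm)
  · rintro ⟨l, v, x, hx, rfl⟩
    exact ⟨v, (hends v _).2 (Or.inl rfl)⟩

lemma false (h : Crit G n) : False := by
  obtain ⟨E, _, _, ends, g⟩ := h.exists_coLine
  exact g.false h

end Crit

lemma colOn_induce {S : Set V} {T : Set S} {k : ℕ} :
    ColOn (G.induce S) T k ↔ ColOn G (Subtype.val '' T) k := by
  classical
  constructor
  · rintro ⟨c, h1, h2⟩
    refine ⟨fun v => if hv : v ∈ S then c ⟨v, hv⟩ else 0, ?_, ?_⟩
    · rintro _ ⟨⟨v, hv⟩, hvT, rfl⟩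
      simpa [hv] using h1 _ hvT
    · rintro _ ⟨⟨u, hu⟩, huT, rfl⟩ _ ⟨⟨v, hv⟩, hvT, rfl⟩ huv
      simpa [hu, hv] using h2 _ huT _ hvT huv
  · rintro ⟨c, h1, h2⟩
    exact ⟨fun v => c v, fun v hv => h1 _ ⟨v, hv, rfl⟩,
      fun u hu v hv huv => h2 _ ⟨u, hu, rfl⟩ _ ⟨v, hv, rfl⟩ huv⟩

lemma clqLe_induce {S : Set V} {T : Set S} {m : ℕ} :
    ClqLe (G.induce S) T m ↔ ClqLe G (Subtype.val '' T) m := by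
  classical
  constructor
  · intro h t ht ht'
    have hS : ∀ x ∈ t, x ∈ S := fun x hx => by
      obtain ⟨y, -, rfl⟩ := ht x hx
      exact y.2
    have := h (t.subtype (· ∈ S)) (fun x hx => by
      obtain ⟨y, hy, e⟩ := ht x (Finset.mem_subtype.1 hx)
      rwa [← Subtype.ext e]) fun x hx y hy hxy =>
        ht' x (Finset.mem_subtype.1 hx) y (Finset.mem_subtype.1 hy) fun e => hxy (Subtype.ext e)
    rwa [Finset.card_subtype, Finset.filter_true_of_mem hS] at this
  · intro h t ht ht'
    have := h (t.map (Function.Embedding.subtype _)) (fun x hx => by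
      obtain ⟨y, hy, rfl⟩ := Finset.mem_map.1 hx
      exact ⟨y, ht y hy, rfl⟩) (fun x hx y hy hxy => by
      obtain ⟨x, hx', rfl⟩ := Finset.mem_map.1 hx
      obtain ⟨y, hy', rfl⟩ := Finset.mem_map.1 hy
      exact ht' x hx' y hy' fun e => hxy (congrArg _ e))
    rwa [Finset.card_map] at this

/-- A finite set of vertices of clique number `n ≤ 5` can be coloured with `3 * n / 2` colours. -/
theorem colOn_of_clqLe
    (p5 : ∀ a b c d e, G.Adj a b → G.Adj b c → G.Adj c d → G.Adj d e → ¬ G.Adj a c → ¬ G.Adj a d →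
      ¬ G.Adj a e → ¬ G.Adj b d → ¬ G.Adj b e → ¬ G.Adj c e → False)
    (kite : ∀ a b c d e, G.Adj a b → G.Adj b c → G.Adj c d → G.Adj e a → G.Adj e b → G.Adj e c →
      ¬ G.Adj a c → ¬ G.Adj a d → ¬ G.Adj b d → ¬ G.Adj e d → False)
    (n : ℕ) (hn : n ≤ 5) (S : Set V) (hS : S.Finite) (hc : ClqLe G S n) :
    ColOn G S (3 * n / 2) := by
  classical
  induction n using Nat.strong_induction_on generalizing S with
  | _ n ihn =>
  obtain ⟨k, hk⟩ : ∃ k, S.ncard = k := ⟨_, rfl⟩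
  induction k using Nat.strong_induction_on generalizing S with
  | _ k ihk =>
  subst hk
  by_cases hn0 : n = 0
  · subst hn0
    have : S = ∅ := by
      by_contra hne
      obtain ⟨x, hx⟩ := Set.nonempty_iff_ne_empty.2 hne
      have := hc {x} (by simpa using hx) (by simp)
      simp at this
    subst this
    exact ⟨fun _ => 0, fun _ e => e.elim, fun _ e => e.elim⟩
  by_cases hn1 : n = 1
  · subst hn1
    refine colOn_one fun u hu v hv huv => ?_
    have := hc {u, v} (by simp [hu, hv]) (by
      intro x hx y hy hxy
      simp only [Finset.mem_insert, Finset.mem_singleton] at hx hy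
      rcases hx with rfl | rfl <;> rcases hy with rfl | rfl
      · exact (hxy rfl).elim
      · exact huv
      · exact huv.symm
      · exact (hxy rfl).elim)
    rw [Finset.card_pair huv.ne] at this
    omega
  by_contra hcol
  have := hS.to_subtype
  have himg : Subtype.val '' (Set.univ : Set S) = S := by simp
  have hsub : ∀ T : Set S, Subtype.val '' T ⊆ S := fun T => by
    rintro _ ⟨x, -, rfl⟩
    exact x.2
  have h : Crit (G.induce S) n :=
    { p5 := fun a b c d e => p5 a b c d e
      kite := fun a b c d e => kite a b c d e
      two_le := by omega
      le_five := hn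
      clq := by rwa [clqLe_induce, himg]
      notCol := by rwa [colOn_induce, himg]
      col := fun T hT => by
        rw [colOn_induce]
        refine ihk _ ?_ _ (hS.subset (hsub T)) (hc.mono (hsub T)) rfl
        refine Set.ncard_lt_ncard ((hsub T).ssubset_of_ne fun e => hT ?_) hS
        exact Subtype.val_injective.image_injective (e.trans himg.symm)
      low := fun m hm T hT => by
        rw [colOn_induce]
        exact ihn m hm (by omega) _ (hS.subset (hsub T)) (clqLe_induce.1 hT) }
  exact h.false

end P5Kite

/-- Every (P_5, kite, K_6)-free graph is 7-colorable. -/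
theorem stmt6 {V : Type*} (G : SimpleGraph V)
    (hP5 : IsEmpty (SimpleGraph.pathGraph 5 ↪g G))
    (hkite : IsEmpty (kite ↪g G))
    (h6 : G.CliqueFree 6) :
    G.Colorable 7 := by
  classical
  have emb : ∀ {H : SimpleGraph (Fin 5)} (f : Fin 5 → V),
      (∀ i j, i < j → (H.Adj i j ↔ G.Adj (f i) (f j)) ∧ f i ≠ f j) → Nonempty (H ↪g G) := by
    intro H f hf
    have key : ∀ i j, (H.Adj i j ↔ G.Adj (f i) (f j)) ∧ (i ≠ j → f i ≠ f j) := by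
      intro i j
      rcases lt_trichotomy i j with e | rfl | e
      · exact ⟨(hf i j e).1, fun _ => (hf i j e).2⟩
      · simp
      · exact ⟨by rw [H.adj_comm, G.adj_comm]; exact (hf j i e).1, fun _ => (hf j i e).2.symm⟩
    exact ⟨⟨⟨f, fun i j e => by_contra fun e' => (key i j).2 e' e⟩, fun {i j} => (key i j).1.symm⟩⟩
  have hcol : ∀ S : Set V, S.Finite → P5Kite.ColOn G S 7 := by
    intro S hS
    refine P5Kite.colOn_of_clqLe ?_ ?_ 5 le_rfl S hS ?_
    · intro a b c d e hab hbc hcd hde hac had hae hbd hbe hce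
      refine not_isEmpty_iff.2 (emb (H := pathGraph 5) ![a, b, c, d, e] ?_) hP5
      intro i j hij
      rw [pathGraph_adj]
      have h1 := fun x => G.loopless.irrefl x
      have h2 := fun x y => G.adj_comm x y
      fin_cases i <;> fin_cases j <;> simp at hij ⊢ <;> grind
    · intro a b c d e hab hbc hcd hea heb hec hac had hbd hed
      refine not_isEmpty_iff.2 (emb (H := kite) ![a, b, c, d, e] ?_) hkite
      intro i j hij
      have h1 := fun x => G.loopless.irrefl x
      have h2 := fun x y => G.adj_comm x y
      fin_cases i <;> fin_cases j <;> simp [kite] at hij ⊢ <;> grind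
    · intro t _ ht
      by_contra! hlt
      obtain ⟨s, hs, hs6⟩ := Finset.exists_subset_card_eq (show 6 ≤ t.card by omega)
      exact h6 s ⟨fun x hx y hy hxy => ht x (hs hx) y (hs hy) hxy, hs6⟩
  refine nonempty_hom_of_forall_finite_subgraph_hom fun G' hG' => ?_
  refine Classical.choice ?_
  obtain ⟨c, h1, h2⟩ := hcol G'.verts hG'
  exact ⟨⟨fun v => ⟨c v, h1 v v.2⟩, fun {u v} huv e =>
    h2 u u.2 v v.2 (G'.adj_sub huv) (congrArg Fin.val e)⟩⟩
end
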